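/- arXiv:1911.09122 — 4 statements merged into one kernel-verified Lean document; each statement's English description precedes it below -/
import Mathlib

section
/- Let N > 0 and let (𝒳, 𝒴) be distributed according to a bivariate Gaussian on ℝ² with Var(𝒳) ≤ N/4, Var(𝒴) ≤ N/4, and Cov(𝒳, 𝒴) ≤ N/7. Then P(𝒳 − E[𝒳] ≥ √N and 𝒴 − E[𝒴] ≥ √N) ≤ 0.0051. -/
open MeasureTheory ProbabilityTheory

/-- The standard Gaussian measure on `Fin n → ℝ` (product of `n` standard normals). -/
noncomputable def stdGaussianPi (n : ℕ) : Measure (Fin n → ℝ) :=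
  Measure.pi fun _ => gaussianReal 0 1

/-- `μ` is the (possibly degenerate) multivariate Gaussian measure on `Fin n → ℝ` with
mean vector `m` and covariance matrix `S`: it is the pushforward of the standard Gaussian
under an affine map `x ↦ m + L x` with `L Lᵀ = S`. -/
def IsGaussianWith {n : ℕ} (μ : Measure (Fin n → ℝ)) (m : Fin n → ℝ)
    (S : Matrix (Fin n) (Fin n) ℝ) : Prop :=
  ∃ L : Matrix (Fin n) (Fin n) ℝ, L * L.transpose = S ∧
    μ = Measure.map (fun x => m + L.mulVec x) (stdGaussianPi n)

section GaussianTailAux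
open Set Filter Topology

lemma aux_tail_bound {f F F' : ℝ → ℝ} {a : ℝ} (hd : ∀ x ∈ Ici a, HasDerivAt F (F' x) x)
    (hf0 : ∀ x ∈ Ioi a, 0 ≤ f x) (hf : ∀ x ∈ Ioi a, f x ≤ -F' x)
    (hF : Tendsto F atTop (𝓝 0)) : ∫ x in Ioi a, f x ≤ F a := by
  have hn : ∀ x ∈ Ioi a, F' x ≤ 0 := fun x hx => by linarith [hf0 x hx, hf x hx]
  have h1 := integral_Ioi_of_hasDerivAt_of_nonpos' hd hn hF
  have h2 := integrableOn_Ioi_deriv_of_nonpos' hd hn hF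
  have h3 : ∫ x in Ioi a, f x ≤ ∫ x in Ioi a, -F' x := by
    apply integral_mono_of_nonneg
    · exact (ae_restrict_iff' measurableSet_Ioi).2 (Eventually.of_forall hf0)
    · exact h2.neg
    · exact (ae_restrict_iff' measurableSet_Ioi).2 (Eventually.of_forall hf)
  rw [integral_neg, h1] at h3
  linarith

/-- standard normal density -/
noncomputable def auxPhi (x : ℝ) : ℝ := (√(2 * Real.pi))⁻¹ * Real.exp (-x ^ 2 / 2)

lemma auxPhi_eq : gaussianPDFReal 0 1 = auxPhi := by
  ext x; simp [gaussianPDFReal, auxPhi]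

lemma auxPhi_pos (x : ℝ) : 0 < auxPhi x := by unfold auxPhi; positivity

lemma auxPhi_continuous : Continuous auxPhi := by unfold auxPhi; fun_prop

lemma auxPhi_integrable : Integrable auxPhi := auxPhi_eq ▸ integrable_gaussianPDFReal 0 1

lemma auxPhi_deriv (x : ℝ) : HasDerivAt auxPhi (-x * auxPhi x) x := by
  unfold auxPhi
  have h : HasDerivAt (fun x : ℝ => -x ^ 2 / 2) (-x) x := by
    have := ((hasDerivAt_pow 2 x).neg).div_const 2
    refine this.congr_deriv ?_
    norm_num
    ring
  refine (h.exp.const_mul (√(2 * Real.pi))⁻¹).congr_deriv ?_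
  ring

lemma auxPhi_antitone {x y : ℝ} (h : |x| ≤ |y|) : auxPhi y ≤ auxPhi x := by
  unfold auxPhi
  have := sq_le_sq.2 h
  gcongr

lemma auxPhi_tendsto : Tendsto auxPhi atTop (𝓝 0) := by
  unfold auxPhi
  rw [← mul_zero (√(2 * Real.pi))⁻¹]
  apply Tendsto.const_mul
  apply Real.tendsto_exp_atBot.comp
  have : Tendsto (fun x : ℝ => x ^ 2 / 2) atTop atTop :=
    (tendsto_pow_atTop (by norm_num)).atTop_div_const (by norm_num)
  have h2 := tendsto_neg_atTop_atBot.comp this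
  refine h2.congr fun x => ?_
  simp [neg_div]

/-- standard normal tail -/
noncomputable def auxQ (y : ℝ) : ℝ := ∫ x in Ioi y, auxPhi x

lemma auxQ_nonneg (y : ℝ) : 0 ≤ auxQ y :=
  integral_nonneg fun x => (auxPhi_pos x).le

lemma auxQ_deriv (y : ℝ) : HasDerivAt auxQ (-auxPhi y) y := by
  have h : auxQ = fun y => auxQ 0 - ∫ x in (0 : ℝ)..y, auxPhi x := by
    ext y
    have := intervalIntegral.integral_interval_add_Ioi (a := 0) (b := y)
      auxPhi_integrable.integrableOn auxPhi_integrable.integrableOn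
    unfold auxQ
    linarith
  rw [h]
  exact (auxPhi_continuous.integral_hasStrictDerivAt 0 y).hasDerivAt.const_sub _

lemma auxQ_antitone : Antitone auxQ :=
  antitone_of_hasDerivAt_nonpos auxQ_deriv (fun x => by simpa using (auxPhi_pos x).le)

lemma auxQ_continuous : Continuous auxQ :=
  continuous_iff_continuousAt.2 fun x => (auxQ_deriv x).continuousAt

lemma auxQ_convex : ConvexOn ℝ (Ici 0) auxQ := by
  apply MonotoneOn.convexOn_of_deriv (convex_Ici 0) auxQ_continuous.continuousOn
  · exact fun x _ => (auxQ_deriv x).differentiableAt.differentiableWithinAt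
  · intro x hx y hy hxy
    rw [(auxQ_deriv x).deriv, (auxQ_deriv y).deriv]
    simp only [interior_Ici, mem_Ioi] at hx hy
    have : auxPhi y ≤ auxPhi x := auxPhi_antitone (by rwa [abs_of_pos hx, abs_of_pos hy])
    linarith

lemma auxQ_le {y : ℝ} (hy : 0 ≤ y) : auxQ y ≤ auxPhi y * (1.1 * (y + 0.6)⁻¹) := by
  have key := aux_tail_bound (f := auxPhi) (F := fun y => auxPhi y * (1.1 * (y + 0.6)⁻¹))
    (F' := fun y => (-y * auxPhi y) * (1.1 * (y + 0.6)⁻¹)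
      + auxPhi y * (1.1 * (-1 / (y + 0.6) ^ 2))) (a := y) ?_ ?_ ?_ ?_
  · exact key
  · intro x hx
    have hx' : y ≤ x := hx
    have h0 : x + 0.6 ≠ 0 := by positivity [hy.trans hx']
    exact (auxPhi_deriv x).mul ((((hasDerivAt_id x).add_const (0.6 : ℝ)).inv h0).const_mul 1.1)
  · exact fun x _ => (auxPhi_pos x).le
  · intro x hx
    have hx' : y < x := hx
    have h0 : 0 < x + 0.6 := by linarith
    have h1 : 1 ≤ x * (1.1 * (x + 0.6)⁻¹) + 1.1 * (1 / (x + 0.6) ^ 2) := by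
      have : x * (1.1 * (x + 0.6)⁻¹) + 1.1 * (1 / (x + 0.6) ^ 2)
        = (1.1 * (x * (x + 0.6) + 1)) / (x + 0.6) ^ 2 := by field_simp
      rw [this, le_div_iff₀ (by positivity)]
      nlinarith [sq_nonneg (x - 2.7)]
    have := mul_le_mul_of_nonneg_left h1 (auxPhi_pos x).le
    calc auxPhi x = auxPhi x * 1 := by ring
      _ ≤ _ := this
      _ = _ := by ring
  · have h1 : Tendsto (fun y : ℝ => 1.1 * (y + 0.6)⁻¹) atTop (𝓝 (1.1 * 0)) :=
      ((tendsto_inv_atTop_zero.comp (tendsto_atTop_add_const_right _ _ tendsto_id))).const_mul _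
    simpa using auxPhi_tendsto.mul h1

lemma auxQ_2645 : auxQ 2.645 ≤ 0.0051 := by
  refine (auxQ_le (by norm_num)).trans ?_
  unfold auxPhi
  have h1 : (√(2 * Real.pi))⁻¹ ≤ 0.4 := by
    rw [inv_le_comm₀ (by positivity) (by norm_num)]
    apply Real.le_sqrt_of_sq_le
    nlinarith [Real.pi_gt_d2]
  have h2 : Real.exp (-2.645 ^ 2 / 2) ≤ 0.037 := by
    have : (28 : ℝ) ≤ Real.exp (2.645 ^ 2 / 2) := by
      have := Real.sum_le_exp_of_nonneg (x := 2.645 ^ 2 / 2) (by norm_num) 8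
      refine le_trans ?_ this
      norm_num [Finset.sum_range_succ, Nat.factorial]
    rw [neg_div, Real.exp_neg, inv_le_comm₀ (by positivity) (by norm_num)]
    exact le_trans (by norm_num) this
  calc _ ≤ (0.4 * 0.037) * (1.1 * (2.645 + 0.6 : ℝ)⁻¹) := by gcongr
    _ ≤ _ := by norm_num

lemma aux_stage2 : ∫ b in Ioi 0, auxPhi b * auxQ (2978 / 1320 + 689 / 1320 * b) ≤ 0.00255 := by
  have key := aux_tail_bound (f := fun b => auxPhi b * auxQ (2978 / 1320 + 689 / 1320 * b))
    (F := fun b => auxPhi b * auxPhi (2978 / 1320 + 689 / 1320 * b)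
      * (0.023 * (b + 2.7)⁻¹ + 1.418 * ((b + 2.7)⁻¹) ^ 2))
    (F' := fun b => ((-b * auxPhi b) * auxPhi (2978 / 1320 + 689 / 1320 * b)
      + auxPhi b * ((-(2978 / 1320 + 689 / 1320 * b) * auxPhi (2978 / 1320 + 689 / 1320 * b))
        * (689 / 1320))) * (0.023 * (b + 2.7)⁻¹ + 1.418 * ((b + 2.7)⁻¹) ^ 2)
      + auxPhi b * auxPhi (2978 / 1320 + 689 / 1320 * b) *
       (0.023 * (-1 / (b + 2.7) ^ 2)
        + 1.418 * (2 * (b + 2.7)⁻¹ * (-1 / (b + 2.7) ^ 2)))) (a := 0) ?_ ?_ ?_ ?_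
  · refine key.trans ?_
    have h2 : Real.exp (-(2978 / 1320) ^ 2 / 2) ≤ 1 / 12.73 := by
      have h3 : (12.73 : ℝ) ≤ Real.exp ((2978 / 1320) ^ 2 / 2) := by
        have := Real.sum_le_exp_of_nonneg (x := (2978 / 1320) ^ 2 / 2) (by norm_num) 12
        refine le_trans ?_ this
        norm_num [Finset.sum_range_succ, Nat.factorial]
      rw [neg_div, Real.exp_neg, one_div]
      exact inv_anti₀ (by norm_num) h3
    have h4 : (√(2 * Real.pi))⁻¹ * (√(2 * Real.pi))⁻¹ ≤ 1 / 6.28 := by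
      rw [← mul_inv, Real.mul_self_sqrt (by positivity), one_div]
      exact inv_anti₀ (by norm_num) (by linarith [Real.pi_gt_d2])
    have h5 : auxPhi 0 * auxPhi (2978 / 1320) ≤ 1 / 6.28 * (1 / 12.73) := by
      unfold auxPhi
      calc _ = ((√(2 * Real.pi))⁻¹ * (√(2 * Real.pi))⁻¹) * Real.exp (-(2978 / 1320) ^ 2 / 2) := by
            simp; ring
        _ ≤ _ := by gcongr
    calc _ = auxPhi 0 * auxPhi (2978 / 1320) * (0.023 * (2.7)⁻¹ + 1.418 * ((2.7)⁻¹) ^ 2) := by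
          simp
      _ ≤ 1 / 6.28 * (1 / 12.73) * (0.023 * (2.7)⁻¹ + 1.418 * ((2.7)⁻¹) ^ 2) := by gcongr
      _ ≤ _ := by norm_num
  · intro x hx
    have hx' : 0 ≤ x := hx
    have h0 : x + 2.7 ≠ 0 := by positivity
    have hi := ((hasDerivAt_id x).add_const (2.7 : ℝ)).inv h0
    have hlin : HasDerivAt (fun b : ℝ => 2978 / 1320 + 689 / 1320 * b) (689 / 1320) x := by
      simpa using ((hasDerivAt_id x).const_mul (689 / 1320 : ℝ)).const_add (2978 / 1320)
    have hc := HasDerivAt.comp x (auxPhi_deriv (2978 / 1320 + 689 / 1320 * x)) hlin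
    have := ((auxPhi_deriv x).mul hc).mul ((hi.const_mul 0.023).add ((hi.pow 2).const_mul 1.418))
    refine this.congr_deriv ?_
    simp
  · exact fun x _ => mul_nonneg (auxPhi_pos x).le (auxQ_nonneg _)
  · intro x hx
    have hx' : 0 < x := hx
    have hp := auxPhi_pos x
    have hp2 := auxPhi_pos (2978 / 1320 + 689 / 1320 * x)
    have h1 := auxQ_le (y := 2978 / 1320 + 689 / 1320 * x) (by positivity)
    have h2 : 1.1 * ((2978 / 1320 + 689 / 1320 * x) + 0.6)⁻¹ ≤
        (x + (2978 / 1320 + 689 / 1320 * x) * (689 / 1320)) *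
        (0.023 * (x + 2.7)⁻¹ + 1.418 * ((x + 2.7)⁻¹) ^ 2) + (0.023 * (1 / (x + 2.7) ^ 2)
        + 1.418 * (2 * (x + 2.7)⁻¹ * (1 / (x + 2.7) ^ 2))) := by
      have e : (x + (2978 / 1320 + 689 / 1320 * x) * (689 / 1320)) *
        (0.023 * (x + 2.7)⁻¹ + 1.418 * ((x + 2.7)⁻¹) ^ 2) + (0.023 * (1 / (x + 2.7) ^ 2)
        + 1.418 * (2 * (x + 2.7)⁻¹ * (1 / (x + 2.7) ^ 2))) =
        ((x + (2978 / 1320 + 689 / 1320 * x) * (689 / 1320)) *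
        (0.023 * (x + 2.7) ^ 2 + 1.418 * (x + 2.7)) + 0.023 * (x + 2.7) + 2 * 1.418)
          / (x + 2.7) ^ 3 := by field_simp; ring
      rw [e, ← div_eq_mul_inv, div_le_div_iff₀ (by positivity) (by positivity)]
      have h3 : 0 < x ^ 3 := by positivity
      have h4 : 0 < x ^ 4 := by positivity
      nlinarith [sq_nonneg (x - 0.404)]
    calc auxPhi x * auxQ (2978 / 1320 + 689 / 1320 * x)
        ≤ auxPhi x * (auxPhi (2978 / 1320 + 689 / 1320 * x) *
          (1.1 * ((2978 / 1320 + 689 / 1320 * x) + 0.6)⁻¹)) := by gcongr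
      _ ≤ auxPhi x * (auxPhi (2978 / 1320 + 689 / 1320 * x) *
          ((x + (2978 / 1320 + 689 / 1320 * x) * (689 / 1320)) *
        (0.023 * (x + 2.7)⁻¹ + 1.418 * ((x + 2.7)⁻¹) ^ 2) + (0.023 * (1 / (x + 2.7) ^ 2)
        + 1.418 * (2 * (x + 2.7)⁻¹ * (1 / (x + 2.7) ^ 2))))) := by gcongr
      _ = _ := by ring
  · have hi : Tendsto (fun y : ℝ => (y + 2.7)⁻¹) atTop (𝓝 0) :=
      tendsto_inv_atTop_zero.comp (tendsto_atTop_add_const_right _ _ tendsto_id)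
    have hl : Tendsto (fun b : ℝ => 2978 / 1320 + 689 / 1320 * b) atTop atTop :=
      tendsto_atTop_add_const_left _ _ (tendsto_id.const_mul_atTop (by norm_num))
    have := (auxPhi_tendsto.mul (auxPhi_tendsto.comp hl)).mul
      ((hi.const_mul 0.023).add ((hi.pow 2).const_mul 1.418))
    simpa using this

lemma aux_meas {α : Type*} [MeasurableSpace α] {f g f' g' : α → ℝ} (hf : Measurable f)
    (hg : Measurable g) (hf' : Measurable f') (hg' : Measurable g') :
    MeasurableSet {p | f p ≤ g p ∧ f' p ≤ g' p} := by
  have := (measurableSet_le hf hg).inter (measurableSet_le hf' hg')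
  convert this using 1
  ext p
  simp

lemma aux_gauss_Ici (y : ℝ) : gaussianReal 0 1 (Ici y) = ENNReal.ofReal (auxQ y) := by
  rw [gaussianReal_apply_eq_integral 0 one_ne_zero, auxPhi_eq, integral_Ici_eq_integral_Ioi]
  rfl

lemma aux_anderson_pos (p r : ℝ) (hp : 0 ≤ p) (hr : 0 ≤ r) :
    ∫ x in (p - r)..(p + r), auxPhi x ≤ ∫ x in (-r)..r, auxPhi x := by
  have hi : ∀ a b : ℝ, IntervalIntegrable auxPhi volume a b :=
    fun a b => auxPhi_continuous.intervalIntegrable a b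
  have h1 := intervalIntegral.integral_add_adjacent_intervals (hi (-r) (p - r)) (hi (p - r) (p + r))
  have h2 := intervalIntegral.integral_add_adjacent_intervals (hi (-r) r) (hi r (p + r))
  have h3 : ∫ x in (-r)..(p - r), auxPhi x = ∫ x in (0 : ℝ)..p, auxPhi (x - r) := by
    rw [intervalIntegral.integral_comp_sub_right]; simp
  have h4 : ∫ x in r..(p + r), auxPhi x = ∫ x in (0 : ℝ)..p, auxPhi (x + r) := by
    rw [intervalIntegral.integral_comp_add_right]; simp
  have h5 : ∫ x in (0 : ℝ)..p, auxPhi (x + r) ≤ ∫ x in (0 : ℝ)..p, auxPhi (x - r) := by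
    apply intervalIntegral.integral_mono_on hp
    · exact (auxPhi_continuous.comp (by fun_prop)).intervalIntegrable _ _
    · exact (auxPhi_continuous.comp (by fun_prop)).intervalIntegrable _ _
    · intro x hx
      apply auxPhi_antitone
      rw [abs_of_nonneg (by linarith [hx.1] : 0 ≤ x + r), abs_le]
      constructor <;> linarith [hx.1]
  linarith

lemma aux_anderson_all (p r : ℝ) (hr : 0 ≤ r) :
    ∫ x in (p - r)..(p + r), auxPhi x ≤ ∫ x in (-r)..r, auxPhi x := by
  rcases le_total 0 p with hp | hp
  · exact aux_anderson_pos p r hp hr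
  · have h := aux_anderson_pos (-p) r (by linarith) hr
    have e : ∫ x in (p - r)..(p + r), auxPhi x = ∫ x in (-p - r)..(-p + r), auxPhi x := by
      have h1 := intervalIntegral.integral_comp_neg (a := p - r) (b := p + r) auxPhi
      have h2 : (fun x => auxPhi (-x)) = auxPhi := by
        ext x; simp [auxPhi]
      rw [show (∫ x in (p - r)..(p + r), auxPhi (-x)) = ∫ x in (p - r)..(p + r), auxPhi x by
        rw [h2]] at h1
      rw [h1]
      congr 1 <;> ring
    rw [e]; exact h

lemma aux_anderson_Icc (p r : ℝ) :
    gaussianReal 0 1 (Icc (p - r) (p + r)) ≤ gaussianReal 0 1 (Icc (-r) r) := by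
  rcases lt_or_ge r 0 with hr | hr
  · rw [Icc_eq_empty (by linarith)]; simp
  · rw [gaussianReal_apply_eq_integral 0 one_ne_zero, gaussianReal_apply_eq_integral 0 one_ne_zero,
      auxPhi_eq, integral_Icc_eq_integral_Ioc, integral_Icc_eq_integral_Ioc,
      ← intervalIntegral.integral_of_le (by linarith),
      ← intervalIntegral.integral_of_le (by linarith)]
    exact ENNReal.ofReal_le_ofReal (aux_anderson_all p r hr)

lemma aux_anderson (σ d w : ℝ) :
    gaussianReal 0 1 {b | |σ * b - d| ≤ w} ≤ gaussianReal 0 1 {b | |σ * b| ≤ w} := by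
  rcases eq_or_ne σ 0 with rfl | hσ
  · apply measure_mono
    intro b hb
    simp only [mem_ofPred_eq, zero_mul, abs_zero] at *
    exact (abs_nonneg _).trans hb
  · have hs : 0 < |σ| := abs_pos.2 hσ
    have h1 : {b | |σ * b - d| ≤ w} = Icc (d / σ - w / |σ|) (d / σ + w / |σ|) := by
      ext b
      have : σ * b - d = σ * (b - d / σ) := by field_simp
      rw [mem_ofPred_eq, this, abs_mul, mul_comm, ← le_div_iff₀ hs, abs_le, mem_Icc]
      constructor <;> rintro ⟨h, h'⟩ <;> constructor <;> linarith
    have h2 : {b | |σ * b| ≤ w} = Icc (-(w / |σ|)) (w / |σ|) := by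
      ext b
      rw [mem_ofPred_eq, abs_mul, mul_comm, ← le_div_iff₀ hs, abs_le, mem_Icc]
    rw [h1, h2]
    exact aux_anderson_Icc _ _

lemma aux_wedge (C D h k : ℝ) (hC : 0 < C) :
    ((gaussianReal 0 1).prod (gaussianReal 0 1))
      {p : ℝ × ℝ | h ≤ C * p.1 + D * p.2 ∧ k ≤ C * p.1 - D * p.2} ≤
    ∫⁻ b, ENNReal.ofReal (auxQ ((h + k) / 2 / C + |D| / C * |b|)) ∂(gaussianReal 0 1) := by
  have hm1 : MeasurableSet {p : ℝ × ℝ | h ≤ C * p.1 + D * p.2 ∧ k ≤ C * p.1 - D * p.2} :=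
    aux_meas (by fun_prop) (by fun_prop) (by fun_prop) (by fun_prop)
  have hm2 : MeasurableSet {p : ℝ × ℝ | |D * p.2| ≤ C * p.1 - (h + k) / 2} :=
    measurableSet_le (by fun_prop) (by fun_prop)
  calc ((gaussianReal 0 1).prod (gaussianReal 0 1))
        {p : ℝ × ℝ | h ≤ C * p.1 + D * p.2 ∧ k ≤ C * p.1 - D * p.2}
      ≤ ((gaussianReal 0 1).prod (gaussianReal 0 1))
        {p : ℝ × ℝ | |D * p.2| ≤ C * p.1 - (h + k) / 2} := by
        rw [Measure.prod_apply hm1, Measure.prod_apply hm2]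
        apply lintegral_mono
        intro a
        have := aux_anderson D ((h - k) / 2) (C * a - (h + k) / 2)
        refine le_trans (measure_mono ?_) this
        rintro b ⟨h1, h2⟩
        simp only [mem_ofPred_eq] at *
        rw [abs_le]
        constructor <;> linarith
    _ = _ := by
        rw [Measure.prod_apply_symm hm2]
        apply lintegral_congr
        intro b
        rw [← aux_gauss_Ici]
        congr 1
        ext a
        simp only [mem_preimage, mem_ofPred_eq, mem_Ici, abs_mul]
        rw [← mul_div_right_comm, ← add_div, div_le_iff₀ hC]
        constructor <;> intro <;> linarith

lemma aux_Q_bounded_integrable {f : ℝ → ℝ} (hf : Continuous f) :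
    Integrable (fun b => auxQ (f b)) (gaussianReal 0 1) := by
  apply Integrable.of_bound (C := 1) (auxQ_continuous.comp hf).aestronglyMeasurable
  refine Eventually.of_forall fun b => ?_
  rw [Function.comp_apply, Real.norm_of_nonneg (auxQ_nonneg _)]
  have h : gaussianReal 0 1 (Ici (f b)) ≤ 1 := prob_le_one
  rw [aux_gauss_Ici] at h
  simpa using h

lemma aux_T0 : ∫ b, auxQ (2978 / 1320 + 689 / 1320 * |b|) ∂(gaussianReal 0 1) ≤ 0.0051 := by
  rw [integral_gaussianReal_eq_integral_smul one_ne_zero, auxPhi_eq]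
  have h : (fun b => auxPhi b • auxQ (2978 / 1320 + 689 / 1320 * |b|)) =
      fun b => (fun b => auxPhi b * auxQ (2978 / 1320 + 689 / 1320 * b)) |b| := by
    ext b
    simp [auxPhi]
  rw [h, integral_comp_abs (f := fun b => auxPhi b * auxQ (2978 / 1320 + 689 / 1320 * b))]
  linarith [aux_stage2]

lemma aux_T (c s : ℝ) (hs : 0 ≤ s) (hc0 : 0 ≤ c) (hc1 : 4 * (1 + s ^ 2) ≤ c ^ 2)
    (hc2 : 7 * (1 - s ^ 2) ≤ c ^ 2) :
    ∫ b, auxQ (c + s * |b|) ∂(gaussianReal 0 1) ≤ 0.0051 := by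
  rcases le_total (689 / 1320) s with h | h
  · refine le_trans (integral_mono (aux_Q_bounded_integrable (by fun_prop))
      (aux_Q_bounded_integrable (by fun_prop)) ?_) aux_T0
    intro b
    apply auxQ_antitone
    have : 2978 / 1320 ≤ c := by
      apply le_of_sq_le_sq _ hc0
      nlinarith
    gcongr
  · obtain ⟨l, hl⟩ : ∃ l, l = s / (689 / 1320) := ⟨_, rfl⟩
    have hsl : s = 689 / 1320 * l := by rw [hl]; field_simp
    have l0 : 0 ≤ l := by rw [hl]; positivity
    have l1 : l ≤ 1 := by rw [hl]; exact (div_le_one (by norm_num)).2 h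
    have hc : (1 - l) * 2.645 + l * (2978 / 1320) ≤ c := by
      apply le_of_sq_le_sq _ hc0
      refine le_trans ?_ hc2
      rw [hsl]
      nlinarith [mul_nonneg l0 (sub_nonneg.2 l1)]
    calc ∫ b, auxQ (c + s * |b|) ∂(gaussianReal 0 1)
        ≤ ∫ b, ((1 - l) * auxQ 2.645 + l * auxQ (2978 / 1320 + 689 / 1320 * |b|))
          ∂(gaussianReal 0 1) := by
          apply integral_mono (aux_Q_bounded_integrable (by fun_prop))
          · exact (integrable_const _).add
              ((aux_Q_bounded_integrable (by fun_prop)).const_mul _)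
          intro b
          have := auxQ_convex.2 (x := 2.645) (by simp; norm_num)
            (y := 2978 / 1320 + 689 / 1320 * |b|) (by simp; positivity)
            (sub_nonneg.2 l1) l0 (by ring)
          refine le_trans (auxQ_antitone ?_) this
          simp only [smul_eq_mul]
          rw [hsl]
          linarith
      _ = (1 - l) * auxQ 2.645 + l * ∫ b, auxQ (2978 / 1320 + 689 / 1320 * |b|)
          ∂(gaussianReal 0 1) := by
          rw [integral_add (integrable_const _)
            ((aux_Q_bounded_integrable (by fun_prop)).const_mul _)]
          simp [integral_const_mul]
      _ ≤ _ := by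
          have := aux_T0
          have := auxQ_2645
          nlinarith

lemma aux_wedge_bound (C D h k : ℝ) (hC : 0 < C) (hCD : C ^ 2 + D ^ 2 = 1) (hh : 2 ≤ h)
    (hk : 2 ≤ k) (hhk : 7 * (C ^ 2 - D ^ 2) ≤ h * k) :
    ((gaussianReal 0 1).prod (gaussianReal 0 1))
      {p : ℝ × ℝ | h ≤ C * p.1 + D * p.2 ∧ k ≤ C * p.1 - D * p.2} ≤ ENNReal.ofReal 0.0051 := by
  refine (aux_wedge C D h k hC).trans ?_
  rw [← ofReal_integral_eq_lintegral_ofReal (aux_Q_bounded_integrable (by fun_prop))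
    (Eventually.of_forall fun b => auxQ_nonneg _)]
  apply ENNReal.ofReal_le_ofReal
  apply aux_T
  · positivity
  · positivity
  · rw [div_pow, div_pow, sq_abs, le_div_iff₀ (by positivity)]
    have : (1 + D ^ 2 / C ^ 2) * C ^ 2 = 1 := by field_simp; linarith
    nlinarith
  · rw [div_pow, div_pow, sq_abs, le_div_iff₀ (by positivity)]
    have : (1 - D ^ 2 / C ^ 2) * C ^ 2 = C ^ 2 - D ^ 2 := by field_simp
    nlinarith [sq_nonneg (h - k)]

lemma aux_polar (a b : ℝ) : ∃ r t : ℝ, 0 ≤ r ∧ a = r * Real.cos t ∧ b = r * Real.sin t := by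
  refine ⟨‖(⟨a, b⟩ : ℂ)‖, Complex.arg ⟨a, b⟩, norm_nonneg _, ?_, ?_⟩
  · rw [Complex.norm_mul_cos_arg]
  · rw [Complex.norm_mul_sin_arg]

lemma aux_core_angle (n σ σ' θ δ : ℝ) (hn : 0 < n) (h1 : 0 ≤ σ) (h2 : 0 ≤ σ')
    (hX : σ ^ 2 ≤ n ^ 2 / 4) (hY : σ' ^ 2 ≤ n ^ 2 / 4)
    (hXY : σ * σ' * Real.cos (2 * δ) ≤ n ^ 2 / 7) (hδ : 0 ≤ Real.cos δ) :
    ((gaussianReal 0 1).prod (gaussianReal 0 1))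
      {p : ℝ × ℝ | n ≤ σ * Real.cos (θ + δ) * p.1 + σ * Real.sin (θ + δ) * p.2 ∧
        n ≤ σ' * Real.cos (θ - δ) * p.1 + σ' * Real.sin (θ - δ) * p.2}
      ≤ ENNReal.ofReal 0.0051 := by
  rcases h1.eq_or_lt with rfl | h1
  · simp [hn.not_ge]
  rcases h2.eq_or_lt with rfl | h2
  · simp [hn.not_ge]
  have hrot := IsGaussian.map_rotation_eq_self (μ := gaussianReal 0 1)
    (by simp) θ
  have hmeas : MeasurableSet {p : ℝ × ℝ | n / σ ≤ Real.cos δ * p.1 + Real.sin δ * p.2 ∧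
      n / σ' ≤ Real.cos δ * p.1 - Real.sin δ * p.2} :=
    aux_meas (by fun_prop) (by fun_prop) (by fun_prop) (by fun_prop)
  have e : {p : ℝ × ℝ | n ≤ σ * Real.cos (θ + δ) * p.1 + σ * Real.sin (θ + δ) * p.2 ∧
        n ≤ σ' * Real.cos (θ - δ) * p.1 + σ' * Real.sin (θ - δ) * p.2} =
      (ContinuousLinearMap.rotation θ) ⁻¹'
      {p : ℝ × ℝ | n / σ ≤ Real.cos δ * p.1 + Real.sin δ * p.2 ∧
        n / σ' ≤ Real.cos δ * p.1 - Real.sin δ * p.2} := by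
    ext ⟨x, y⟩
    simp only [mem_preimage, mem_ofPred_eq, ContinuousLinearMap.rotation_apply, smul_eq_mul,
      div_le_iff₀ h1, div_le_iff₀ h2, Real.cos_add, Real.sin_add, Real.cos_sub, Real.sin_sub]
    apply and_congr <;> apply le_iff_le_of_cmp_eq_cmp <;> congr 1 <;> ring
  rw [e, ← Measure.map_apply (by fun_prop) hmeas, hrot]
  rcases hδ.eq_or_lt with h0 | h0
  · rw [← h0]
    have : {p : ℝ × ℝ | n / σ ≤ 0 * p.1 + Real.sin δ * p.2 ∧
      n / σ' ≤ 0 * p.1 - Real.sin δ * p.2} = ∅ := by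
      ext p
      simp only [mem_ofPred_eq, mem_empty_iff_false, iff_false, not_and, not_le]
      intro h
      have : 0 < n / σ := by positivity
      have : 0 < n / σ' := by positivity
      linarith
    rw [this]; simp
  · apply aux_wedge_bound _ _ _ _ h0 (by simp)
    · rw [le_div_iff₀ h1]
      apply le_of_sq_le_sq _ hn.le
      nlinarith
    · rw [le_div_iff₀ h2]
      apply le_of_sq_le_sq _ hn.le
      nlinarith
    · rw [← Real.cos_two_mul', div_mul_div_comm, le_div_iff₀ (by positivity)]
      nlinarith

lemma aux_core (n a b a' b' : ℝ) (hn : 0 < n) (hX : a ^ 2 + b ^ 2 ≤ n ^ 2 / 4)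
    (hY : a' ^ 2 + b' ^ 2 ≤ n ^ 2 / 4) (hXY : a * a' + b * b' ≤ n ^ 2 / 7) :
    ((gaussianReal 0 1).prod (gaussianReal 0 1))
      {p : ℝ × ℝ | n ≤ a * p.1 + b * p.2 ∧ n ≤ a' * p.1 + b' * p.2} ≤ ENNReal.ofReal 0.0051 := by
  obtain ⟨σ, α, h1, rfl, rfl⟩ := aux_polar a b
  obtain ⟨σ', β, h2, rfl, rfl⟩ := aux_polar a' b'
  have hX' : σ ^ 2 ≤ n ^ 2 / 4 := by
    nlinarith [Real.sin_sq_add_cos_sq α]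
  have hY' : σ' ^ 2 ≤ n ^ 2 / 4 := by
    nlinarith [Real.sin_sq_add_cos_sq β]
  have hXY' : σ * σ' * Real.cos (α - β) ≤ n ^ 2 / 7 := by
    rw [Real.cos_sub]; linarith
  rcases le_total 0 (Real.cos ((α - β) / 2)) with h | h
  · have := aux_core_angle n σ σ' ((α + β) / 2) ((α - β) / 2) hn h1 h2 hX' hY'
      (by rwa [mul_div_cancel₀ _ two_ne_zero]) h
    rwa [show (α + β) / 2 + (α - β) / 2 = α by ring,
      show (α + β) / 2 - (α - β) / 2 = β by ring] at this
  · have := aux_core_angle n σ σ' ((α + β) / 2 + Real.pi) ((α - β) / 2 + Real.pi) hn h1 h2 hX' hY'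
      (by rwa [show 2 * ((α - β) / 2 + Real.pi) = α - β + 2 * Real.pi by ring,
        Real.cos_add_two_pi]) (by rw [Real.cos_add_pi]; linarith)
    rwa [show (α + β) / 2 + Real.pi + ((α - β) / 2 + Real.pi) = α + 2 * Real.pi by ring,
      show (α + β) / 2 + Real.pi - ((α - β) / 2 + Real.pi) = β by ring,
      Real.cos_add_two_pi, Real.sin_add_two_pi] at this

end GaussianTailAux

/-- **Gaussian upper-tail lemma.** If `(𝒳, 𝒴)` is bivariate Gaussian with
`Var(𝒳) ≤ N/4`, `Var(𝒴) ≤ N/4` and `Cov(𝒳,𝒴) ≤ N/7`, then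
`P(𝒳 − E[𝒳] ≥ √N ∧ 𝒴 − E[𝒴] ≥ √N) ≤ 0.0051`. -/
theorem gaussian_joint_upper_tail (N : ℝ) (hN : 0 < N)
    (μ : Measure (Fin 2 → ℝ)) (m : Fin 2 → ℝ) (S : Matrix (Fin 2) (Fin 2) ℝ)
    (hG : IsGaussianWith μ m S)
    (hX : S 0 0 ≤ N / 4) (hY : S 1 1 ≤ N / 4) (hC : S 0 1 ≤ N / 7) :
    (μ {x | Real.sqrt N ≤ x 0 - m 0 ∧ Real.sqrt N ≤ x 1 - m 1}).toReal ≤ 0.0051 := by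
  obtain ⟨L, rfl, rfl⟩ := hG
  have hs : Real.sqrt N ^ 2 = N := Real.sq_sqrt hN.le
  simp only [Matrix.mul_apply, Matrix.transpose_apply, Fin.sum_univ_two] at hX hY hC
  have key := aux_core (Real.sqrt N) (L 0 0) (L 0 1) (L 1 0) (L 1 1) (Real.sqrt_pos.2 hN)
    (by rw [hs]; linarith) (by rw [hs]; linarith) (by rw [hs]; linarith)
  have hmeas : MeasurableSet {x : Fin 2 → ℝ | Real.sqrt N ≤ x 0 - m 0 ∧
      Real.sqrt N ≤ x 1 - m 1} :=
    aux_meas (by fun_prop) (by fun_prop) (by fun_prop) (by fun_prop)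
  have hmeas2 : MeasurableSet {p : ℝ × ℝ | Real.sqrt N ≤ L 0 0 * p.1 + L 0 1 * p.2 ∧
      Real.sqrt N ≤ L 1 0 * p.1 + L 1 1 * p.2} :=
    aux_meas (by fun_prop) (by fun_prop) (by fun_prop) (by fun_prop)
  have hmap : Measurable (fun x : Fin 2 → ℝ => m + L.mulVec x) := by
    have : Continuous (fun x : Fin 2 → ℝ => m + L.mulVec x) :=
      continuous_const.add (Continuous.matrix_mulVec continuous_const continuous_id)
    exact this.measurable
  rw [Measure.map_apply hmap hmeas]
  have hp := (measurePreserving_finTwoArrow (gaussianReal 0 1)).measure_preimage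
    hmeas2.nullMeasurableSet
  apply ENNReal.toReal_le_of_le_ofReal (by norm_num)
  rw [← hp] at key
  refine le_trans (measure_mono ?_) key
  intro x hx
  have e : ∀ i, (m + L.mulVec x) i - m i = L i 0 * x 0 + L i 1 * x 1 := fun i => by
    rw [Pi.add_apply, add_sub_cancel_left]
    simp only [Matrix.mulVec, dotProduct, Fin.sum_univ_two]
  rw [Set.mem_preimage, Set.mem_ofPred_eq, e 0, e 1] at hx
  exact hx
end

section
/- Let N > 0 and let (𝒳, 𝒴) be distributed according to a bivariate Gaussian on ℝ². If Var(𝒳) ≤ N/4, Var(𝒴) ≤ N/4, and Cov(𝒳, 𝒴) ≥ −N/7, then P(𝒳 − E[𝒳] ≥ √N and 𝒴 − E[𝒴] ≤ −√N) ≤ 0.0051. -/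
open MeasureTheory ProbabilityTheory

/-- standard normal density -/
noncomputable def ph (x : ℝ) : ℝ := (Real.sqrt (2 * Real.pi))⁻¹ * Real.exp (-x ^ 2 / 2)

/-- standard normal upper tail -/
noncomputable def Qt (y : ℝ) : ℝ := ∫ x in Set.Ioi y, ph x

lemma ph_eq : gaussianPDFReal 0 1 = ph := by
  ext x
  simp [gaussianPDFReal, ph]

lemma ph_pos (x : ℝ) : 0 < ph x := by
  unfold ph; positivity

lemma ph_cont : Continuous ph := by
  unfold ph; fun_prop

lemma ph_int : Integrable ph := by
  rw [← ph_eq]; exact integrable_gaussianPDFReal 0 1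

lemma gauss_Ici (y : ℝ) : (gaussianReal 0 1 (Set.Ici y)).toReal = Qt y := by
  rw [gaussianReal_apply_eq_integral _ one_ne_zero, ph_eq, integral_Ici_eq_integral_Ioi,
    ENNReal.toReal_ofReal]
  · rfl
  · exact integral_nonneg fun x => (ph_pos x).le

lemma Qt_nonneg (y : ℝ) : 0 ≤ Qt y := integral_nonneg fun x => (ph_pos x).le

lemma Qt_anti {x y : ℝ} (h : x ≤ y) : Qt y ≤ Qt x := by
  rw [← gauss_Ici, ← gauss_Ici]
  exact ENNReal.toReal_mono (measure_ne_top _ _) (measure_mono (Set.Ici_subset_Ici.2 h))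

lemma Qt_deriv (y : ℝ) : HasDerivAt Qt (-ph y) y := by
  have h : Qt = fun y => Qt 0 - ∫ x in (0:ℝ)..y, ph x := by
    ext y
    have := intervalIntegral.integral_Ioi_sub_Ioi' (f := ph) (μ := volume) (a := 0) (b := y)
      ph_int.integrableOn ph_int.integrableOn
    simp only [Qt]
    linarith
  rw [h]
  exact (intervalIntegral.integral_hasDerivAt_right (ph_cont.intervalIntegrable _ _)
    ph_cont.stronglyMeasurable.stronglyMeasurableAtFilter ph_cont.continuousAt).const_sub _

lemma ph_deriv (x : ℝ) : HasDerivAt ph (-x * ph x) x := by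
  have : HasDerivAt (fun x : ℝ => -x ^ 2 / 2) (-x) x := by
    have := ((hasDerivAt_pow 2 x).neg).div_const 2
    exact this.congr_deriv (by norm_num; ring)
  have h := (this.exp).const_mul (Real.sqrt (2 * Real.pi))⁻¹
  exact h.congr_deriv (by unfold ph; ring)

lemma ph_tendsto : Filter.Tendsto ph Filter.atTop (nhds 0) := by
  unfold ph
  rw [← mul_zero (Real.sqrt (2 * Real.pi))⁻¹]
  apply Filter.Tendsto.const_mul
  apply Real.tendsto_exp_atBot.comp
  have : (fun x : ℝ => -x ^ 2 / 2) = fun x => (-1/2) * x ^ 2 := by ext; ring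
  rw [this]
  exact (Filter.tendsto_pow_atTop (by norm_num)).const_mul_atTop_of_neg (by norm_num)

/-- Mills ratio type bound -/
lemma Qt_le {a : ℝ} (ha : 0 < a) : Qt a ≤ ph a * ((a ^ 2 + 2) / (a ^ 3 + 3 * a)) := by
  set g : ℝ → ℝ := fun x => -(ph x * ((x ^ 2 + 2) / (x ^ 3 + 3 * x))) with hg
  set g' : ℝ → ℝ := fun x => ph x * (1 + 6 / (x ^ 3 + 3 * x) ^ 2) with hg'
  have hd : ∀ x ∈ Set.Ici a, HasDerivAt g (g' x) x := by
    intro x hx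
    have hx : 0 < x := lt_of_lt_of_le ha hx
    have hne : x ^ 3 + 3 * x ≠ 0 := by positivity
    have h1 : HasDerivAt (fun x : ℝ => x ^ 2 + 2) (2 * x) x := by
      simpa using (hasDerivAt_pow 2 x).add_const 2
    have h2 : HasDerivAt (fun x : ℝ => x ^ 3 + 3 * x) (3 * x ^ 2 + 3) x := by
      have := (hasDerivAt_pow 3 x).add ((hasDerivAt_id x).const_mul 3)
      exact this.congr_deriv (by norm_num)
    have := ((ph_deriv x).mul (h1.div h2 hne)).neg
    refine this.congr_deriv ?_
    simp only [hg', Pi.div_apply]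
    field_simp
    ring
  have hpos : ∀ x ∈ Set.Ioi a, 0 ≤ g' x := by
    intro x hx
    have := ph_pos x
    simp only [hg']; positivity
  have ht : Filter.Tendsto g Filter.atTop (nhds 0) := by
    rw [← neg_zero]
    apply Filter.Tendsto.neg
    refine squeeze_zero' (g := ph) ?_ ?_ ph_tendsto
    · filter_upwards [Filter.eventually_gt_atTop 0] with x hx
      have := ph_pos x
      positivity
    · filter_upwards [Filter.eventually_gt_atTop 1] with x hx
      have := ph_pos x
      have h0 : 0 < x ^ 3 + 3 * x := by positivity
      apply mul_le_of_le_one_right this.le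
      rw [div_le_one h0]
      nlinarith [sq_nonneg (x-1), mul_pos (sub_pos.2 hx) (sub_pos.2 hx)]
  have hI := integral_Ioi_of_hasDerivAt_of_nonneg' hd hpos ht
  have hi := integrableOn_Ioi_deriv_of_nonneg' hd hpos ht
  have : Qt a ≤ ∫ x in Set.Ioi a, g' x := by
    apply setIntegral_mono_on ph_int.integrableOn hi measurableSet_Ioi
    intro x hx
    have := ph_pos x
    have hx : 0 < x := lt_of_lt_of_le ha (le_of_lt hx)
    simp only [hg']
    have : 0 ≤ 6 / (x ^ 3 + 3 * x) ^ 2 := by positivity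
    nlinarith
  rw [hI] at this
  simpa [hg] using this

lemma charFunDual_gamma (L : StrongDual ℝ ℝ) :
    charFunDual (gaussianReal 0 1) L = Complex.exp (-((L 1 : ℝ) : ℂ) ^ 2 / 2) := by
  rw [charFunDual_eq_charFun_map_one, gaussianReal_map_continuousLinearMap, charFun_gaussianReal]
  congr 1
  simp [max_eq_left (sq_nonneg _)]
  ring

lemma rot (p q p' q' : ℝ) (h1 : p ^ 2 + q ^ 2 = 1) (h2 : p' ^ 2 + q' ^ 2 = 1)
    (h3 : p * p' + q * q' = 0) :
    Measure.map (fun z : ℝ × ℝ => (p * z.1 + q * z.2, p' * z.1 + q' * z.2))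
      ((gaussianReal 0 1).prod (gaussianReal 0 1)) =
      (gaussianReal 0 1).prod (gaussianReal 0 1) := by
  let T : ℝ × ℝ →L[ℝ] ℝ × ℝ :=
    (p • ContinuousLinearMap.fst ℝ ℝ ℝ + q • ContinuousLinearMap.snd ℝ ℝ ℝ).prod
      (p' • ContinuousLinearMap.fst ℝ ℝ ℝ + q' • ContinuousLinearMap.snd ℝ ℝ ℝ)
  have hT : (fun z : ℝ × ℝ => (p * z.1 + q * z.2, p' * z.1 + q' * z.2)) = T := by
    ext z <;> simp [T]
  rw [hT]
  have : IsFiniteMeasure (Measure.map T ((gaussianReal 0 1).prod (gaussianReal 0 1))) :=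
    inferInstance
  apply Measure.ext_of_charFunDual
  ext L
  rw [charFunDual_map, charFunDual_prod, charFunDual_prod, charFunDual_gamma, charFunDual_gamma,
    charFunDual_gamma, charFunDual_gamma, ← Complex.exp_add, ← Complex.exp_add]
  have hL : ∀ x y : ℝ, L (x, y) = x * L (1, 0) + y * L (0, 1) := by
    intro x y
    have : ((x, y) : ℝ × ℝ) = x • (1, 0) + y • (0, 1) := by simp
    rw [this, map_add, map_smul, map_smul]; simp
  have e1 : (L.comp T).comp (ContinuousLinearMap.inl ℝ ℝ ℝ) 1 = p * L (1, 0) + p' * L (0, 1) := by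
    rw [← hL]; simp [T]
  have e2 : (L.comp T).comp (ContinuousLinearMap.inr ℝ ℝ ℝ) 1 = q * L (1, 0) + q' * L (0, 1) := by
    rw [← hL]; simp [T]
  rw [e1, e2]
  simp only [ContinuousLinearMap.comp_apply, ContinuousLinearMap.inl_apply,
    ContinuousLinearMap.inr_apply]
  congr 1
  norm_cast
  generalize L (1, 0) = x
  generalize L (0, 1) = y
  linear_combination (-x ^ 2 / 2) * h1 - (y ^ 2 / 2) * h2 - x * y * h3

lemma std2 : Measure.map (fun x : Fin 2 → ℝ => (x 0, x 1))
    (Measure.pi fun _ => gaussianReal 0 1) = (gaussianReal 0 1).prod (gaussianReal 0 1) := by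
  exact (measurePreserving_finTwoArrow (gaussianReal 0 1)).map_eq

/-- the kernel in Plackett's identity -/
noncomputable def pk (b r x : ℝ) : ℝ :=
  (2 * Real.pi)⁻¹ * Real.exp (-b ^ 2 / 2) * Real.exp (-(x - r * b) ^ 2 / (2 * (1 - r ^ 2))) *
    (x - r * b) / Real.sqrt (1 - r ^ 2) ^ 3

/-- the bivariate normal density -/
noncomputable def bd (a b r : ℝ) : ℝ :=
  (2 * Real.pi * Real.sqrt (1 - r ^ 2))⁻¹ *
    Real.exp (-(a ^ 2 - 2 * r * a * b + b ^ 2) / (2 * (1 - r ^ 2)))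

lemma pk_ftc_r (b ρ x : ℝ) (h0 : 0 ≤ ρ) (h1 : ρ < 1) :
    ∫ r in (0:ℝ)..ρ, pk b r x = ph x * Qt ((b - ρ * x) / Real.sqrt (1 - ρ ^ 2)) - ph x * Qt b := by
  have hpos : ∀ r ∈ Set.uIcc 0 ρ, 0 < 1 - r ^ 2 := by
    intro r hr
    rw [Set.uIcc_of_le h0] at hr
    nlinarith [hr.1, hr.2]
  have hd : ∀ r ∈ Set.uIcc 0 ρ,
      HasDerivAt (fun r => ph x * Qt ((b - r * x) / Real.sqrt (1 - r ^ 2))) (pk b r x) r := by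
    intro r hr
    have hr := hpos r hr
    have hs : 0 < Real.sqrt (1 - r ^ 2) := Real.sqrt_pos.2 hr
    have hss : Real.sqrt (1 - r ^ 2) ^ 2 = 1 - r ^ 2 := Real.sq_sqrt hr.le
    have d1 : HasDerivAt (fun r : ℝ => b - r * x) (-x) r := by
      have := ((hasDerivAt_id r).mul_const x).const_sub b
      exact this.congr_deriv (by ring)
    have d2 : HasDerivAt (fun r : ℝ => 1 - r ^ 2) (-(2 * r)) r := by
      have := (hasDerivAt_pow 2 r).const_sub 1
      exact this.congr_deriv (by norm_num)
    have d3 := d1.div (d2.sqrt hr.ne') hs.ne'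
    have d4 := ((Qt_deriv _).comp r d3).const_mul (ph x)
    refine d4.congr_deriv ?_
    simp only [Pi.div_apply]
    unfold pk
    set s := Real.sqrt (1 - r ^ 2) with hsd
    have e : ph x * ph ((b - r * x) / s) = (2 * Real.pi)⁻¹ * Real.exp (-b ^ 2 / 2) *
        Real.exp (-(x - r * b) ^ 2 / (2 * (1 - r ^ 2))) := by
      have hpi : Real.sqrt (2 * Real.pi) ^ 2 = 2 * Real.pi := Real.sq_sqrt (by positivity)
      have hc : (Real.sqrt (2 * Real.pi))⁻¹ * (Real.sqrt (2 * Real.pi))⁻¹ = (2 * Real.pi)⁻¹ := by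
        rw [← mul_inv, ← sq, hpi]
      have hE : -x ^ 2 / 2 + -((b - r * x) / s) ^ 2 / 2 =
          -b ^ 2 / 2 + -(x - r * b) ^ 2 / (2 * (1 - r ^ 2)) := by
        rw [div_pow, hss]
        have := hr.ne'
        field_simp
        ring
      calc ph x * ph ((b - r * x) / s) = ((Real.sqrt (2 * Real.pi))⁻¹ * (Real.sqrt (2 * Real.pi))⁻¹) *
            Real.exp (-x ^ 2 / 2 + -((b - r * x) / s) ^ 2 / 2) := by
            rw [Real.exp_add]; unfold ph; ring
        _ = _ := by rw [hc, hE, Real.exp_add]; ring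
    rw [← e]
    have hx : (-x * s - (b - r * x) * (-(2 * r) / (2 * s))) / s ^ 2 = -((x - r * b) / s ^ 3) := by
      field_simp
      rw [hss]
      ring
    rw [hx]
    ring
  rw [intervalIntegral.integral_eq_sub_of_hasDerivAt hd]
  · simp
  · apply ContinuousOn.intervalIntegrable
    intro r hr
    have hr := hpos r hr
    have hs : 0 < Real.sqrt (1 - r ^ 2) := Real.sqrt_pos.2 hr
    apply ContinuousAt.continuousWithinAt
    unfold pk
    have h1 : 2 * (1 - r ^ 2) ≠ 0 := by positivity
    have h2 : Real.sqrt (1 - r ^ 2) ^ 3 ≠ 0 := by positivity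
    fun_prop (disch := assumption)

lemma pk_bound (b ρ r x : ℝ) (hr0 : 0 ≤ r) (hr : r ≤ ρ) (h1 : ρ < 1) :
    ‖pk b r x‖ ≤ (Real.sqrt (1 - ρ ^ 2) ^ 3)⁻¹ * ((|x| + |b|) * Real.exp (-(1 / 4) * x ^ 2)) := by
  have p1 : 0 < 1 - ρ ^ 2 := by nlinarith
  have p2 : 0 < 1 - r ^ 2 := by nlinarith
  have p3 : 1 - ρ ^ 2 ≤ 1 - r ^ 2 := by nlinarith
  have s1 : 0 < Real.sqrt (1 - ρ ^ 2) := Real.sqrt_pos.2 p1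
  have s2 : Real.sqrt (1 - ρ ^ 2) ≤ Real.sqrt (1 - r ^ 2) := Real.sqrt_le_sqrt p3
  have s3 : 0 < Real.sqrt (1 - r ^ 2) := s1.trans_le s2
  have i1 : (Real.sqrt (1 - r ^ 2) ^ 3)⁻¹ ≤ (Real.sqrt (1 - ρ ^ 2) ^ 3)⁻¹ := by gcongr
  have i2 : (2 * Real.pi)⁻¹ ≤ 1 := by
    apply inv_le_one_of_one_le₀; linarith [Real.pi_gt_three]
  have i3 : Real.exp (-b ^ 2 / 2) * Real.exp (-(x - r * b) ^ 2 / (2 * (1 - r ^ 2))) ≤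
      Real.exp (-(1 / 4) * x ^ 2) := by
    rw [← Real.exp_add]
    apply Real.exp_le_exp.2
    have : (x - r * b) ^ 2 / 2 ≤ (x - r * b) ^ 2 / (2 * (1 - r ^ 2)) := by
      apply div_le_div_of_nonneg_left (sq_nonneg _) (by positivity)
      nlinarith
    have h2 : (r * b) ^ 2 ≤ b ^ 2 := by
      rw [mul_pow]; nlinarith [sq_nonneg b]
    rw [neg_div, neg_div]
    nlinarith [sq_nonneg (x - 2 * (r * b))]
  have i4 : |x - r * b| ≤ |x| + |b| := by
    refine (abs_sub _ _).trans ?_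
    rw [abs_mul, abs_of_nonneg hr0]
    nlinarith [abs_nonneg b]
  unfold pk
  rw [Real.norm_eq_abs, abs_div, abs_mul, abs_of_pos (by positivity : 0 < Real.sqrt (1 - r ^ 2) ^ 3),
    abs_of_pos (by positivity : 0 < (2 * Real.pi)⁻¹ * Real.exp (-b ^ 2 / 2) *
      Real.exp (-(x - r * b) ^ 2 / (2 * (1 - r ^ 2)))), div_eq_mul_inv]
  calc _ ≤ (1 * Real.exp (-(1 / 4) * x ^ 2) * (|x| + |b|)) * (Real.sqrt (1 - ρ ^ 2) ^ 3)⁻¹ := by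
        rw [mul_assoc (2 * Real.pi)⁻¹]
        gcongr
    _ = _ := by ring

lemma bound_int (b K : ℝ) :
    Integrable (fun x : ℝ => K * ((|x| + |b|) * Real.exp (-(1 / 4) * x ^ 2))) := by
  apply Integrable.const_mul
  have h1 := (integrable_mul_exp_neg_mul_sq (b := 1 / 4) (by norm_num)).norm
  have h2 := (integrable_exp_neg_mul_sq (b := 1 / 4) (by norm_num)).const_mul |b|
  refine (h1.add h2).congr ?_
  filter_upwards with x
  simp
  ring

lemma pk_meas (b : ℝ) : Measurable (fun z : ℝ × ℝ => pk b z.2 z.1) := by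
  unfold pk; fun_prop

lemma pk_ftc_x (a b r : ℝ) (h0 : 0 ≤ r) (h1 : r < 1) :
    ∫ x in Set.Ioi a, pk b r x = bd a b r := by
  have p2 : 0 < 1 - r ^ 2 := by nlinarith
  have hs : 0 < Real.sqrt (1 - r ^ 2) := Real.sqrt_pos.2 p2
  have hss : Real.sqrt (1 - r ^ 2) ^ 2 = 1 - r ^ 2 := Real.sq_sqrt p2.le
  have hInt0 : IntegrableOn (pk b r) (Set.Ioi a) := by
    apply Integrable.integrableOn
    refine (bound_int b (Real.sqrt (1 - r ^ 2) ^ 3)⁻¹).mono' ?_ ?_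
    · exact ((pk_meas b).comp (measurable_id.prodMk measurable_const)).aestronglyMeasurable
    · filter_upwards with x
      exact pk_bound b r r x h0 le_rfl h1
  have hd : ∀ x ∈ Set.Ici a, HasDerivAt (fun x => -((2 * Real.pi * Real.sqrt (1 - r ^ 2))⁻¹ *
      (Real.exp (-b ^ 2 / 2) * Real.exp (-(x - r * b) ^ 2 / (2 * (1 - r ^ 2)))))) (pk b r x) x := by
    intro x _
    have d1 : HasDerivAt (fun x : ℝ => -(x - r * b) ^ 2 / (2 * (1 - r ^ 2)))
        (-(x - r * b) / (1 - r ^ 2)) x := by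
      have := ((((hasDerivAt_id x).sub_const (r * b)).pow 2).neg).div_const (2 * (1 - r ^ 2))
      refine this.congr_deriv ?_
      have := p2.ne'
      simp
      field_simp
      ring
    have := (((d1.exp).const_mul (Real.exp (-b ^ 2 / 2))).const_mul
      (2 * Real.pi * Real.sqrt (1 - r ^ 2))⁻¹).neg
    refine this.congr_deriv ?_
    unfold pk
    rw [← hss]
    field_simp
    rw [Real.sqrt_sq hs.le]
  have ht : Filter.Tendsto (fun x => -((2 * Real.pi * Real.sqrt (1 - r ^ 2))⁻¹ *
      (Real.exp (-b ^ 2 / 2) * Real.exp (-(x - r * b) ^ 2 / (2 * (1 - r ^ 2))))))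
      Filter.atTop (nhds 0) := by
    rw [show (0:ℝ) = -((2 * Real.pi * Real.sqrt (1 - r ^ 2))⁻¹ * (Real.exp (-b ^ 2 / 2) * 0)) by simp]
    apply Filter.Tendsto.neg
    apply Filter.Tendsto.const_mul
    apply Filter.Tendsto.const_mul
    apply Real.tendsto_exp_atBot.comp
    have : (fun x : ℝ => -(x - r * b) ^ 2 / (2 * (1 - r ^ 2))) =
      fun x => (-(2 * (1 - r ^ 2))⁻¹) * (x - r * b) ^ 2 := by ext; ring
    rw [this]
    apply Filter.Tendsto.const_mul_atTop_of_neg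
    · have : 0 < (2 * (1 - r ^ 2))⁻¹ := by positivity
      linarith
    · apply (Filter.tendsto_pow_atTop (by norm_num)).comp
      exact Filter.tendsto_atTop_add_const_right _ _ Filter.tendsto_id
  rw [integral_Ioi_of_hasDerivAt_of_tendsto' hd hInt0 ht]
  unfold bd
  rw [← Real.exp_add, zero_sub, neg_neg]
  congr 2
  have := p2.ne'
  field_simp
  ring

lemma plackett (a b ρ : ℝ) (h0 : 0 ≤ ρ) (h1 : ρ < 1) :
    ∫ x in Set.Ioi a, ph x * Qt ((b - ρ * x) / Real.sqrt (1 - ρ ^ 2)) =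
      Qt a * Qt b + ∫ r in (0:ℝ)..ρ, bd a b r := by
  have hI : Integrable (Function.uncurry fun x r => pk b r x)
      ((volume.restrict (Set.Ioi a)).prod (volume.restrict (Set.Ioc 0 ρ))) := by
    have hb := ((bound_int b (Real.sqrt (1 - ρ ^ 2) ^ 3)⁻¹).integrableOn (s := Set.Ioi a)).mul_prod
      (integrable_const (μ := volume.restrict (Set.Ioc 0 ρ)) (1:ℝ))
    refine hb.mono' (pk_meas b).aestronglyMeasurable ?_
    rw [Measure.prod_restrict]
    filter_upwards [ae_restrict_mem (measurableSet_Ioi.prod measurableSet_Ioc)] with z hz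
    rw [mul_one]
    exact pk_bound b ρ z.2 z.1 hz.2.1.le hz.2.2 h1
  have hsw := integral_integral_swap hI
  have e1 : ∀ x, ∫ r in Set.Ioc 0 ρ, pk b r x =
      ph x * Qt ((b - ρ * x) / Real.sqrt (1 - ρ ^ 2)) - ph x * Qt b := by
    intro x
    rw [← pk_ftc_r b ρ x h0 h1, intervalIntegral.integral_of_le h0]
  have e2 : ∫ r in Set.Ioc 0 ρ, ∫ x in Set.Ioi a, pk b r x = ∫ r in (0:ℝ)..ρ, bd a b r := by
    rw [intervalIntegral.integral_of_le h0]
    apply setIntegral_congr_fun measurableSet_Ioc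
    intro r hr
    exact pk_ftc_x a b r hr.1.le (hr.2.trans_lt h1)
  rw [e2] at hsw
  have hI1 := hI.integral_prod_left
  simp only [Function.uncurry, e1] at hI1 hsw
  have hI2 : Integrable (fun x => ph x * Qt b) (volume.restrict (Set.Ioi a)) :=
    (ph_int.integrableOn).mul_const _
  have hI3 : Integrable (fun x => ph x * Qt ((b - ρ * x) / Real.sqrt (1 - ρ ^ 2)))
      (volume.restrict (Set.Ioi a)) := by
    refine (hI1.add hI2).congr ?_
    filter_upwards with x
    simp
  rw [integral_sub hI3 hI2, integral_mul_const] at hsw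
  change _ - Qt a * Qt b = _ at hsw
  linarith

lemma cert_one (r : ℝ) (h0 : 0 ≤ r) (h1 : r ≤ (5/7)) : 0 ≤ ((109 / 1000 + 1220 / 1000 * r - 2061 / 1000 * r ^ 2 + 2232 / 1000 * r ^ 3) * (1 + r) ^ 2 + 4 * (225 / 1000 + 109 / 1000 * r + 610 / 1000 * r ^ 2 - 687 / 1000 * r ^ 3 + 558 / 1000 * r ^ 4)) ^ 2 * (1 - r) - (1 + r) ^ 3 := by
  have u : 0 ≤ r - 0 := by linarith
  have w : 0 ≤ (5/7) - r := by linarith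
  have e : ((109 / 1000 + 1220 / 1000 * r - 2061 / 1000 * r ^ 2 + 2232 / 1000 * r ^ 3) * (1 + r) ^ 2 + 4 * (225 / 1000 + 109 / 1000 * r + 610 / 1000 * r ^ 2 - 687 / 1000 * r ^ 3 + 558 / 1000 * r ^ 4)) ^ 2 * (1 - r) - (1 + r) ^ 3 =
        (250264313881281/244140625000000) * ((r - 0) ^ 0 * ((5/7) - r) ^ 12) +
        (666475774668837/244140625000000) * ((r - 0) ^ 1 * ((5/7) - r) ^ 11) +
        (9449019952021461/244140625000000) * ((r - 0) ^ 2 * ((5/7) - r) ^ 10) +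
        (16178394476869079/48828125000000) * ((r - 0) ^ 3 * ((5/7) - r) ^ 9) +
        (29265422770684807/24414062500000) * ((r - 0) ^ 4 * ((5/7) - r) ^ 8) +
        (133224753817697563/61035156250000) * ((r - 0) ^ 5 * ((5/7) - r) ^ 7) +
        (15831351618050507/7629394531250) * ((r - 0) ^ 6 * ((5/7) - r) ^ 6) +
        (28754226572994279/30517578125000) * ((r - 0) ^ 7 * ((5/7) - r) ^ 5) +
        (552964433243999/3051757812500) * ((r - 0) ^ 8 * ((5/7) - r) ^ 4) +
        (494797142887299/3051757812500) * ((r - 0) ^ 9 * ((5/7) - r) ^ 3) +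
        (3169099836613781/15258789062500) * ((r - 0) ^ 10 * ((5/7) - r) ^ 2) +
        (1276954753329507/15258789062500) * ((r - 0) ^ 11 * ((5/7) - r) ^ 1) +
        (18962740697103/7629394531250) * ((r - 0) ^ 12 * ((5/7) - r) ^ 0) := by ring
  rw [e]; positivity

lemma cert_two_0 (r : ℝ) (h0 : 0 ≤ r) (h1 : r ≤ (951/2000)) : 0 ≤ ((128 / 100 - 444 / 100 * r + 567 / 100 * r ^ 2) * (1 + r) ^ 2 + 5 * (128 / 100 * r - 222 / 100 * r ^ 2 + 189 / 100 * r ^ 3)) ^ 2 * (1 - r) - (1 + r) ^ 3 := by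
  have u : 0 ≤ r - 0 := by linarith
  have w : 0 ≤ (951/2000) - r := by linarith
  have e : ((128 / 100 - 444 / 100 * r + 567 / 100 * r ^ 2) * (1 + r) ^ 2 + 5 * (128 / 100 * r - 222 / 100 * r ^ 2 + 189 / 100 * r ^ 3)) ^ 2 * (1 - r) - (1 + r) ^ 3 =
        (217907200000000000000000000000000/201689790403357666679746040667) * ((r - 0) ^ 0 * ((951/2000) - r) ^ 10) +
        (3304293171200000000000000000000000/201689790403357666679746040667) * ((r - 0) ^ 1 * ((951/2000) - r) ^ 9) +
        (5936890694041600000000000000000000/67229930134452555559915346889) * ((r - 0) ^ 2 * ((951/2000) - r) ^ 8) +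
        (5258973017994956800000000000000000/22409976711484185186638448963) * ((r - 0) ^ 3 * ((951/2000) - r) ^ 7) +
        (7948508012495700089600000000000000/22409976711484185186638448963) * ((r - 0) ^ 4 * ((951/2000) - r) ^ 6) +
        (21792451593750427551113600000000000/67229930134452555559915346889) * ((r - 0) ^ 5 * ((951/2000) - r) ^ 5) +
        (12066195279899779845996776000000000/67229930134452555559915346889) * ((r - 0) ^ 6 * ((951/2000) - r) ^ 4) +
        (3761713205682225284372295690400000/67229930134452555559915346889) * ((r - 0) ^ 7 * ((951/2000) - r) ^ 3) +
        (549322840772567910404554312524400/67229930134452555559915346889) * ((r - 0) ^ 8 * ((951/2000) - r) ^ 2) +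
        (821969551273196141132338749511187/1008448952016788333398730203335) * ((r - 0) ^ 9 * ((951/2000) - r) ^ 1) +
        (251164425520324295400819417645187/1008448952016788333398730203335) * ((r - 0) ^ 10 * ((951/2000) - r) ^ 0) := by ring
  rw [e]; positivity

lemma cert_two_1 (r : ℝ) (h0 : (951/2000) ≤ r) (h1 : r ≤ (951/1000)) : 0 ≤ ((128 / 100 - 444 / 100 * r + 567 / 100 * r ^ 2) * (1 + r) ^ 2 + 5 * (128 / 100 * r - 222 / 100 * r ^ 2 + 189 / 100 * r ^ 3)) ^ 2 * (1 - r) - (1 + r) ^ 3 := by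
  have u : 0 ≤ r - (951/2000) := by linarith
  have w : 0 ≤ (951/1000) - r := by linarith
  have e : ((128 / 100 - 444 / 100 * r + 567 / 100 * r ^ 2) * (1 + r) ^ 2 + 5 * (128 / 100 * r - 222 / 100 * r ^ 2 + 189 / 100 * r ^ 3)) ^ 2 * (1 - r) - (1 + r) ^ 3 =
        (251164425520324295400819417645187/1008448952016788333398730203335) * ((r - (951/2000)) ^ 0 * ((951/1000) - r) ^ 10) +
        (1400439653044429922294683201130851/336149650672262777799576734445) * ((r - (951/2000)) ^ 1 * ((951/1000) - r) ^ 9) +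
        (12884662427443120429277904124266098/336149650672262777799576734445) * ((r - (951/2000)) ^ 2 * ((951/1000) - r) ^ 8) +
        (66055338938784666164412820219874864/336149650672262777799576734445) * ((r - (951/2000)) ^ 3 * ((951/1000) - r) ^ 7) +
        (201814819931948434385747464557767552/336149650672262777799576734445) * ((r - (951/2000)) ^ 4 * ((951/1000) - r) ^ 6) +
        (388339513112296052070546985045400992/336149650672262777799576734445) * ((r - (951/2000)) ^ 5 * ((951/1000) - r) ^ 5) +
        (159920864753663402481816898428014144/112049883557420925933192244815) * ((r - (951/2000)) ^ 6 * ((951/1000) - r) ^ 4) +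
        (371530371593768613852123886317934336/336149650672262777799576734445) * ((r - (951/2000)) ^ 7 * ((951/1000) - r) ^ 3) +
        (164795910201026258300458564982958848/336149650672262777799576734445) * ((r - (951/2000)) ^ 8 * ((951/1000) - r) ^ 2) +
        (96428682286586028273809020356366592/1008448952016788333398730203335) * ((r - (951/2000)) ^ 9 * ((951/1000) - r) ^ 1) +
        (14094344093441789768127349801472/37349961185806975311064081605) * ((r - (951/2000)) ^ 10 * ((951/1000) - r) ^ 0) := by ring
  rw [e]; positivity

lemma cert_two (r : ℝ) (h0 : 0 ≤ r) (h1 : r ≤ (951/1000)) : 0 ≤ ((128 / 100 - 444 / 100 * r + 567 / 100 * r ^ 2) * (1 + r) ^ 2 + 5 * (128 / 100 * r - 222 / 100 * r ^ 2 + 189 / 100 * r ^ 3)) ^ 2 * (1 - r) - (1 + r) ^ 3 := by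
  rcases le_total r (951/2000) with h | h
  · exact cert_two_0 r h0 h
  · exact cert_two_1 r h h1

lemma cert_three (s : ℝ) (h0 : 0 ≤ s) (h1 : s ≤ 1) : 0 ≤ (320442 / 10000000 + (225 / 1000 - 9 / 49) * (183156 / 10000000) - 225 / 1000 * (183157 / 10000000) * s) * (242 * (11 + s) ^ 2 + 1078 * s * (11 + s) + 2401 * s ^ 2) - 242 * (39219/500000) * (11 + s) ^ 2 * (225 / 1000 + 109 / 1000 * ((4 + s) / 7) + 610 / 1000 * ((4 + s) / 7) ^ 2 - 687 / 1000 * ((4 + s) / 7) ^ 3 + 558 / 1000 * ((4 + s) / 7) ^ 4) := by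
  have u : 0 ≤ s - 0 := by linarith
  have w : 0 ≤ 1 - s := by linarith
  have e : (320442 / 10000000 + (225 / 1000 - 9 / 49) * (183156 / 10000000) - 225 / 1000 * (183157 / 10000000) * s) * (242 * (11 + s) ^ 2 + 1078 * s * (11 + s) + 2401 * s ^ 2) - 242 * (39219/500000) * (11 + s) ^ 2 * (225 / 1000 + 109 / 1000 * ((4 + s) / 7) + 610 / 1000 * ((4 + s) / 7) ^ 2 - 687 / 1000 * ((4 + s) / 7) ^ 3 + 558 / 1000 * ((4 + s) / 7) ^ 4) =
        (55275909579/60025000000) * ((s - 0) ^ 0 * (1 - s) ^ 8) +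
        (229235561945247/2401000000000) * ((s - 0) ^ 1 * (1 - s) ^ 7) +
        (188608554919251/300125000000) * ((s - 0) ^ 2 * (1 - s) ^ 6) +
        (8604943236681153/4802000000000) * ((s - 0) ^ 3 * (1 - s) ^ 5) +
        (13488626198677503/4802000000000) * ((s - 0) ^ 4 * (1 - s) ^ 4) +
        (778770895072287/300125000000) * ((s - 0) ^ 5 * (1 - s) ^ 3) +
        (3368339668965963/2401000000000) * ((s - 0) ^ 6 * (1 - s) ^ 2) +
        (1954644310843521/4802000000000) * ((s - 0) ^ 7 * (1 - s) ^ 1) +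
        (46185700897599/960400000000) * ((s - 0) ^ 8 * (1 - s) ^ 0) := by ring
  rw [e]; positivity

lemma cert_four (s : ℝ) (h0 : 0 ≤ s) (h1 : s ≤ (1657/1000)) : 0 ≤ (320442 / 10000000 - 9 / 49 * (183157 / 10000000)) * (288 * (12 + s) ^ 2 + 1176 * s * (12 + s) + 2401 * s ^ 2) - 288 * (1353/25000) * (12 + s) ^ 2 * (128 / 100 * ((5 + s) / 7) - 222 / 100 * ((5 + s) / 7) ^ 2 + 189 / 100 * ((5 + s) / 7) ^ 3) := by
  have u : 0 ≤ s - 0 := by linarith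
  have w : 0 ≤ (1657/1000) - s := by linarith
  have e : (320442 / 10000000 - 9 / 49 * (183157 / 10000000)) * (288 * (12 + s) ^ 2 + 1176 * s * (12 + s) + 2401 * s ^ 2) - 288 * (1353/25000) * (12 + s) ^ 2 * (128 / 100 * ((5 + s) / 7) - 222 / 100 * ((5 + s) / 7) ^ 2 + 189 / 100 * ((5 + s) / 7) ^ 3) =
        (6546707712000000000000000/1680558516123621099097657) * ((s - 0) ^ 0 * ((1657/1000) - s) ^ 7) +
        (54425723785027200000000000/1680558516123621099097657) * ((s - 0) ^ 1 * ((1657/1000) - s) ^ 6) +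
        (184522995419583146100000000/1680558516123621099097657) * ((s - 0) ^ 2 * ((1657/1000) - s) ^ 5) +
        (328995311874813607735200000/1680558516123621099097657) * ((s - 0) ^ 3 * ((1657/1000) - s) ^ 4) +
        (329154568591902759592166400/1680558516123621099097657) * ((s - 0) ^ 4 * ((1657/1000) - s) ^ 3) +
        (898821126392854193019110208/8402792580618105495488285) * ((s - 0) ^ 5 * ((1657/1000) - s) ^ 2) +
        (32970288506382356337103488/1200398940088300785069755) * ((s - 0) ^ 6 * ((1657/1000) - s) ^ 1) +
        (326266805511179410723392/171485562869757255009965) * ((s - 0) ^ 7 * ((1657/1000) - s) ^ 0) := by ring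
  rw [e]; positivity

lemma bd_le {a b r t : ℝ} (hr0 : 0 ≤ r) (hr1 : r < 1) (ht : t ≤ a * b) :
    bd a b r ≤ (2 * Real.pi)⁻¹ * (Real.exp (-t / (1 + r)) * (Real.sqrt (1 - r ^ 2))⁻¹) := by
  have p2 : 0 < 1 - r ^ 2 := by nlinarith
  have hs : 0 < Real.sqrt (1 - r ^ 2) := Real.sqrt_pos.2 p2
  unfold bd
  rw [mul_inv, mul_assoc, mul_comm (Real.sqrt (1 - r ^ 2))⁻¹]
  refine mul_le_mul_of_nonneg_left (mul_le_mul_of_nonneg_right (Real.exp_le_exp.2 ?_)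
    (by positivity)) (by positivity)
  rw [neg_div, neg_div, neg_le_neg_iff]
  rw [div_le_div_iff₀ (by linarith) (by positivity)]
  have h1 : 0 < 1 + r := by linarith
  have h2 : 0 < 1 - r := by linarith
  nlinarith [mul_nonneg (sq_nonneg (a - b)) h1.le, mul_nonneg (mul_pos h1 h2).le (sub_nonneg.2 ht)]

lemma bd_nonneg (a b r : ℝ) : 0 ≤ bd a b r := by unfold bd; positivity

lemma bd_contOn (a b ρ : ℝ) (h1 : ρ < 1) : ContinuousOn (bd a b) (Set.Icc 0 ρ) := by
  intro r hr
  have p2 : 0 < 1 - r ^ 2 := by nlinarith [hr.1, hr.2]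
  have hs : 0 < Real.sqrt (1 - r ^ 2) := Real.sqrt_pos.2 p2
  apply ContinuousAt.continuousWithinAt
  unfold bd
  have h1 : 2 * (1 - r ^ 2) ≠ 0 := by positivity
  have h2 : 2 * Real.pi * Real.sqrt (1 - r ^ 2) ≠ 0 := by positivity
  fun_prop (disch := assumption)

lemma int_le (a b t t0 ρ : ℝ) (p p' : ℝ → ℝ) (h0 : 0 ≤ ρ) (h1 : ρ < 1) (ht : t ≤ a * b)
    (ht0 : t0 ≤ t)
    (hd : ∀ r, HasDerivAt p (p' r) r) (hp : ∀ r ∈ Set.Icc 0 ρ, 0 ≤ p r)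
    (hq : ∀ r ∈ Set.Icc 0 ρ, 0 < p' r * (1 + r) ^ 2 + t0 * p r)
    (hc : ∀ r ∈ Set.Icc 0 ρ, 0 ≤ (p' r * (1 + r) ^ 2 + t0 * p r) ^ 2 * (1 - r) - (1 + r) ^ 3) :
    ∫ r in (0:ℝ)..ρ, bd a b r ≤
      (2 * Real.pi)⁻¹ * (Real.exp (-t / (1 + ρ)) * p ρ - Real.exp (-t) * p 0) := by
  set g : ℝ → ℝ := fun r => (2 * Real.pi)⁻¹ * (Real.exp (-t / (1 + r)) * p r) with hg
  set g' : ℝ → ℝ := fun r =>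
    (2 * Real.pi)⁻¹ * (Real.exp (-t / (1 + r)) * (p' r + t * p r / (1 + r) ^ 2)) with hg'
  have hder : ∀ r ∈ Set.Icc 0 ρ, HasDerivAt g (g' r) r := by
    intro r hr
    have h1r : 1 + r ≠ 0 := by linarith [hr.1]
    have d1 : HasDerivAt (fun r : ℝ => -t / (1 + r)) (t / (1 + r) ^ 2) r := by
      have := (hasDerivAt_const r (-t)).div ((hasDerivAt_id r).const_add 1) h1r
      exact this.congr_deriv (by simp)
    have := ((d1.exp).mul (hd r)).const_mul (2 * Real.pi)⁻¹
    exact this.congr_deriv (by simp only [hg']; ring)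
  have key := intervalIntegral.integral_le_sub_of_hasDeriv_right_of_le (g := g) (g' := g')
    (φ := bd a b) h0 (fun r hr => (hder r hr).continuousAt.continuousWithinAt)
    (fun r hr => (hder r (Set.Ioo_subset_Icc_self hr)).hasDerivWithinAt)
    (bd_contOn a b ρ h1).integrableOn_Icc ?_
  · refine key.trans (le_of_eq ?_)
    simp only [hg]
    rw [add_zero, div_one]
    ring
  · intro r hr
    have hr := Set.Ioo_subset_Icc_self hr
    have hr0 := hr.1
    have hr1 : r < 1 := hr.2.trans_lt h1
    refine (bd_le hr0 hr1 ht).trans ?_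
    simp only [hg']
    have p2 : 0 < 1 - r ^ 2 := by nlinarith
    have hs : 0 < Real.sqrt (1 - r ^ 2) := Real.sqrt_pos.2 p2
    have hss : Real.sqrt (1 - r ^ 2) ^ 2 = 1 - r ^ 2 := Real.sq_sqrt p2.le
    gcongr
    have h1r : 0 < 1 + r := by linarith
    set q := p' r * (1 + r) ^ 2 + t0 * p r with hqd
    have e1 : q / (1 + r) ^ 2 ≤ p' r + t * p r / (1 + r) ^ 2 := by
      rw [div_le_iff₀ (by positivity), add_mul, div_mul_cancel₀ _ (by positivity)]
      have := mul_le_mul_of_nonneg_right ht0 (hp r hr)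
      linarith
    refine le_trans ?_ e1
    have hqp := hq r hr
    have hcr := hc r hr
    rw [inv_le_iff_one_le_mul₀ hs]
    rw [← one_le_sq_iff₀ (by positivity)]
    rw [mul_pow, hss, div_pow, div_mul_eq_mul_div, one_le_div (by positivity)]
    nlinarith

lemma exp_neg_four : (183156 / 10000000 : ℝ) ≤ Real.exp (-4) ∧
    Real.exp (-4) ≤ 183157 / 10000000 := by
  have h : Real.exp (-4) = Real.exp (-1) ^ 4 := by
    rw [← Real.exp_nat_mul]; norm_num
  rw [h]
  constructor
  · refine le_trans ?_ (pow_le_pow_left₀ (by norm_num) Real.exp_neg_one_gt_d9.le 4)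
    norm_num
  · refine le_trans (pow_le_pow_left₀ (Real.exp_pos _).le Real.exp_neg_one_lt_d9.le 4) ?_
    norm_num

lemma exp_c1 : Real.exp (-(28 / 11)) ≤ 39219 / 500000 := by
  have h : Real.exp (-(28 / 11)) ^ 11 = Real.exp (-1) ^ 28 := by
    rw [← Real.exp_nat_mul, ← Real.exp_nat_mul]; norm_num
  refine le_of_pow_le_pow_left₀ (n := 11) (by norm_num) (by norm_num) ?_
  rw [h]
  refine le_trans (pow_le_pow_left₀ (Real.exp_pos _).le Real.exp_neg_one_lt_d9.le 28) ?_
  norm_num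

lemma exp_c2 : Real.exp (-(35 / 12)) ≤ 1353 / 25000 := by
  have h : Real.exp (-(35 / 12)) ^ 12 = Real.exp (-1) ^ 35 := by
    rw [← Real.exp_nat_mul, ← Real.exp_nat_mul]; norm_num
  refine le_of_pow_le_pow_left₀ (n := 12) (by norm_num) (by norm_num) ?_
  rw [h]
  refine le_trans (pow_le_pow_left₀ (Real.exp_pos _).le Real.exp_neg_one_lt_d9.le 35) ?_
  norm_num

lemma exp_neg_le {x : ℝ} (hx : 0 ≤ x) : Real.exp (-x) ≤ (1 + x + x ^ 2 / 2)⁻¹ := by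
  rw [Real.exp_neg]
  have := Real.quadratic_le_exp_of_nonneg hx
  gcongr

lemma val_one (s : ℝ) (h0 : 0 ≤ s) (h1 : s ≤ 1) :
    9 / 49 * Real.exp (-4) + (Real.exp (-(4 + s) / (1 + (4 + s) / 7)) *
      (225 / 1000 + 109 / 1000 * ((4 + s) / 7) + 610 / 1000 * ((4 + s) / 7) ^ 2
        - 687 / 1000 * ((4 + s) / 7) ^ 3 + 558 / 1000 * ((4 + s) / 7) ^ 4)
      - Real.exp (-(4 + s)) * (225 / 1000)) ≤ 320442 / 10000000 := by
  have hc := cert_three s h0 h1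
  obtain ⟨l, u⟩ := exp_neg_four
  set P := (225 / 1000 + 109 / 1000 * ((4 + s) / 7) + 610 / 1000 * ((4 + s) / 7) ^ 2
        - 687 / 1000 * ((4 + s) / 7) ^ 3 + 558 / 1000 * ((4 + s) / 7) ^ 4) with hP
  have hP0 : 0 ≤ P := by
    have hr : 0 ≤ (4 + s) / 7 := by positivity
    rw [hP]
    generalize (4 + s) / 7 = r at hr
    nlinarith [mul_nonneg (sq_nonneg r) (sq_nonneg (r - 6 / 10)), sq_nonneg r]
  have hx : 0 ≤ 49 * s / (11 * (11 + s)) := by positivity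
  have e1 : Real.exp (-(4 + s) / (1 + (4 + s) / 7)) =
      Real.exp (-(28 / 11)) * Real.exp (-(49 * s / (11 * (11 + s)))) := by
    rw [← Real.exp_add]
    congr 1
    have : 7 + (4 + s) ≠ 0 := by positivity
    field_simp
    ring
  have hD : 0 < 242 * (11 + s) ^ 2 + 1078 * s * (11 + s) + 2401 * s ^ 2 := by positivity
  have e2 : Real.exp (-(49 * s / (11 * (11 + s)))) ≤
      242 * (11 + s) ^ 2 / (242 * (11 + s) ^ 2 + 1078 * s * (11 + s) + 2401 * s ^ 2) := by
    refine (exp_neg_le hx).trans (le_of_eq ?_)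
    rw [inv_eq_one_div, div_eq_div_iff (by positivity) (by positivity)]
    field_simp
    ring
  have e3 : Real.exp (-4) * (1 - s) ≤ Real.exp (-(4 + s)) := by
    rw [neg_add, Real.exp_add]
    have := Real.add_one_le_exp (-s)
    gcongr
    linarith
  have e4 : Real.exp (-(4 + s) / (1 + (4 + s) / 7)) * P ≤ (39219 / 500000) *
      (242 * (11 + s) ^ 2 / (242 * (11 + s) ^ 2 + 1078 * s * (11 + s) + 2401 * s ^ 2)) * P := by
    rw [e1]
    have := exp_c1
    gcongr
  have e5 : (39219 / 500000) *
      (242 * (11 + s) ^ 2 / (242 * (11 + s) ^ 2 + 1078 * s * (11 + s) + 2401 * s ^ 2)) * P ≤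
      (320442 / 10000000 + (225 / 1000 - 9 / 49) * (183156 / 10000000)
        - 225 / 1000 * (183157 / 10000000) * s) := by
    rw [mul_div_assoc', div_mul_eq_mul_div, div_le_iff₀ hD]
    linarith
  have e6 : Real.exp (-4) * s ≤ 183157 / 10000000 * s := by gcongr
  linarith

lemma val_two (s : ℝ) (h0 : 0 ≤ s) (h1 : s ≤ 1657 / 1000) :
    9 / 49 * Real.exp (-4) + (Real.exp (-(5 + s) / (1 + (5 + s) / 7)) *
      (128 / 100 * ((5 + s) / 7) - 222 / 100 * ((5 + s) / 7) ^ 2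
        + 189 / 100 * ((5 + s) / 7) ^ 3)) ≤ 320442 / 10000000 := by
  have hc := cert_four s h0 h1
  obtain ⟨l, u⟩ := exp_neg_four
  set P := (128 / 100 * ((5 + s) / 7) - 222 / 100 * ((5 + s) / 7) ^ 2
        + 189 / 100 * ((5 + s) / 7) ^ 3) with hP
  have hP0 : 0 ≤ P := by
    have hr : 0 ≤ (5 + s) / 7 := by positivity
    rw [hP]
    generalize (5 + s) / 7 = r at hr
    nlinarith [mul_nonneg hr (sq_nonneg (r - 6 / 10)), sq_nonneg r]
  have hx : 0 ≤ 49 * s / (12 * (12 + s)) := by positivity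
  have e1 : Real.exp (-(5 + s) / (1 + (5 + s) / 7)) =
      Real.exp (-(35 / 12)) * Real.exp (-(49 * s / (12 * (12 + s)))) := by
    rw [← Real.exp_add]
    congr 1
    have : 7 + (5 + s) ≠ 0 := by positivity
    field_simp
    ring
  have hD : 0 < 288 * (12 + s) ^ 2 + 1176 * s * (12 + s) + 2401 * s ^ 2 := by positivity
  have e2 : Real.exp (-(49 * s / (12 * (12 + s)))) ≤
      288 * (12 + s) ^ 2 / (288 * (12 + s) ^ 2 + 1176 * s * (12 + s) + 2401 * s ^ 2) := by
    refine (exp_neg_le hx).trans (le_of_eq ?_)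
    rw [inv_eq_one_div, div_eq_div_iff (by positivity) (by positivity)]
    field_simp
    ring
  have e4 : Real.exp (-(5 + s) / (1 + (5 + s) / 7)) * P ≤ (1353 / 25000) *
      (288 * (12 + s) ^ 2 / (288 * (12 + s) ^ 2 + 1176 * s * (12 + s) + 2401 * s ^ 2)) * P := by
    rw [e1]
    have := exp_c2
    gcongr
  have e5 : (1353 / 25000) *
      (288 * (12 + s) ^ 2 / (288 * (12 + s) ^ 2 + 1176 * s * (12 + s) + 2401 * s ^ 2)) * P ≤
      (320442 / 10000000 - 9 / 49 * (183157 / 10000000)) := by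
    rw [mul_div_assoc', div_mul_eq_mul_div, div_le_iff₀ hD]
    linarith
  linarith

lemma Qt_two_sq : Qt 2 ^ 2 ≤ (2 * Real.pi)⁻¹ * (9 / 49 * Real.exp (-4)) := by
  have h := Qt_le (a := 2) (by norm_num)
  have h2 := pow_le_pow_left₀ (Qt_nonneg 2) h 2
  refine h2.trans (le_of_eq ?_)
  have hpi : Real.sqrt (2 * Real.pi) ^ 2 = 2 * Real.pi := Real.sq_sqrt (by positivity)
  have he : Real.exp (-2) ^ 2 = Real.exp (-4) := by rw [← Real.exp_nat_mul]; norm_num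
  unfold ph
  rw [mul_pow, mul_pow, inv_pow, hpi, ← he]
  norm_num
  ring

lemma Qt_top : Qt (258 / 100) ≤ 0.0051 := by
  refine (Qt_le (a := 258 / 100) (by norm_num)).trans ?_
  have h1 : (25066 / 10000 : ℝ) ≤ Real.sqrt (2 * Real.pi) := by
    apply Real.le_sqrt_of_sq_le
    have := Real.pi_gt_d6
    norm_num at this ⊢
    linarith
  have h2 : Real.exp (-(258 / 100) ^ 2 / 2) ≤ 0.03588 := by
    have h : Real.exp (-(258 / 100) ^ 2 / 2) ^ 3 = Real.exp (-9.9846) := by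
      rw [← Real.exp_nat_mul]; norm_num
    refine le_of_pow_le_pow_left₀ (n := 3) (by norm_num) (by norm_num) ?_
    rw [h]
    have e : Real.exp (-9.9846) = Real.exp (-1) ^ 10 * Real.exp 0.0154 := by
      rw [← Real.exp_nat_mul, ← Real.exp_add]; norm_num
    have e2 : Real.exp 0.0154 ≤ 1 / (1 - 0.0154) := Real.exp_bound_div_one_sub_of_interval
      (by norm_num) (by norm_num)
    rw [e]
    calc _ ≤ (0.3678794412 : ℝ) ^ 10 * (1 / (1 - 0.0154)) := by
          have := Real.exp_neg_one_lt_d9.le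
          gcongr
      _ ≤ _ := by norm_num
  have h3 : (Real.sqrt (2 * Real.pi))⁻¹ ≤ (25066 / 10000)⁻¹ := by gcongr
  calc ph (258 / 100) * _ ≤ ((25066 / 10000)⁻¹ * 0.03588) *
        (((258 / 100) ^ 2 + 2) / ((258 / 100) ^ 3 + 3 * (258 / 100))) := by
        unfold ph
        gcongr
    _ ≤ _ := by norm_num

lemma fin_bound {V : ℝ} (h : 9 / 49 * Real.exp (-4) + V ≤ 320442 / 10000000) :
    Qt 2 ^ 2 + (2 * Real.pi)⁻¹ * V ≤ 0.0051 := by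
  have h1 := Qt_two_sq
  have h2 : (2 * Real.pi)⁻¹ * (9 / 49 * Real.exp (-4) + V) ≤ (2 * Real.pi)⁻¹ * (320442 / 10000000) := by
    gcongr
  have h3 : (2 * Real.pi)⁻¹ * (320442 / 10000000) ≤ 0.0051 := by
    rw [inv_mul_le_iff₀ (by positivity)]
    have := Real.pi_gt_d6
    norm_num at this ⊢
    linarith
  linarith

lemma wedge_bound (a b ρ : ℝ) (ha : 2 ≤ a) (hb : 2 ≤ b) (ha' : a ≤ 258 / 100)
    (hb' : b ≤ 258 / 100) (h0 : 0 ≤ ρ) (hρ : ρ ≤ a * b / 7) :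
    Qt a * Qt b + ∫ r in (0:ℝ)..ρ, bd a b r ≤ 0.0051 := by
  have hQ : Qt a * Qt b ≤ Qt 2 ^ 2 := by
    rw [sq]
    exact mul_le_mul (Qt_anti ha) (Qt_anti hb) (Qt_nonneg _) (Qt_nonneg _)
  have hab : a * b ≤ 66564 / 10000 := by nlinarith
  have hab4 : 4 ≤ a * b := by nlinarith
  set R := max ρ (4 / 7) with hR
  have hR1 : 7 * R ≤ a * b := by
    rw [hR]
    rcases max_cases ρ (4 / 7) with h | h <;> rw [h.1] <;> linarith
  have hR4 : 4 / 7 ≤ R := le_max_right _ _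
  have hR0 : 0 ≤ R := by linarith
  have hR2 : R ≤ 951 / 1000 := by linarith
  have hR3 : R < 1 := by linarith
  have hmono : ∫ r in (0:ℝ)..ρ, bd a b r ≤ ∫ r in (0:ℝ)..R, bd a b r := by
    apply intervalIntegral.integral_mono_interval le_rfl h0 (le_max_left _ _)
    · filter_upwards with r using bd_nonneg a b r
    · apply ContinuousOn.intervalIntegrable
      rw [Set.uIcc_of_le hR0]
      exact bd_contOn a b R hR3
  rcases le_total R (5 / 7) with h | h
  · have hI := int_le a b (7 * R) 4 R
      (fun r => 225 / 1000 + 109 / 1000 * r + 610 / 1000 * r ^ 2 - 687 / 1000 * r ^ 3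
        + 558 / 1000 * r ^ 4)
      (fun r => 109 / 1000 + 1220 / 1000 * r - 2061 / 1000 * r ^ 2 + 2232 / 1000 * r ^ 3)
      hR0 hR3 hR1 (by linarith) ?_ ?_ ?_ ?_
    · have hv := val_one (7 * R - 4) (by linarith) (by linarith)
      have e : 4 + (7 * R - 4) = 7 * R := by ring
      have e' : 7 * R / 7 = R := by ring
      rw [e, e'] at hv
      have := fin_bound hv
      norm_num at this hI ⊢
      linarith
    · intro r
      have := (((((hasDerivAt_id r).const_mul (109 / 1000)).const_add (225 / 1000)).add
        ((hasDerivAt_pow 2 r).const_mul (610 / 1000))).sub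
        ((hasDerivAt_pow 3 r).const_mul (687 / 1000))).add
        ((hasDerivAt_pow 4 r).const_mul (558 / 1000))
      exact this.congr_deriv (by norm_num; ring)
    · intro r hr
      have hr0 := hr.1
      nlinarith [mul_nonneg (sq_nonneg r) (sq_nonneg (r - 6 / 10)), sq_nonneg r]
    · intro r hr
      have hr0 : 0 ≤ r := hr.1
      have k1 : 0 < 109 / 1000 + 1220 / 1000 * r - 2061 / 1000 * r ^ 2 + 2232 / 1000 * r ^ 3 := by
        nlinarith [mul_nonneg hr0 (sq_nonneg (r - 1 / 2))]
      have k2 : 0 ≤ 225 / 1000 + 109 / 1000 * r + 610 / 1000 * r ^ 2 - 687 / 1000 * r ^ 3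
        + 558 / 1000 * r ^ 4 := by
        nlinarith [mul_nonneg (sq_nonneg r) (sq_nonneg (r - 6 / 10)), sq_nonneg r]
      positivity
    · intro r hr
      exact cert_one r hr.1 (hr.2.trans h)
  · have hI := int_le a b (7 * R) 5 R
      (fun r => 128 / 100 * r - 222 / 100 * r ^ 2 + 189 / 100 * r ^ 3)
      (fun r => 128 / 100 - 444 / 100 * r + 567 / 100 * r ^ 2)
      hR0 hR3 hR1 (by linarith) ?_ ?_ ?_ ?_
    · have hv := val_two (7 * R - 5) (by linarith) (by linarith)
      have e : 5 + (7 * R - 5) = 7 * R := by ring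
      have e' : 7 * R / 7 = R := by ring
      rw [e, e'] at hv
      have := fin_bound hv
      norm_num at this hI ⊢
      linarith
    · intro r
      have := (((hasDerivAt_id r).const_mul (128 / 100)).sub
        ((hasDerivAt_pow 2 r).const_mul (222 / 100))).add
        ((hasDerivAt_pow 3 r).const_mul (189 / 100))
      exact this.congr_deriv (by norm_num; ring)
    · intro r hr
      have hr0 : 0 ≤ r := hr.1
      nlinarith [mul_nonneg hr0 (sq_nonneg (r - 6 / 10)), sq_nonneg r]
    · intro r hr
      have hr0 : 0 ≤ r := hr.1
      have k1 : 0 < 128 / 100 - 444 / 100 * r + 567 / 100 * r ^ 2 := by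
        nlinarith [sq_nonneg (r - 4 / 10)]
      have k2 : 0 ≤ 128 / 100 * r - 222 / 100 * r ^ 2 + 189 / 100 * r ^ 3 := by
        nlinarith [mul_nonneg hr0 (sq_nonneg (r - 6 / 10)), sq_nonneg r]
      positivity
    · intro r hr
      exact cert_two r hr.1 (hr.2.trans hR2)

lemma abs_le_of_sq_le_sq_aux {x y : ℝ} (h : x ^ 2 ≤ y ^ 2) (hy : 0 ≤ y) : x ≤ y :=
  (abs_le_of_sq_le_sq' h hy).2

lemma meas_and {Ω : Type*} [MeasurableSpace Ω] (f g h k : Ω → ℝ) (hf : Measurable f)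
    (hg : Measurable g) (hh : Measurable h) (hk : Measurable k) :
    MeasurableSet {z | f z ≤ g z ∧ h z ≤ k z} := by
  have : {z | f z ≤ g z ∧ h z ≤ k z} = {z | f z ≤ g z} ∩ {z | h z ≤ k z} := by
    ext z; simp
  rw [this]
  exact (measurableSet_le hf hg).inter (measurableSet_le hh hk)

lemma tail_set (α β h : ℝ) (hh : 0 < h) (hv : (258/100)^2*(α^2+β^2) ≤ h^2) :
    (((gaussianReal 0 1).prod (gaussianReal 0 1)) {z : ℝ × ℝ | h ≤ α*z.1+β*z.2}).toReal
      ≤ 0.0051 := by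
  rcases (add_nonneg (sq_nonneg α) (sq_nonneg β)).eq_or_lt with h0 | h0
  · have ha : α = 0 := by nlinarith [sq_nonneg α, sq_nonneg β]
    have hb : β = 0 := by nlinarith [sq_nonneg α, sq_nonneg β]
    have : {z : ℝ × ℝ | h ≤ α*z.1+β*z.2} = ∅ := by
      ext z
      simp [ha, hb, hh]
    rw [this]
    norm_num
  · set σ := Real.sqrt (α^2+β^2) with hσ
    have hσp : 0 < σ := Real.sqrt_pos.2 h0
    have hσ2 : σ^2 = α^2+β^2 := Real.sq_sqrt h0.le
    have hr := rot (α/σ) (β/σ) (-β/σ) (α/σ)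
      (by field_simp; linarith) (by field_simp; linarith) (by field_simp; ring)
    have hset : {z : ℝ × ℝ | h ≤ α*z.1+β*z.2} =
        (fun z : ℝ×ℝ => ((α/σ)*z.1+(β/σ)*z.2, (-β/σ)*z.1+(α/σ)*z.2)) ⁻¹'
          (Set.Ici (h/σ) ×ˢ Set.univ) := by
      ext z
      simp only [Set.mem_ofPred_eq, Set.mem_preimage, Set.mem_prod, Set.mem_Ici, Set.mem_univ,
        and_true]
      rw [div_le_iff₀ hσp]
      have : ((α/σ)*z.1+(β/σ)*z.2) * σ = α*z.1+β*z.2 := by field_simp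
      rw [this]
    rw [hset, ← Measure.map_apply (by fun_prop) (measurableSet_Ici.prod MeasurableSet.univ), hr,
      Measure.prod_prod, measure_univ, mul_one, gauss_Ici]
    refine (Qt_anti ?_).trans Qt_top
    rw [le_div_iff₀ hσp]
    refine abs_le_of_sq_le_sq_aux ?_ hh.le
    rw [mul_pow, hσ2]
    exact hv

lemma wedge_set (a b ρ s : ℝ) (hs : 0 < s) :
    (((gaussianReal 0 1).prod (gaussianReal 0 1))
      {z : ℝ × ℝ | a ≤ z.1 ∧ b ≤ ρ*z.1+s*z.2}).toReal
      = ∫ x in Set.Ioi a, ph x * Qt ((b - ρ*x)/s) := by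
  have hm : MeasurableSet {z : ℝ × ℝ | a ≤ z.1 ∧ b ≤ ρ*z.1+s*z.2} :=
    meas_and _ _ _ _ (by fun_prop) (by fun_prop) (by fun_prop) (by fun_prop)
  rw [Measure.prod_apply hm, ← integral_toReal (measurable_measure_prodMk_left hm).aemeasurable
    (Filter.Eventually.of_forall fun x => measure_lt_top _ _),
    integral_gaussianReal_eq_integral_smul one_ne_zero, ph_eq, ← integral_Ici_eq_integral_Ioi,
    ← integral_indicator measurableSet_Ici]
  congr 1
  ext x
  by_cases hx : a ≤ x
  · rw [Set.indicator_of_mem (Set.mem_Ici.2 hx), ← gauss_Ici, smul_eq_mul]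
    congr 3
    ext y
    simp only [Set.mem_preimage, Set.mem_ofPred_eq, hx, true_and, Set.mem_Ici]
    rw [div_le_iff₀ hs]
    constructor <;> intro h <;> nlinarith
  · rw [Set.indicator_of_notMem (by simpa using hx)]
    have : (Prod.mk x ⁻¹' {z : ℝ × ℝ | a ≤ z.1 ∧ b ≤ ρ*z.1+s*z.2}) = ∅ := by
      ext y
      simp [hx]
    rw [this]
    simp

lemma core (N : ℝ) (hN : 0 < N) (α β γ δ : ℝ) (hX : α^2+β^2 ≤ N/4) (hY : γ^2+δ^2 ≤ N/4)
    (hC : α*γ+β*δ ≤ N/7) :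
    (((gaussianReal 0 1).prod (gaussianReal 0 1)) {z : ℝ × ℝ | Real.sqrt N ≤ α*z.1+β*z.2 ∧
      Real.sqrt N ≤ γ*z.1+δ*z.2}).toReal ≤ 0.0051 := by
  set n := Real.sqrt N with hn
  have hnp : 0 < n := Real.sqrt_pos.2 hN
  have hn2 : n^2 = N := Real.sq_sqrt hN.le
  by_cases h1 : (258/100)^2*(α^2+β^2) ≤ N
  · refine le_trans (ENNReal.toReal_mono (measure_ne_top _ _) (measure_mono ?_))
      (tail_set α β n hnp (by rw [hn2]; exact h1))
    exact fun z hz => hz.1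
  by_cases h2 : (258/100)^2*(γ^2+δ^2) ≤ N
  · refine le_trans (ENNReal.toReal_mono (measure_ne_top _ _) (measure_mono ?_))
      (tail_set γ δ n hnp (by rw [hn2]; exact h2))
    exact fun z hz => hz.2
  by_cases h3 : α*γ+β*δ ≤ 0
  · refine le_trans (ENNReal.toReal_mono (measure_ne_top _ _) (measure_mono ?_))
      (tail_set (α+γ) (β+δ) (2*n) (by positivity) (by rw [mul_pow, hn2]; nlinarith))
    intro z hz
    have h1 := hz.1
    have h2 := hz.2
    simp only [Set.mem_ofPred_eq]
    linarith
  push Not at h1 h2 h3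
  have hV1 : 0 < α^2+β^2 := by nlinarith
  have hV2 : 0 < γ^2+δ^2 := by nlinarith
  set σ := Real.sqrt (α^2+β^2) with hσ
  have hσp : 0 < σ := Real.sqrt_pos.2 hV1
  have hσ2 : σ^2 = α^2+β^2 := Real.sq_sqrt hV1.le
  set τ := Real.sqrt (γ^2+δ^2) with hτ
  have hτp : 0 < τ := Real.sqrt_pos.2 hV2
  have hτ2 : τ^2 = γ^2+δ^2 := Real.sq_sqrt hV2.le
  have ha : 2 ≤ n/σ := by
    rw [le_div_iff₀ hσp]
    refine abs_le_of_sq_le_sq_aux ?_ hnp.le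
    rw [mul_pow]; linarith
  have hb : 2 ≤ n/τ := by
    rw [le_div_iff₀ hτp]
    refine abs_le_of_sq_le_sq_aux ?_ hnp.le
    rw [mul_pow]; linarith
  have ha' : n/σ ≤ 258/100 := by
    rw [div_le_iff₀ hσp]
    refine abs_le_of_sq_le_sq_aux ?_ (by positivity)
    rw [mul_pow]; linarith
  have hb' : n/τ ≤ 258/100 := by
    rw [div_le_iff₀ hτp]
    refine abs_le_of_sq_le_sq_aux ?_ (by positivity)
    rw [mul_pow]; linarith
  obtain ⟨ρ, hρ⟩ : ∃ ρ, ρ = (α*γ+β*δ)/(σ*τ) := ⟨_, rfl⟩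
  have hρ0 : 0 ≤ ρ := by rw [hρ]; positivity
  have hρ7 : ρ ≤ (n/σ)*(n/τ)/7 := by
    have : (n/σ)*(n/τ)/7 = (N/7)/(σ*τ) := by rw [← hn2]; field_simp
    rw [this, hρ]
    gcongr
  have hρ1 : ρ < 1 := by nlinarith
  have hs1 : 0 < 1-ρ^2 := by nlinarith
  have hpl := plackett (n/σ) (n/τ) ρ hρ0 hρ1
  have hwb := wedge_bound (n/σ) (n/τ) ρ ha hb ha' hb' hρ0 hρ7
  set s := Real.sqrt (1-ρ^2) with hs
  have hsp : 0 < s := Real.sqrt_pos.2 hs1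
  have hs2 : s^2 = 1-ρ^2 := Real.sq_sqrt hs1.le
  obtain ⟨p, hp⟩ : ∃ p, p = α/σ := ⟨_, rfl⟩
  obtain ⟨q, hq⟩ : ∃ p, p = β/σ := ⟨_, rfl⟩
  obtain ⟨u, hu⟩ : ∃ p, p = γ/τ := ⟨_, rfl⟩
  obtain ⟨v, hv⟩ : ∃ p, p = δ/τ := ⟨_, rfl⟩
  have e1 : p^2+q^2 = 1 := by rw [hp, hq]; field_simp; linarith
  have e2 : u^2+v^2 = 1 := by rw [hu, hv]; field_simp; linarith
  have e3 : p*u+q*v = ρ := by rw [hp, hq, hu, hv, hρ]; field_simp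
  have hr := rot p q ((u-ρ*p)/s) ((v-ρ*q)/s) e1
    (by
      field_simp
      rw [hs2]
      linear_combination e2 - 2*ρ*e3 + ρ^2*e1)
    (by
      field_simp
      linear_combination e3 - ρ*e1)
  have hm : MeasurableSet {z : ℝ × ℝ | n/σ ≤ z.1 ∧ n/τ ≤ ρ*z.1+s*z.2} :=
    meas_and _ _ _ _ (by fun_prop) (by fun_prop) (by fun_prop) (by fun_prop)
  have hset : {z : ℝ × ℝ | n ≤ α*z.1+β*z.2 ∧ n ≤ γ*z.1+δ*z.2} =
      (fun z : ℝ×ℝ => (p*z.1+q*z.2, ((u-ρ*p)/s)*z.1+((v-ρ*q)/s)*z.2)) ⁻¹'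
        {z : ℝ × ℝ | n/σ ≤ z.1 ∧ n/τ ≤ ρ*z.1+s*z.2} := by
    ext z
    simp only [Set.mem_ofPred_eq, Set.mem_preimage]
    rw [div_le_iff₀ hσp, div_le_iff₀ hτp]
    have f1 : (p*z.1+q*z.2) * σ = α*z.1+β*z.2 := by rw [hp, hq]; field_simp
    have f2 : (ρ*(p*z.1+q*z.2)+s*(((u-ρ*p)/s)*z.1+((v-ρ*q)/s)*z.2)) = u*z.1+v*z.2 := by
      field_simp; ring
    have f3 : (u*z.1+v*z.2) * τ = γ*z.1+δ*z.2 := by rw [hu, hv]; field_simp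
    rw [f2, f1, f3]
  rw [hset, ← Measure.map_apply (by fun_prop) hm, hr, wedge_set _ _ _ _ hsp, hpl]
  exact hwb

/-- **Gaussian opposite-tail corollary.** If `(𝒳, 𝒴)` is bivariate Gaussian with
`Var(𝒳) ≤ N/4`, `Var(𝒴) ≤ N/4` and `−Cov(𝒳,𝒴) ≤ N/7` (equivalently
`Cov(𝒳,𝒴) ≥ −N/7`), then `P(𝒳 − E[𝒳] ≥ √N ∧ 𝒴 − E[𝒴] ≤ −√N) ≤ 0.0051`.
This follows from the Gaussian upper-tail lemma applied to `(𝒳, −𝒴)`, whose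
covariance is `−Cov(𝒳,𝒴)`. -/
theorem gaussian_opposite_tail (N : ℝ) (hN : 0 < N)
    (μ : Measure (Fin 2 → ℝ)) (m : Fin 2 → ℝ) (S : Matrix (Fin 2) (Fin 2) ℝ)
    (hG : IsGaussianWith μ m S)
    (hX : S 0 0 ≤ N / 4) (hY : S 1 1 ≤ N / 4) (hC : -(S 0 1) ≤ N / 7) :
    (μ {x | Real.sqrt N ≤ x 0 - m 0 ∧ x 1 - m 1 ≤ -Real.sqrt N}).toReal ≤ 0.0051 := by
  obtain ⟨L, hL, rfl⟩ := hG
  subst hL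
  simp only [Matrix.mul_apply, Matrix.transpose_apply, Fin.sum_univ_two] at hX hY hC
  have hc := core N hN (L 0 0) (L 0 1) (-L 1 0) (-L 1 1) (by linarith) (by linarith) (by linarith)
  have hm1 : MeasurableSet {x : Fin 2 → ℝ | Real.sqrt N ≤ x 0 - m 0 ∧ x 1 - m 1 ≤ -Real.sqrt N} :=
    meas_and _ _ _ _ (by fun_prop) (by fun_prop) (by fun_prop) (by fun_prop)
  have hm2 : MeasurableSet {z : ℝ × ℝ | Real.sqrt N ≤ L 0 0*z.1+L 0 1*z.2 ∧
      Real.sqrt N ≤ -L 1 0*z.1+ -L 1 1*z.2} :=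
    meas_and _ _ _ _ (by fun_prop) (by fun_prop) (by fun_prop) (by fun_prop)
  have hmeas : Measurable (fun x : Fin 2 → ℝ => m + L.mulVec x) := by
    refine measurable_pi_lambda _ fun i => ?_
    simp only [Pi.add_apply, Matrix.mulVec, dotProduct, Fin.sum_univ_two]
    fun_prop
  rw [← std2, Measure.map_apply (by fun_prop) hm2] at hc
  rw [Measure.map_apply hmeas hm1]
  suffices he : ((fun x : Fin 2 → ℝ => m + L.mulVec x) ⁻¹'
      {x | Real.sqrt N ≤ x 0 - m 0 ∧ x 1 - m 1 ≤ -Real.sqrt N}) =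
      ((fun x : Fin 2 → ℝ => (x 0, x 1)) ⁻¹' {z : ℝ × ℝ | Real.sqrt N ≤ L 0 0*z.1+L 0 1*z.2 ∧
      Real.sqrt N ≤ -L 1 0*z.1+ -L 1 1*z.2}) by
    rw [he]
    exact hc
  ext x
  simp only [Set.mem_preimage, Set.mem_ofPred_eq, Pi.add_apply, Matrix.mulVec, dotProduct,
    Fin.sum_univ_two]
  constructor <;> rintro ⟨h1, h2⟩ <;> constructor <;> linarith
end

section
/- Let N > 0 and let (A₀, A₁, B₀, B₁) be distributed according to a multivariate Gaussian on ℝ⁴ with Var(Aₓ) ≤ N/4 and Var(B_y) ≤ N/4 for all x, y ∈ {0,1}, and with Cov(A₀,B₀) + Cov(A₀,B₁) + Cov(A₁,B₀) − Cov(A₁,B₁) ≤ 4N/7. For (x,y) with x∧y = 0, define the round-win probability w(x,y) := P(Aₓ − E[Aₓ] ≥ √N ∧ B_y − E[B_y] ≥ √N) + P(Aₓ − E[Aₓ] ≤ −√N ∧ B_y − E[B_y] ≤ −√N); for (x,y) = (1,1), define w(1,1) := P(A₁ − E[A₁] ≥ √N ∧ B₁ − E[B₁] ≤ −√N) + P(A₁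 − E[A₁] ≤ −√N ∧ B₁ − E[B₁] ≥ √N). Then min over the four question pairs (x,y) ∈ {0,1}² of w(x,y) is at most 0.0102. -/
open MeasureTheory ProbabilityTheory

lemma int_exp_lin (v : Fin 4 → ℝ) :
    ∫ z, Complex.exp (((∑ i, v i * z i : ℝ) : ℂ) * Complex.I) ∂(stdGaussianPi 4)
      = Complex.exp (-((∑ i, v i ^ 2 : ℝ) : ℂ) / 2) := by
  have h1 : ∀ z : Fin 4 → ℝ, Complex.exp (((∑ i, v i * z i : ℝ) : ℂ) * Complex.I)
      = ∏ i, Complex.exp (((v i : ℂ)) * (z i : ℂ) * Complex.I) := by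
    intro z
    rw [← Complex.exp_sum]
    congr 1
    push_cast
    rw [Finset.sum_mul]
  simp_rw [h1]
  unfold stdGaussianPi
  rw [MeasureTheory.integral_fintype_prod_eq_prod (𝕜 := ℂ)
    (f := fun i (x : ℝ) => Complex.exp ((v i : ℂ) * (x : ℂ) * Complex.I))]
  simp_rw [← charFun_apply_real, charFun_gaussianReal]
  rw [← Complex.exp_sum]
  congr 1
  push_cast
  simp [Finset.sum_div, neg_div]

instance : IsProbabilityMeasure (stdGaussianPi 4) := by
  unfold stdGaussianPi; infer_instance

lemma law_one (p : Fin 4 → ℝ) :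
    (stdGaussianPi 4).map (fun z => ∑ i, p i * z i)
      = gaussianReal 0 (∑ i, p i ^ 2).toNNReal := by
  have hm : Measurable (fun z : Fin 4 → ℝ => ∑ i, p i * z i) := by fun_prop
  have : IsProbabilityMeasure ((stdGaussianPi 4).map (fun z => ∑ i, p i * z i)) :=
    Measure.isProbabilityMeasure_map hm.aemeasurable
  apply Measure.ext_of_charFun
  ext t
  rw [charFun_apply_real, integral_map hm.aemeasurable (by fun_prop), charFun_gaussianReal]
  have := int_exp_lin (fun i => t * p i)
  have h0 : 0 ≤ ∑ i, p i ^ 2 := Finset.sum_nonneg (fun i _ => sq_nonneg _)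
  have e : ∀ z : Fin 4 → ℝ, ((∑ i, t * p i * z i : ℝ) : ℂ) = (t : ℂ) * ((∑ i, p i * z i : ℝ) : ℂ) := by
    intro z; push_cast; rw [Finset.mul_sum]; simp only [mul_assoc]
  simp_rw [e] at this
  rw [this]
  congr 1
  have h2 : (((∑ i, p i ^ 2).toNNReal : ℝ) : ℂ) = ((∑ i, p i ^ 2 : ℝ) : ℂ) := by
    rw [Real.coe_toNNReal _ h0]
  rw [h2]
  push_cast
  simp only [mul_pow, ← Finset.mul_sum]
  ring

lemma law_two (p q : Fin 4 → ℝ) (hp : ∑ i, p i ^ 2 = 1) (hq : ∑ i, q i ^ 2 = 1)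
    (hpq : ∑ i, p i * q i = 0) :
    (stdGaussianPi 4).map (fun z => (∑ i, p i * z i, ∑ i, q i * z i))
      = (gaussianReal 0 1).prod (gaussianReal 0 1) := by
  have hm : Measurable (fun z : Fin 4 → ℝ => (∑ i, p i * z i, ∑ i, q i * z i)) := by fun_prop
  have : IsProbabilityMeasure
      ((stdGaussianPi 4).map (fun z => (∑ i, p i * z i, ∑ i, q i * z i))) :=
    Measure.isProbabilityMeasure_map hm.aemeasurable
  rw [← charFun_eq_prod_iff]
  intro t
  rw [charFun_gaussianReal, charFun_gaussianReal, charFun_apply,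
    integral_map (by fun_prop) (by fun_prop),
    integral_map hm.aemeasurable (by fun_prop), ← Complex.exp_add]
  have := int_exp_lin (fun i => t.fst * p i + t.snd * q i)
  have e : ∀ z : Fin 4 → ℝ,
      inner ℝ (WithLp.toLp 2 (∑ i, p i * z i, ∑ i, q i * z i)) t
        = ∑ i, (t.fst * p i + t.snd * q i) * z i := by
    intro z
    simp only [WithLp.prod_inner_apply, RCLike.inner_apply, conj_trivial, Fin.sum_univ_four]
    simp only [WithLp.ofLp_fst, WithLp.ofLp_snd]
    ring
  simp_rw [e]
  rw [this]
  congr 1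
  have h2 : ∑ i, (t.fst * p i + t.snd * q i) ^ 2 = t.fst ^ 2 + t.snd ^ 2 := by
    have : ∑ i, (t.fst * p i + t.snd * q i) ^ 2 = t.fst ^ 2 * ∑ i, p i ^ 2
      + t.snd ^ 2 * ∑ i, q i ^ 2 + 2 * t.fst * t.snd * ∑ i, p i * q i := by
      simp only [Fin.sum_univ_four]; ring
    rw [this, hp, hq, hpq]; ring
  rw [h2]
  push_cast
  simp
  ring

/-- The standard normal density. -/
noncomputable def phi (x : ℝ) : ℝ := (Real.sqrt (2 * Real.pi))⁻¹ * Real.exp (-x ^ 2 / 2)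

/-- The standard normal tail. -/
noncomputable def Qf (t : ℝ) : ℝ := ∫ x in Set.Ioi t, phi x

lemma phi_eq : gaussianPDFReal 0 1 = phi := by
  ext x; simp [gaussianPDFReal, phi]

lemma phi_pos (x : ℝ) : 0 < phi x := by unfold phi; positivity

lemma phi_le_one (x : ℝ) : phi x ≤ 1 := by
  unfold phi
  have h1 : (Real.sqrt (2 * Real.pi))⁻¹ ≤ 1 := by
    apply inv_le_one_of_one_le₀
    rw [Real.one_le_sqrt]
    linarith [Real.pi_gt_three]
  have h2 : Real.exp (-x ^ 2 / 2) ≤ 1 := by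
    apply Real.exp_le_one_iff.mpr; nlinarith [sq_nonneg x]
  exact mul_le_one₀ h1 (Real.exp_pos _).le h2

lemma phi_continuous : Continuous phi := by unfold phi; fun_prop

lemma phi_integrable : Integrable phi := by
  rw [← phi_eq]; exact integrable_gaussianPDFReal 0 1

lemma phi_integral : ∫ x, phi x = 1 := by
  rw [← phi_eq]; exact integral_gaussianPDFReal_eq_one 0 one_ne_zero

lemma phi_hasDeriv (x : ℝ) : HasDerivAt phi (-x * phi x) x := by
  unfold phi
  have h : HasDerivAt (fun x : ℝ => -x ^ 2 / 2) (-x) x := by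
    have := ((hasDerivAt_id x).pow 2).neg.div_const 2
    convert! this using 1
    simp; ring
  convert! (h.exp.const_mul ((Real.sqrt (2 * Real.pi))⁻¹)) using 1
  ring

lemma phi_tendsto : Filter.Tendsto phi Filter.atTop (nhds 0) := by
  have h : Filter.Tendsto (fun x : ℝ => Real.exp (-x ^ 2 / 2)) Filter.atTop (nhds 0) := by
    apply Real.tendsto_exp_atBot.comp
    have : Filter.Tendsto (fun x : ℝ => x ^ 2) Filter.atTop Filter.atTop :=
      Filter.tendsto_pow_atTop two_ne_zero
    have := Filter.tendsto_neg_atTop_atBot.comp this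
    exact this.atBot_div_const (by norm_num : (0:ℝ) < 2)
  have := h.const_mul ((Real.sqrt (2 * Real.pi))⁻¹)
  rw [mul_zero] at this
  exact this

lemma Qf_hasDeriv (t : ℝ) : HasDerivAt Qf (-phi t) t := by
  have h : Qf = fun t => Qf 0 - ∫ x in (0:ℝ)..t, phi x := by
    ext t
    have := intervalIntegral.integral_interval_add_Ioi (μ := volume) (f := phi) (a := 0) (b := t)
      phi_integrable.integrableOn phi_integrable.integrableOn
    unfold Qf
    rw [← this]; ring
  rw [h]
  have := intervalIntegral.integral_hasDerivAt_right (f := phi) (a := 0) (b := t)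
    (phi_continuous.intervalIntegrable _ _)
    (phi_continuous.stronglyMeasurableAtFilter _ _) phi_continuous.continuousAt
  simpa using this.const_sub (Qf 0)

lemma Qf_nonneg (t : ℝ) : 0 ≤ Qf t :=
  setIntegral_nonneg measurableSet_Ioi (fun x _ => (phi_pos x).le)

lemma Qf_le_one (t : ℝ) : Qf t ≤ 1 := by
  rw [← phi_integral]
  exact setIntegral_le_integral phi_integrable (Filter.Eventually.of_forall fun x => (phi_pos x).le)

lemma Qf_antitone : Antitone Qf := by
  apply antitone_of_hasDerivAt_nonpos Qf_hasDeriv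
  intro x; have := phi_pos x; simp; linarith

lemma Qf_continuous : Continuous Qf :=
  continuous_iff_continuousAt.mpr fun t => (Qf_hasDeriv t).continuousAt

lemma Qf_measure (t : ℝ) : (gaussianReal 0 1).real (Set.Ici t) = Qf t := by
  rw [Measure.real, gaussianReal_apply_eq_integral 0 one_ne_zero, ENNReal.toReal_ofReal,
    phi_eq, integral_Ici_eq_integral_Ioi]
  · rfl
  · rw [phi_eq]; exact setIntegral_nonneg measurableSet_Ici (fun x _ => (phi_pos x).le)

lemma Qf_bound (t : ℝ) (ht : 0 < t) :
    Qf t ≤ phi t * ((t ^ 4 + 9 * t ^ 2 + 8) / (t ^ 5 + 10 * t ^ 3 + 15 * t)) := by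
  set B : ℝ → ℝ := fun t => phi t * ((t ^ 4 + 9 * t ^ 2 + 8) / (t ^ 5 + 10 * t ^ 3 + 15 * t)) with hB
  set B' : ℝ → ℝ := fun t => -t * phi t * ((t ^ 4 + 9 * t ^ 2 + 8) / (t ^ 5 + 10 * t ^ 3 + 15 * t))
    + phi t * (((4 * t ^ 3 + 18 * t) * (t ^ 5 + 10 * t ^ 3 + 15 * t)
      - (t ^ 4 + 9 * t ^ 2 + 8) * (5 * t ^ 4 + 30 * t ^ 2 + 15))
        / (t ^ 5 + 10 * t ^ 3 + 15 * t) ^ 2) with hB'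
  have hd : ∀ x ∈ Set.Ici t, HasDerivAt B (B' x) x := by
    intro x hx
    have hx0 : 0 < x := lt_of_lt_of_le ht hx
    have hD : x ^ 5 + 10 * x ^ 3 + 15 * x ≠ 0 := by positivity
    have h1 : HasDerivAt (fun t : ℝ => t ^ 4 + 9 * t ^ 2 + 8) (4 * x ^ 3 + 18 * x) x := by
      have := (((hasDerivAt_id x).pow 4).add (((hasDerivAt_id x).pow 2).const_mul 9)).add_const 8
      convert! this using 1
      simp; ring
    have h2 : HasDerivAt (fun t : ℝ => t ^ 5 + 10 * t ^ 3 + 15 * t)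
        (5 * x ^ 4 + 30 * x ^ 2 + 15) x := by
      have := (((hasDerivAt_id x).pow 5).add (((hasDerivAt_id x).pow 3).const_mul 10)).add
        ((hasDerivAt_id x).const_mul 15)
      convert! this using 1
      simp; ring
    exact (phi_hasDeriv x).mul (h1.div h2 hD)
  have hle : ∀ x, 0 < x → phi x ≤ -B' x := by
    intro x hx
    have hD : 0 < x ^ 5 + 10 * x ^ 3 + 15 * x := by positivity
    have e : -B' x - phi x = phi x * (120 / (x ^ 5 + 10 * x ^ 3 + 15 * x) ^ 2) := by
      rw [hB']; field_simp; ring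
    have : 0 ≤ phi x * (120 / (x ^ 5 + 10 * x ^ 3 + 15 * x) ^ 2) := by
      have := phi_pos x; positivity
    linarith
  have hneg : ∀ x ∈ Set.Ioi t, B' x ≤ 0 := by
    intro x hx
    have := hle x (lt_trans ht hx); have := phi_pos x; linarith
  have hlim : Filter.Tendsto B Filter.atTop (nhds 0) := by
    apply squeeze_zero' (g := phi) _ _ phi_tendsto
    · filter_upwards [Filter.eventually_gt_atTop 0] with x hx
      have := phi_pos x
      rw [hB]; positivity
    · filter_upwards [Filter.eventually_ge_atTop 1] with x hx
      have := phi_pos x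
      have h0 : 0 < x := by linarith
      rw [hB]
      apply mul_le_of_le_one_right this.le
      rw [div_le_one (by positivity)]
      have h3 : x ^ 4 ≤ x ^ 5 := by
        have : 0 ≤ x ^ 4 * (x - 1) := by have : 0 ≤ x - 1 := by linarith
                                         positivity
        nlinarith
      have h4 : x ^ 2 ≤ x ^ 3 := by
        have : 0 ≤ x ^ 2 * (x - 1) := by have : 0 ≤ x - 1 := by linarith
                                         positivity
        nlinarith
      have : 0 ≤ x ^ 3 := by positivity
      linarith
  have hi := integral_Ioi_of_hasDerivAt_of_nonpos' hd hneg hlim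
  have hint := integrableOn_Ioi_deriv_of_nonpos' hd hneg hlim
  have : Qf t ≤ ∫ x in Set.Ioi t, -B' x := by
    unfold Qf
    apply setIntegral_mono_on phi_integrable.integrableOn hint.neg measurableSet_Ioi
    intro x hx; exact hle x (lt_trans ht hx)
  rw [integral_neg, hi] at this
  simpa using this

/-- Bivariate normal orthant-type tail with correlation `r`. -/
noncomputable def Lf (h k r : ℝ) : ℝ :=
  ∫ x in Set.Ioi h, phi x * Qf ((k - r * x) / Real.sqrt (1 - r ^ 2))

lemma Lf_zero (h k : ℝ) : Lf h k 0 = Qf h * Qf k := by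
  unfold Lf
  simp only [zero_mul, sub_zero]
  norm_num
  rw [integral_mul_const]; rfl

lemma abs_phi_integrable : Integrable (fun x : ℝ => |x| * phi x) := by
  have := (integrable_mul_exp_neg_mul_sq (b := 1 / 2) (by norm_num)).norm.const_mul
    ((Real.sqrt (2 * Real.pi))⁻¹)
  refine this.congr (Filter.Eventually.of_forall fun x => ?_)
  simp only [norm_mul, Real.norm_eq_abs, Real.abs_exp, phi]
  rw [show -(1 / 2) * x ^ 2 = -x ^ 2 / 2 by ring]
  ring

lemma inner_hasDeriv (k x r : ℝ) (hr : 0 < 1 - r ^ 2) :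
    HasDerivAt (fun r => (k - r * x) / Real.sqrt (1 - r ^ 2))
      ((r * k - x) / ((1 - r ^ 2) * Real.sqrt (1 - r ^ 2))) r := by
  have hs : 0 < Real.sqrt (1 - r ^ 2) := Real.sqrt_pos.mpr hr
  have hs2 : Real.sqrt (1 - r ^ 2) ^ 2 = 1 - r ^ 2 := Real.sq_sqrt hr.le
  have h1 : HasDerivAt (fun r : ℝ => k - r * x) (-x) r := by
    have := ((hasDerivAt_id r).mul_const x).const_sub k
    convert! this using 1
    simp
  have h0 : HasDerivAt (fun r : ℝ => 1 - r ^ 2) (-(2 * r)) r := by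
    have := ((hasDerivAt_id r).pow 2).const_sub 1
    convert! this using 1
    simp
  have h2 := h0.sqrt hr.ne'
  have h3 := h1.div h2 hs.ne'
  convert! h3 using 1
  set s := Real.sqrt (1 - r ^ 2) with hsdef
  rw [← hs2]
  have hr2 : r ^ 2 = 1 - s ^ 2 := by linarith
  field_simp
  have hkey : x * (r ^ 2 + s ^ 2 - 1) = 0 := by rw [hr2]; ring
  linarith

/-- The `r`-derivative of the integrand. -/
noncomputable def dF (k r x : ℝ) : ℝ :=
  phi x * (phi ((k - r * x) / Real.sqrt (1 - r ^ 2)) *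
    ((x - r * k) / ((1 - r ^ 2) * Real.sqrt (1 - r ^ 2))))

/-- The bivariate density. -/
noncomputable def phi2 (x k r : ℝ) : ℝ :=
  phi x * phi ((k - r * x) / Real.sqrt (1 - r ^ 2)) / Real.sqrt (1 - r ^ 2)

lemma phi2_hasDeriv (x k r : ℝ) (hr : 0 < 1 - r ^ 2) :
    HasDerivAt (fun x => phi2 x k r) (-dF k r x) x := by
  have hs : 0 < Real.sqrt (1 - r ^ 2) := Real.sqrt_pos.mpr hr
  have hs2 : Real.sqrt (1 - r ^ 2) ^ 2 = 1 - r ^ 2 := Real.sq_sqrt hr.le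
  unfold phi2 dF
  have h1 : HasDerivAt (fun x : ℝ => (k - r * x) / Real.sqrt (1 - r ^ 2))
      (-r / Real.sqrt (1 - r ^ 2)) x := by
    have := (((hasDerivAt_id x).const_mul r).const_sub k).div_const (Real.sqrt (1 - r ^ 2))
    convert! this using 1
    simp
  have h2 := (phi_hasDeriv ((k - r * x) / Real.sqrt (1 - r ^ 2))).comp x h1
  have h3 := ((phi_hasDeriv x).mul h2).div_const (Real.sqrt (1 - r ^ 2))
  convert! h3 using 1
  simp only [Function.comp]
  set s := Real.sqrt (1 - r ^ 2) with hsdef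
  rw [← hs2]
  have hr2 : r ^ 2 = 1 - s ^ 2 := by linarith
  generalize phi ((k - r * x) / s) = P
  generalize phi x = P'
  field_simp
  linear_combination (P * P' * x) * hr2

lemma phi2_tendsto (k r : ℝ) (hr : 0 < 1 - r ^ 2) :
    Filter.Tendsto (fun x => phi2 x k r) Filter.atTop (nhds 0) := by
  have hs : 0 < Real.sqrt (1 - r ^ 2) := Real.sqrt_pos.mpr hr
  have h := phi_tendsto.div_const (Real.sqrt (1 - r ^ 2))
  rw [zero_div] at h
  apply squeeze_zero _ _ h
  · intro x
    have := phi_pos x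
    have := phi_pos ((k - r * x) / Real.sqrt (1 - r ^ 2))
    unfold phi2; positivity
  · intro x
    unfold phi2
    gcongr
    exact mul_le_of_le_one_right (phi_pos x).le (phi_le_one _)

lemma Lf_hasDeriv (h k r : ℝ) (hr : |r| < 1) : HasDerivAt (Lf h k) (phi2 h k r) r := by
  set R := (1 + |r|) / 2 with hR
  have hR1 : R < 1 := by rw [hR]; linarith
  have hR0 : 0 < R := by rw [hR]; linarith [abs_nonneg r]
  have hrR : |r| < R := by rw [hR]; linarith
  set d := 1 - R ^ 2 with hd
  have hd0 : 0 < d := by rw [hd]; nlinarith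
  have hdx : ∀ x ∈ Set.Ioo (-R) R, d ≤ 1 - x ^ 2 := by
    intro x hx
    have : x ^ 2 ≤ R ^ 2 := sq_le_sq' hx.1.le hx.2.le
    rw [hd]; linarith
  have hmem : r ∈ Set.Ioo (-R) R := abs_lt.mp hrR
  have hr' : 0 < 1 - r ^ 2 := lt_of_lt_of_le hd0 (hdx r hmem)
  have key := hasDerivAt_integral_of_dominated_loc_of_deriv_le (μ := volume.restrict (Set.Ioi h))
    (F := fun r x => phi x * Qf ((k - r * x) / Real.sqrt (1 - r ^ 2)))
    (F' := fun r x => dF k r x) (x₀ := r) (s := Set.Ioo (-R) R)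
    (bound := fun x => (|x| * phi x + |k| * phi x) / (d * Real.sqrt d))
    (Ioo_mem_nhds hmem.1 hmem.2) ?_ ?_ ?_ ?_ ?_ ?_
  · have e : ∫ x in Set.Ioi h, dF k r x = phi2 h k r := by
      have hi := integral_Ioi_of_hasDerivAt_of_tendsto' (a := h) (f := fun x => phi2 x k r)
        (fun x _ => phi2_hasDeriv x k r hr') key.1.neg (phi2_tendsto k r hr')
      rw [integral_neg] at hi
      linarith
    have := key.2
    rw [e] at this
    exact this
  · refine Filter.Eventually.of_forall fun r => ?_
    have := phi_continuous
    have := Qf_continuous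
    exact (by fun_prop : Continuous fun x => phi x * Qf ((k - r * x) / Real.sqrt (1 - r ^ 2))).aestronglyMeasurable
  · apply Integrable.mono' (phi_integrable.integrableOn (s := Set.Ioi h))
    · have := phi_continuous
      have := Qf_continuous
      exact (by fun_prop : Continuous fun x => phi x * Qf ((k - r * x) / Real.sqrt (1 - r ^ 2))).aestronglyMeasurable
    · refine Filter.Eventually.of_forall fun x => ?_
      rw [Real.norm_eq_abs, abs_of_nonneg (mul_nonneg (phi_pos x).le (Qf_nonneg _))]
      exact mul_le_of_le_one_right (phi_pos x).le (Qf_le_one _)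
  · have := phi_continuous
    have c : Continuous fun x => dF k r x := by unfold dF; fun_prop
    exact c.aestronglyMeasurable
  · refine Filter.Eventually.of_forall fun x y hy => ?_
    have hy1 := hdx y hy
    have hy2 : Real.sqrt d ≤ Real.sqrt (1 - y ^ 2) := Real.sqrt_le_sqrt hy1
    have hsd : 0 < Real.sqrt d := Real.sqrt_pos.mpr hd0
    have hden : d * Real.sqrt d ≤ (1 - y ^ 2) * Real.sqrt (1 - y ^ 2) :=
      mul_le_mul hy1 hy2 hsd.le (by linarith)
    have hnum : |x - y * k| ≤ |x| + |k| := by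
      have h1 : |x - y * k| ≤ |x| + |y * k| := abs_sub _ _
      have h2 : |y * k| ≤ |k| := by
        rw [abs_mul]
        have : |y| ≤ 1 := (abs_le.mpr ⟨by linarith [hy.1], by linarith [hy.2]⟩)
        exact mul_le_of_le_one_left (abs_nonneg _) this
      linarith
    have hpos : 0 < (1 - y ^ 2) * Real.sqrt (1 - y ^ 2) := lt_of_lt_of_le (by positivity) hden
    unfold dF
    rw [Real.norm_eq_abs, abs_mul, abs_mul, abs_div, abs_of_pos (phi_pos x), abs_of_pos (phi_pos _),
      abs_of_pos hpos]
    calc phi x * (phi ((k - y * x) / Real.sqrt (1 - y ^ 2)) *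
          (|x - y * k| / ((1 - y ^ 2) * Real.sqrt (1 - y ^ 2))))
        ≤ phi x * (1 * ((|x| + |k|) / (d * Real.sqrt d))) := by
          have := phi_pos x
          have := phi_le_one ((k - y * x) / Real.sqrt (1 - y ^ 2))
          gcongr
      _ = _ := by ring
  · exact ((abs_phi_integrable.add (phi_integrable.const_mul |k|)).div_const _).integrableOn
  · refine Filter.Eventually.of_forall fun x y hy => ?_
    have hy1 := lt_of_lt_of_le hd0 (hdx y hy)
    have h1 := (Qf_hasDeriv ((k - y * x) / Real.sqrt (1 - y ^ 2))).comp y (inner_hasDeriv k x y hy1)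
    have h2 := h1.const_mul (phi x)
    convert! h2 using 1
    unfold dF
    rw [show (x - y * k) = -(y * k - x) by ring]
    ring

lemma prod_wedge (h k r s : ℝ) (hs : 0 < s) :
    ((gaussianReal 0 1).prod (gaussianReal 0 1)).real
        {w : ℝ × ℝ | h ≤ w.1 ∧ k ≤ r * w.1 + s * w.2}
      = ∫ x in Set.Ioi h, phi x * Qf ((k - r * x) / s) := by
  have hS : MeasurableSet {w : ℝ × ℝ | h ≤ w.1 ∧ k ≤ r * w.1 + s * w.2} := by
    apply MeasurableSet.inter
    · exact measurableSet_le measurable_const measurable_fst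
    · exact measurableSet_le measurable_const
        (by fun_prop : Measurable fun w : ℝ × ℝ => r * w.1 + s * w.2)
  have e1 : ((gaussianReal 0 1).prod (gaussianReal 0 1)).real
        {w : ℝ × ℝ | h ≤ w.1 ∧ k ≤ r * w.1 + s * w.2}
      = ∫ x, (gaussianReal 0 1).real
          (Prod.mk x ⁻¹' {w : ℝ × ℝ | h ≤ w.1 ∧ k ≤ r * w.1 + s * w.2}) ∂(gaussianReal 0 1) := by
    rw [measureReal_def, Measure.prod_apply hS, integral_eq_lintegral_of_nonneg_ae]
    · congr 1
      apply lintegral_congr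
      intro x
      rw [ofReal_measureReal]
    · exact Filter.Eventually.of_forall fun x => measureReal_nonneg
    · exact (measurable_measure_prodMk_left hS).ennreal_toReal.aestronglyMeasurable
  have e2 : ∀ x, (gaussianReal 0 1).real
          (Prod.mk x ⁻¹' {w : ℝ × ℝ | h ≤ w.1 ∧ k ≤ r * w.1 + s * w.2})
        = Set.indicator (Set.Ici h) (fun x => Qf ((k - r * x) / s)) x := by
    intro x
    by_cases hx : h ≤ x
    · rw [Set.indicator_of_mem (Set.mem_Ici.mpr hx), ← Qf_measure]
      congr 1
      ext y
      simp only [Set.mem_preimage, Set.mem_ofPred_eq, Set.mem_Ici, hx, true_and]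
      rw [div_le_iff₀ hs]
      constructor <;> intro h <;> linarith
    · rw [Set.indicator_of_notMem (by simpa using hx)]
      have : (Prod.mk x ⁻¹' {w : ℝ × ℝ | h ≤ w.1 ∧ k ≤ r * w.1 + s * w.2}) = ∅ := by
        ext y; simp [hx]
      rw [this]; simp
  rw [e1]
  simp_rw [e2]
  rw [integral_gaussianReal_eq_integral_smul one_ne_zero, phi_eq]
  have e3 : ∀ x, phi x • Set.indicator (Set.Ici h) (fun x => Qf ((k - r * x) / s)) x
      = Set.indicator (Set.Ici h) (fun x => phi x * Qf ((k - r * x) / s)) x := by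
    intro x
    by_cases hx : h ≤ x
    · simp [hx]
    · simp [hx]
  simp_rw [e3]
  rw [integral_indicator measurableSet_Ici, integral_Ici_eq_integral_Ioi]

lemma wedge_measure (p q : Fin 4 → ℝ) (a b c : ℝ) (ha : 0 < a) (hb : 0 < b)
    (hp : ∑ i, p i ^ 2 = a ^ 2) (hq : ∑ i, q i ^ 2 = b ^ 2) (hpq : ∑ i, p i * q i = c)
    (hc : |c / (a * b)| < 1) :
    (stdGaussianPi 4).real {z | 2 ≤ ∑ i, p i * z i ∧ 2 ≤ ∑ i, q i * z i}
      = Lf (2 / a) (2 / b) (c / (a * b)) := by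
  set r := c / (a * b) with hr
  have hr1 : 0 < 1 - r ^ 2 := by
    have := (sq_lt_one_iff_abs_lt_one r).mpr hc
    linarith
  set s := Real.sqrt (1 - r ^ 2) with hsdef
  have hs : 0 < s := Real.sqrt_pos.mpr hr1
  have hs2 : s ^ 2 = 1 - r ^ 2 := Real.sq_sqrt hr1.le
  have hcr : c = r * (a * b) := by rw [hr]; field_simp
  set e1 : Fin 4 → ℝ := fun i => p i / a with he1
  set e2 : Fin 4 → ℝ := fun i => (q i / b - r * (p i / a)) / s with he2
  have k1 : ∑ i, e1 i ^ 2 = 1 := by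
    simp only [he1, div_pow, ← Finset.sum_div, hp]
    field_simp
  have k2 : ∑ i, e2 i ^ 2 = 1 := by
    have : ∑ i, e2 i ^ 2 = ((∑ i, q i ^ 2) / b ^ 2 - 2 * r * (∑ i, p i * q i) / (a * b)
        + r ^ 2 * (∑ i, p i ^ 2) / a ^ 2) / s ^ 2 := by
      simp only [he2, Fin.sum_univ_four]; field_simp; ring
    rw [this, hp, hq, hpq, hs2, hcr]
    field_simp; ring
  have k3 : ∑ i, e1 i * e2 i = 0 := by
    have : ∑ i, e1 i * e2 i = ((∑ i, p i * q i) / (a * b)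
        - r * (∑ i, p i ^ 2) / a ^ 2) / s := by
      simp only [he1, he2, Fin.sum_univ_four]; field_simp; ring
    rw [this, hp, hpq, hcr]
    field_simp; ring
  have hlaw := law_two e1 e2 k1 k2 k3
  have hm : Measurable (fun z : Fin 4 → ℝ => (∑ i, e1 i * z i, ∑ i, e2 i * z i)) := by fun_prop
  have hS : MeasurableSet {w : ℝ × ℝ | 2 / a ≤ w.1 ∧ 2 / b ≤ r * w.1 + s * w.2} := by
    apply MeasurableSet.inter
    · exact measurableSet_le measurable_const measurable_fst
    · exact measurableSet_le measurable_const
        (by fun_prop : Measurable fun w : ℝ × ℝ => r * w.1 + s * w.2)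
  have hw := prod_wedge (2 / a) (2 / b) r s hs
  rw [← hlaw, map_measureReal_apply hm hS] at hw
  rw [Lf, ← hw]
  congr 1
  ext z
  have z1 : ∑ i, e1 i * z i = (∑ i, p i * z i) / a := by
    simp only [he1, Fin.sum_univ_four]; field_simp
  have z2 : r * (∑ i, e1 i * z i) + s * ∑ i, e2 i * z i = (∑ i, q i * z i) / b := by
    simp only [he1, he2, Fin.sum_univ_four]; field_simp; ring
  rw [z1] at z2
  simp only [Set.mem_preimage, Set.mem_ofPred_eq, z1, z2]
  rw [div_le_div_iff_of_pos_right ha, div_le_div_iff_of_pos_right hb]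

lemma half_measure (p : Fin 4 → ℝ) (a : ℝ) (ha : 0 < a) (hp : ∑ i, p i ^ 2 = a ^ 2) :
    (stdGaussianPi 4).real {z | 2 ≤ ∑ i, p i * z i} = Qf (2 / a) := by
  have hm : Measurable (fun z : Fin 4 → ℝ => ∑ i, (p i / a) * z i) := by fun_prop
  have hl := law_one (fun i => p i / a)
  have h1 : ∑ i, (p i / a) ^ 2 = 1 := by
    simp only [div_pow, ← Finset.sum_div, hp]
    field_simp
  rw [h1, Real.toNNReal_one] at hl
  rw [← Qf_measure, ← hl, map_measureReal_apply hm measurableSet_Ici]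
  congr 1
  ext z
  have z1 : ∑ i, p i / a * z i = (∑ i, p i * z i) / a := by
    simp only [Fin.sum_univ_four]; field_simp
  simp only [Set.mem_preimage, Set.mem_ofPred_eq, Set.mem_Ici, z1]
  rw [div_le_div_iff_of_pos_right ha]

/-- Polynomial used in the comparison function. -/
noncomputable def Qp (r : ℝ) : ℝ :=
  (201/200) * r ^ 1 + (-103/50) * r ^ 2 + (146/25) * r ^ 3 + (-827/50) * r ^ 4 + (1501/40) * r ^ 5 + (-11243/200) * r ^ 6 + (1159/25) * r ^ 7 + (-631/40) * r ^ 8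

/-- Derivative of `Qp`. -/
noncomputable def Qd (r : ℝ) : ℝ :=
  (201/200) * r ^ 0 + (-103/25) * r ^ 1 + (438/25) * r ^ 2 + (-1654/25) * r ^ 3 + (1501/8) * r ^ 4 + (-33729/100) * r ^ 5 + (8113/25) * r ^ 6 + (-631/5) * r ^ 7

lemma Qp_zero : Qp 0 = 0 := by norm_num [Qp]

lemma Qp_hasDeriv (r : ℝ) : HasDerivAt Qp (Qd r) r := by
  have H (n : ℕ) (c : ℝ) : HasDerivAt (fun r : ℝ => c * r ^ n) (c * (n * r ^ (n - 1))) r :=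
    (hasDerivAt_pow n r).const_mul c
  have := ((((((((H 1 (201/200)).add (H 2 (-103/50))).add (H 3 (146/25))).add (H 4 (-827/50))).add
    (H 5 (1501/40))).add (H 6 (-11243/200))).add (H 7 (1159/25))).add (H 8 (-631/40)))
  convert! this using 1
  unfold Qd
  norm_num
  ring

lemma Qp_ode0 (r : ℝ) (h0 : 0 ≤ r) (h1 : r ≤ 1/4) :
    0 ≤ (4 - 3 * r + r ^ 2) * Qp r + (1 + r) ^ 2 * (1 - r) * (Qd r - 1) := by
  obtain ⟨s, hs⟩ : ∃ s, s = 1 * r - 0 := ⟨_, rfl⟩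
  obtain ⟨t, ht⟩ : ∃ t, t = 1 - 4 * r := ⟨_, rfl⟩
  have hs0 : 0 ≤ s := by rw [hs]; linarith
  have ht0 : 0 ≤ t := by rw [ht]; linarith
  have key : 200 * ((4 - 3 * r + r ^ 2) * Qp r + (1 + r) ^ 2 * (1 - r) * (Qd r - 1)) =
      1 * s ^ 0 * t ^ 10 + 21 * s ^ 1 * t ^ 9 + 464 * s ^ 2 * t ^ 8 + 7636 * s ^ 3 * t ^ 7
      + 69537 * s ^ 4 * t ^ 6 + 367747 * s ^ 5 * t ^ 5 + 1207522 * s ^ 6 * t ^ 4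
      + 2565903 * s ^ 7 * t ^ 3 + 3556855 * s ^ 8 * t ^ 2 + 3028521 * s ^ 9 * t ^ 1
      + 1223993 * s ^ 10 * t ^ 0 := by
    rw [hs, ht]; unfold Qp Qd; ring
  have : 0 ≤ 200 * ((4 - 3 * r + r ^ 2) * Qp r + (1 + r) ^ 2 * (1 - r) * (Qd r - 1)) := by
    rw [key]; positivity
  linarith

lemma Qp_ode1 (r : ℝ) (h0 : 1/4 ≤ r) (h1 : r ≤ 1/2) :
    0 ≤ (4 - 3 * r + r ^ 2) * Qp r + (1 + r) ^ 2 * (1 - r) * (Qd r - 1) := by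
  obtain ⟨s, hs⟩ : ∃ s, s = 4 * r - 1 := ⟨_, rfl⟩
  obtain ⟨t, ht⟩ : ∃ t, t = 1 - 2 * r := ⟨_, rfl⟩
  have hs0 : 0 ≤ s := by rw [hs]; linarith
  have ht0 : 0 ≤ t := by rw [ht]; linarith
  have key : 204800 * ((4 - 3 * r + r ^ 2) * Qp r + (1 + r) ^ 2 * (1 - r) * (Qd r - 1)) =
      1223993 * s ^ 0 * t ^ 10 + 6182888 * s ^ 1 * t ^ 9 + 14793727 * s ^ 2 * t ^ 8
      + 22117784 * s ^ 3 * t ^ 7 + 22244546 * s ^ 4 * t ^ 6 + 15076968 * s ^ 5 * t ^ 5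
      + 6733926 * s ^ 6 * t ^ 4 + 1922376 * s ^ 7 * t ^ 3 + 337237 * s ^ 8 * t ^ 2
      + 34000 * s ^ 9 * t ^ 1 + 1611 * s ^ 10 * t ^ 0 := by
    rw [hs, ht]; unfold Qp Qd; ring
  have : 0 ≤ 204800 * ((4 - 3 * r + r ^ 2) * Qp r + (1 + r) ^ 2 * (1 - r) * (Qd r - 1)) := by
    rw [key]; positivity
  linarith

lemma Qp_ode2 (r : ℝ) (h0 : 1/2 ≤ r) (h1 : r ≤ 3/4) :
    0 ≤ (4 - 3 * r + r ^ 2) * Qp r + (1 + r) ^ 2 * (1 - r) * (Qd r - 1) := by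
  obtain ⟨s, hs⟩ : ∃ s, s = 2 * r - 1 := ⟨_, rfl⟩
  obtain ⟨t, ht⟩ : ∃ t, t = 3 - 4 * r := ⟨_, rfl⟩
  have hs0 : 0 ≤ s := by rw [hs]; linarith
  have ht0 : 0 ≤ t := by rw [ht]; linarith
  have key : 204800 * ((4 - 3 * r + r ^ 2) * Qp r + (1 + r) ^ 2 * (1 - r) * (Qd r - 1)) =
      1611 * s ^ 0 * t ^ 10 + 30440 * s ^ 1 * t ^ 9 + 273157 * s ^ 2 * t ^ 8
      + 1657688 * s ^ 3 * t ^ 7 + 7812934 * s ^ 4 * t ^ 6 + 28287656 * s ^ 5 * t ^ 5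
      + 72913986 * s ^ 6 * t ^ 4 + 124113800 * s ^ 7 * t ^ 3 + 129152927 * s ^ 8 * t ^ 2
      + 72926608 * s ^ 9 * t ^ 1 + 16918921 * s ^ 10 * t ^ 0 := by
    rw [hs, ht]; unfold Qp Qd; ring
  have : 0 ≤ 204800 * ((4 - 3 * r + r ^ 2) * Qp r + (1 + r) ^ 2 * (1 - r) * (Qd r - 1)) := by
    rw [key]; positivity
  linarith

lemma Qp_ode3 (r : ℝ) (h0 : 3/4 ≤ r) (h1 : r ≤ 20/21) :
    0 ≤ (4 - 3 * r + r ^ 2) * Qp r + (1 + r) ^ 2 * (1 - r) * (Qd r - 1) := by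
  obtain ⟨s, hs⟩ : ∃ s, s = 4 * r - 3 := ⟨_, rfl⟩
  obtain ⟨t, ht⟩ : ∃ t, t = 20 - 21 * r := ⟨_, rfl⟩
  have hs0 : 0 ≤ s := by rw [hs]; linarith
  have ht0 : 0 ≤ t := by rw [ht]; linarith
  have key : 403198780089800 * ((4 - 3 * r + r ^ 2) * Qp r + (1 + r) ^ 2 * (1 - r) * (Qd r - 1)) =
      16918921 * s ^ 0 * t ^ 10 + 987421327 * s ^ 1 * t ^ 9 + 25043854523 * s ^ 2 * t ^ 8
      + 359682851985 * s ^ 3 * t ^ 7 + 3188104616014 * s ^ 4 * t ^ 6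
      + 17746597105533 * s ^ 5 * t ^ 5 + 59798482561493 * s ^ 6 * t ^ 4
      + 107854648557500 * s ^ 7 * t ^ 3 + 71238835329320 * s ^ 8 * t ^ 2
      + 13215186511403 * s ^ 9 * t ^ 1 + 117822277592621 * s ^ 10 * t ^ 0 := by
    rw [hs, ht]; unfold Qp Qd; ring
  have : 0 ≤ 403198780089800 * ((4 - 3 * r + r ^ 2) * Qp r + (1 + r) ^ 2 * (1 - r) * (Qd r - 1)) := by
    rw [key]; positivity
  linarith

lemma Qp_ode (r : ℝ) (h0 : 0 ≤ r) (h1 : r ≤ 20/21) :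
    0 ≤ (4 - 3 * r + r ^ 2) * Qp r + (1 + r) ^ 2 * (1 - r) * (Qd r - 1) := by
  rcases le_total r (1/4) with h | h
  · exact Qp_ode0 r h0 h
  rcases le_total r (1/2) with ha | ha
  · exact Qp_ode1 r h ha
  rcases le_total r (3/4) with hb | hb
  · exact Qp_ode2 r ha hb
  · exact Qp_ode3 r hb h1

lemma Qp_final (r : ℝ) (h0 : 4/7 ≤ r) (h1 : r ≤ 20/21) :
    0 ≤ (733/2000) ^ 2 * (1 - r) * ((1 + r) ^ 2 + (49 * r - 28) / 11 * (1 + r) + ((49 * r - 28) / 11) ^ 2 / 2) ^ 2 - Qp r ^ 2 * (1 + r) ^ 3 := by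
  obtain ⟨s, hs⟩ : ∃ s, s = 7 * r - 4 := ⟨_, rfl⟩
  obtain ⟨t, ht⟩ : ∃ t, t = 20 - 21 * r := ⟨_, rfl⟩
  have hs0 : 0 ≤ s := by rw [hs]; linarith
  have ht0 : 0 ≤ t := by rw [ht]; linarith
  have key : 96206240775679390714773490133362540544000000 * ((733/2000) ^ 2 * (1 - r) * ((1 + r) ^ 2 + (49 * r - 28) / 11 * (1 + r) + ((49 * r - 28) / 11) ^ 2 / 2) ^ 2 - Qp r ^ 2 * (1 + r) ^ 3) =
      1364719032243923752116523 * s ^ 0 * t ^ 19 + 666367633074423078266849051 * s ^ 1 * t ^ 18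
      + 36154142794198904860676254513 * s ^ 2 * t ^ 17
      + 957265649332637768895486479897 * s ^ 3 * t ^ 16
      + 15917971772734648281902266548044 * s ^ 4 * t ^ 15
      + 184904448268690147441415709710540 * s ^ 5 * t ^ 14
      + 1588034670917662252510453601694580 * s ^ 6 * t ^ 13
      + 10425812611548592659157662218972884 * s ^ 7 * t ^ 12
      + 53379900143356609034929243417913642 * s ^ 8 * t ^ 11
      + 215525937487439152319113024325469834 * s ^ 9 * t ^ 10
      + 689271943942232515132890255562266734 * s ^ 10 * t ^ 9
      + 1743500354120088177820993335955713758 * s ^ 11 * t ^ 8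
      + 3462834109793030011068565958621860188 * s ^ 12 * t ^ 7
      + 5326151434050901227202632945166376028 * s ^ 13 * t ^ 6
      + 6206366855408818471084438883315090756 * s ^ 14 * t ^ 5
      + 5301776233432025048097546904266817188 * s ^ 15 * t ^ 4
      + 3160145310365180830964090802525347331 * s ^ 16 * t ^ 3
      + 1210509452739338625793916114612279859 * s ^ 17 * t ^ 2
      + 244104580923927428193397795757984425 * s ^ 18 * t ^ 1
      + 5060192506687867623818334296340625 * s ^ 19 * t ^ 0 := by
    rw [hs, ht]; unfold Qp; ring
  have : 0 ≤ 96206240775679390714773490133362540544000000 * ((733/2000) ^ 2 * (1 - r) * ((1 + r) ^ 2 + (49 * r - 28) / 11 * (1 + r) + ((49 * r - 28) / 11) ^ 2 / 2) ^ 2 - Qp r ^ 2 * (1 + r) ^ 3) := by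
    rw [key]; positivity
  linarith


lemma exp_num1 : Real.exp (-(28/11)) ≤ 0.07844 := by
  have h1 : (12.749 : ℝ) ≤ Real.exp (28/11) := by
    refine le_of_pow_le_pow_left₀ (n := 11) (by norm_num) (Real.exp_pos _).le ?_
    rw [← Real.exp_nat_mul, show ((11 : ℕ) : ℝ) * (28/11) = ((28 : ℕ) : ℝ) * 1 by norm_num,
      Real.exp_nat_mul]
    calc (12.749 : ℝ) ^ 11 ≤ 2.7182818283 ^ 28 := by norm_num
      _ ≤ _ := pow_le_pow_left₀ (by norm_num) Real.exp_one_gt_d9.le _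
  rw [Real.exp_neg]
  calc (Real.exp (28/11))⁻¹ ≤ (12.749 : ℝ)⁻¹ := inv_anti₀ (by norm_num) h1
    _ ≤ _ := by norm_num

lemma exp_num2 : Real.exp (-4) ≤ 0.018317 := by
  have h1 : (54.597 : ℝ) ≤ Real.exp 4 := by
    rw [show (4 : ℝ) = ((4 : ℕ) : ℝ) * 1 by norm_num, Real.exp_nat_mul]
    calc (54.597 : ℝ) ≤ 2.7182818283 ^ 4 := by norm_num
      _ ≤ _ := pow_le_pow_left₀ (by norm_num) Real.exp_one_gt_d9.le _
  rw [Real.exp_neg]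
  calc (Real.exp 4)⁻¹ ≤ (54.597 : ℝ)⁻¹ := inv_anti₀ (by norm_num) h1
    _ ≤ _ := by norm_num

lemma exp_num3 : Real.exp (-(83/25)) ≤ 0.0362 := by
  have h1 : (27.65 : ℝ) ≤ Real.exp (83/25) := by
    refine le_of_pow_le_pow_left₀ (n := 25) (by norm_num) (Real.exp_pos _).le ?_
    rw [← Real.exp_nat_mul, show ((25 : ℕ) : ℝ) * (83/25) = ((83 : ℕ) : ℝ) * 1 by norm_num,
      Real.exp_nat_mul]
    calc (27.65 : ℝ) ^ 25 ≤ 2.7182818283 ^ 83 := by norm_num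
      _ ≤ _ := pow_le_pow_left₀ (by norm_num) Real.exp_one_gt_d9.le _
  rw [Real.exp_neg]
  calc (Real.exp (83/25))⁻¹ ≤ (27.65 : ℝ)⁻¹ := inv_anti₀ (by norm_num) h1
    _ ≤ _ := by norm_num

lemma Qf_258 : Qf 2.58 ≤ 0.0051 := by
  have h1 := Qf_bound 2.58 (by norm_num)
  have h2 : phi 2.58 ≤ 0.01445 := by
    unfold phi
    have h3 : (2.506 : ℝ) ≤ Real.sqrt (2 * Real.pi) := by
      apply Real.le_sqrt_of_sq_le
      have := Real.pi_gt_d4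
      norm_num
      linarith
    have h4 : Real.exp (-2.58 ^ 2 / 2) ≤ 0.0362 :=
      (Real.exp_le_exp.2 (by norm_num)).trans exp_num3
    calc _ ≤ (2.506 : ℝ)⁻¹ * 0.0362 :=
          mul_le_mul (inv_anti₀ (by norm_num) h3) h4 (Real.exp_pos _).le (by norm_num)
      _ ≤ _ := by norm_num
  refine h1.trans ?_
  calc _ ≤ (0.01445 : ℝ) * ((2.58 ^ 4 + 9 * 2.58 ^ 2 + 8) / (2.58 ^ 5 + 10 * 2.58 ^ 3 + 15 * 2.58)) :=
        mul_le_mul_of_nonneg_right h2 (by norm_num)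
    _ ≤ _ := by norm_num

lemma half_small (p : Fin 4 → ℝ) (hp : ∑ i, p i ^ 2 ≤ 0.6) :
    (stdGaussianPi 4).real {z | 2 ≤ ∑ i, p i * z i} ≤ 0.0051 := by
  have h0 : 0 ≤ ∑ i, p i ^ 2 := Finset.sum_nonneg fun i _ => sq_nonneg _
  rcases h0.eq_or_lt with h | h
  · have hz : ∀ i, p i = 0 := by
      intro i
      have := (Finset.sum_eq_zero_iff_of_nonneg (fun i _ => sq_nonneg (p i))).1 h.symm i
        (Finset.mem_univ i)
      simpa using this
    have : {z : Fin 4 → ℝ | 2 ≤ ∑ i, p i * z i} = ∅ := by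
      ext z
      simp [hz]
    rw [this]
    norm_num
  · have ha := Real.sqrt_pos.2 h
    rw [half_measure p _ ha (Real.sq_sqrt h0).symm]
    refine (Qf_antitone ?_).trans Qf_258
    rw [le_div_iff₀ ha]
    have : Real.sqrt (∑ i, p i ^ 2) ≤ 0.775 := by
      rw [Real.sqrt_le_left (by norm_num)]
      norm_num at hp ⊢
      linarith
    linarith

/-- Comparison density. -/
noncomputable def Ef (x : ℝ) : ℝ := Real.exp (-4 / (1 + x)) * (Real.sqrt (1 - x ^ 2))⁻¹

lemma Ef_hasDeriv (x : ℝ) (h0 : 0 ≤ x) (h1 : x < 1) :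
    HasDerivAt Ef (Ef x * (4 / (1 + x) ^ 2 + x / (1 - x ^ 2))) x := by
  have hs : 0 < 1 - x ^ 2 := by nlinarith
  have hsq := Real.sqrt_pos.2 hs
  have e1 : HasDerivAt (fun x : ℝ => -4 / (1 + x)) (4 / (1 + x) ^ 2) x := by
    have := ((hasDerivAt_id x).const_add 1).fun_inv (by simp; linarith)
    convert! this.const_mul (-4) using 1
    simp
    ring
  have e2 : HasDerivAt (fun x : ℝ => 1 - x ^ 2) (-(2 * x)) x := by
    have := (hasDerivAt_pow 2 x).const_sub 1
    convert! this using 1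
    simp
  have e3 := (e2.sqrt hs.ne').fun_inv hsq.ne'
  convert! e1.exp.mul e3 using 1
  unfold Ef
  have hh := Real.sq_sqrt hs.le
  rw [← hh]
  rw [Real.sqrt_sq hsq.le]
  have : 1 + x ≠ 0 := by linarith
  field_simp

lemma phi2_le (h k r x : ℝ) (hk4 : 4 ≤ h * k) (h0 : 0 ≤ x) (hx : x ≤ r) (hr : r < 1) :
    phi2 h k x ≤ (2 * Real.pi)⁻¹ * Real.exp (-(h * k - 4) / (1 + r)) * Ef x := by
  have hx1 : x < 1 := lt_of_le_of_lt hx hr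
  have hs : 0 < 1 - x ^ 2 := by nlinarith
  have hsq := Real.sqrt_pos.2 hs
  have e : phi2 h k x = (2 * Real.pi)⁻¹ *
      Real.exp (-h ^ 2 / 2 + -((k - x * h) / Real.sqrt (1 - x ^ 2)) ^ 2 / 2) *
      (Real.sqrt (1 - x ^ 2))⁻¹ := by
    unfold phi2 phi
    rw [Real.exp_add]
    have : (2 * Real.pi)⁻¹ = (Real.sqrt (2 * Real.pi))⁻¹ * (Real.sqrt (2 * Real.pi))⁻¹ := by
      rw [← mul_inv, Real.mul_self_sqrt (by positivity)]
    rw [this]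
    ring
  rw [e]
  unfold Ef
  rw [← mul_assoc, mul_assoc (2 * Real.pi)⁻¹ (Real.exp _) (Real.exp _), ← Real.exp_add]
  have hle : -h ^ 2 / 2 + -((k - x * h) / Real.sqrt (1 - x ^ 2)) ^ 2 / 2 ≤
      -(h * k - 4) / (1 + r) + -4 / (1 + x) := by
    rw [div_pow, Real.sq_sqrt hs.le]
    have a1 : -h ^ 2 / 2 + -((k - x * h) ^ 2 / (1 - x ^ 2)) / 2 =
        -(h * k) / (1 + x) - (h - k) ^ 2 / (2 * (1 - x ^ 2)) := by
      have : 1 - x ^ 2 = (1 - x) * (1 + x) := by ring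
      rw [this]
      have : 1 - x ≠ 0 := by linarith
      have : 1 + x ≠ 0 := by linarith
      field_simp
      ring
    have a2 : 0 ≤ (h - k) ^ 2 / (2 * (1 - x ^ 2)) := by positivity
    have a3 : (h * k - 4) / (1 + r) ≤ (h * k - 4) / (1 + x) :=
      div_le_div_of_nonneg_left (by linarith) (by linarith) (by linarith)
    have a4 : -(h * k) / (1 + x) = -((h * k - 4) / (1 + x)) + -4 / (1 + x) := by ring
    rw [a1, a4, neg_div (1 + r)]
    linarith
  have := Real.exp_le_exp.2 hle
  gcongr

lemma Wf_hasDeriv (x : ℝ) (h0 : 0 ≤ x) (h1 : x ≤ 20/21) :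
    ∃ d, HasDerivAt (fun x => Ef x * Qp x) d x ∧ Ef x ≤ d := by
  refine ⟨_, (Ef_hasDeriv x h0 (by linarith)).mul (Qp_hasDeriv x), ?_⟩
  have hs : 0 < 1 - x ^ 2 := by nlinarith
  have hE : 0 < Ef x := by
    have := Real.sqrt_pos.2 hs
    unfold Ef; positivity
  have key := Qp_ode x h0 h1
  have h2 : 0 ≤ (4 / (1 + x) ^ 2 + x / (1 - x ^ 2)) * Qp x + Qd x - 1 := by
    have e : (4 / (1 + x) ^ 2 + x / (1 - x ^ 2)) * Qp x + Qd x - 1 =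
        ((4 - 3 * x + x ^ 2) * Qp x + (1 + x) ^ 2 * (1 - x) * (Qd x - 1)) /
          ((1 + x) ^ 2 * (1 - x)) := by
      have : 1 - x ^ 2 = (1 - x) * (1 + x) := by ring
      rw [this]
      have : 1 - x ≠ 0 := by linarith
      have : 1 + x ≠ 0 := by linarith
      field_simp
      ring
    rw [e]
    have : 0 < 1 - x := by linarith
    positivity
  nlinarith [mul_nonneg hE.le h2]

lemma Lf_le (h k r x : ℝ) (hh : 2 ≤ h) (hk : 2 ≤ k) (h0 : 0 ≤ x) (hx : x ≤ r)
    (hr : r ≤ 20/21) : Lf h k x ≤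
      Qf h * Qf k + (2 * Real.pi)⁻¹ * Real.exp (-(h * k - 4) / (1 + r)) * (Ef r * Qp r) := by
  set C := (2 * Real.pi)⁻¹ * Real.exp (-(h * k - 4) / (1 + r)) with hC
  have hC0 : 0 < C := by positivity
  have hEpos : ∀ y ∈ Set.Icc 0 r, 0 < Ef y := by
    intro y hy
    have hs : 0 < 1 - y ^ 2 := by nlinarith [hy.1, hy.2]
    have := Real.sqrt_pos.2 hs
    unfold Ef; positivity
  choose! d hd hdE using Wf_hasDeriv
  have m1 : MonotoneOn (fun x => Ef x * Qp x) (Set.Icc 0 r) := by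
    refine monotoneOn_of_hasDerivWithinAt_nonneg (f' := d) (convex_Icc 0 r) ?_ ?_ ?_
    · intro y hy
      exact (hd y hy.1 (hy.2.trans hr)).continuousAt.continuousWithinAt
    · intro y hy
      rw [interior_Icc] at hy
      exact (hd y hy.1.le (hy.2.le.trans hr)).hasDerivWithinAt
    · intro y hy
      rw [interior_Icc] at hy
      exact (hEpos y ⟨hy.1.le, hy.2.le⟩).le.trans (hdE y hy.1.le (hy.2.le.trans hr))
  have hL : ∀ y ∈ Set.Icc 0 r, HasDerivAt (fun y => C * (Ef y * Qp y) - Lf h k y)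
      (C * d y - phi2 h k y) y := by
    intro y hy
    refine ((hd y hy.1 (hy.2.trans hr)).const_mul C).sub (Lf_hasDeriv h k y ?_)
    rw [abs_of_nonneg hy.1]
    linarith [hy.2]
  have m2 : MonotoneOn (fun y => C * (Ef y * Qp y) - Lf h k y) (Set.Icc 0 r) := by
    refine monotoneOn_of_hasDerivWithinAt_nonneg (f' := fun y => C * d y - phi2 h k y)
      (convex_Icc 0 r) ?_ ?_ ?_
    · intro y hy
      exact (hL y hy).continuousAt.continuousWithinAt
    · intro y hy
      rw [interior_Icc] at hy
      exact (hL y ⟨hy.1.le, hy.2.le⟩).hasDerivWithinAt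
    · intro y hy
      rw [interior_Icc] at hy
      have a1 := phi2_le h k r y (by nlinarith) hy.1.le hy.2.le (by linarith)
      have a2 := mul_le_mul_of_nonneg_left (hdE y hy.1.le (hy.2.le.trans hr)) hC0.le
      rw [← hC] at a1
      linarith
  have hr0 := h0.trans hx
  have b1 := m2 ⟨le_refl 0, hr0⟩ ⟨h0, hx⟩ h0
  have b2 := m1 ⟨h0, hx⟩ ⟨hr0, le_refl r⟩ hx
  simp only [Qp_zero, Lf_zero] at b1 b2
  have b3 := mul_le_mul_of_nonneg_left b2 hC0.le
  linarith

lemma Tf_le (r : ℝ) (h0 : 4/7 ≤ r) (h1 : r ≤ 20/21) :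
    Real.exp (-(7 * r - 4) / (1 + r)) * (Ef r * Qp r) ≤ 0.02875 := by
  have hs : 0 < 1 - r ^ 2 := by nlinarith
  have hsq := Real.sqrt_pos.2 hs
  have hr1 : 0 < 1 + r := by linarith
  set δ := (49 * r - 28) / (11 * (1 + r)) with hδ
  have hδ0 : 0 ≤ δ := div_nonneg (by linarith) (by linarith)
  have e1 : Real.exp (-(7 * r - 4) / (1 + r)) * (Ef r * Qp r) =
      Real.exp (-(28/11)) * (Real.exp δ)⁻¹ * (Qp r / Real.sqrt (1 - r ^ 2)) := by
    unfold Ef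
    rw [← Real.exp_neg, ← Real.exp_add]
    have : -(28/11) + -δ = -(7 * r - 4) / (1 + r) + -4 / (1 + r) := by
      rw [hδ]
      field_simp
      ring
    rw [this, Real.exp_add]
    ring
  have hq := Real.quadratic_le_exp_of_nonneg hδ0
  have e2 : Qp r / Real.sqrt (1 - r ^ 2) ≤ 733/2000 * (1 + δ + δ ^ 2 / 2) := by
    rw [div_le_iff₀ hsq]
    apply le_of_sq_le_sq _ (by positivity)
    rw [mul_pow, Real.sq_sqrt hs.le]
    have key := Qp_final r h0 h1
    have e : (733/2000 * (1 + δ + δ ^ 2 / 2)) ^ 2 * (1 - r ^ 2) - Qp r ^ 2 =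
      ((733/2000) ^ 2 * (1 - r) * ((1 + r) ^ 2 + (49 * r - 28) / 11 * (1 + r) + ((49 * r - 28) / 11) ^ 2 / 2) ^ 2 - Qp r ^ 2 * (1 + r) ^ 3) / (1 + r) ^ 3 := by
      rw [hδ]
      field_simp
      ring
    have : 0 ≤ (733/2000 * (1 + δ + δ ^ 2 / 2)) ^ 2 * (1 - r ^ 2) - Qp r ^ 2 := by
      rw [e]
      exact div_nonneg key (by positivity)
    linarith
  have e3 : Qp r / Real.sqrt (1 - r ^ 2) ≤ 733/2000 * Real.exp δ := by linarith
  rw [e1]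
  calc _ ≤ Real.exp (-(28/11)) * (Real.exp δ)⁻¹ * (733/2000 * Real.exp δ) :=
        mul_le_mul_of_nonneg_left e3 (by positivity)
    _ = Real.exp (-(28/11)) * (733/2000) := by
        have := (Real.exp_pos δ).ne'
        field_simp
    _ ≤ 0.07844 * (733/2000) := mul_le_mul_of_nonneg_right exp_num1 (by norm_num)
    _ ≤ _ := by norm_num

lemma Qf_two_sq : Qf 2 * Qf 2 ≤ (2 * Real.pi)⁻¹ * 0.003271 := by
  have h1 := Qf_bound 2 (by norm_num)
  have h2 : Qf 2 ≤ phi 2 * (30/71) := by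
    convert h1 using 2
    norm_num
  have h3 : phi 2 * phi 2 = (2 * Real.pi)⁻¹ * Real.exp (-4) := by
    unfold phi
    have : (2 * Real.pi)⁻¹ = (Real.sqrt (2 * Real.pi))⁻¹ * (Real.sqrt (2 * Real.pi))⁻¹ := by
      rw [← mul_inv, Real.mul_self_sqrt (by positivity)]
    rw [this, show (-4 : ℝ) = -2 ^ 2 / 2 + -2 ^ 2 / 2 by norm_num, Real.exp_add]
    ring
  calc Qf 2 * Qf 2 ≤ (phi 2 * (30/71)) * (phi 2 * (30/71)) :=
        mul_le_mul h2 h2 (Qf_nonneg 2) ((Qf_nonneg 2).trans h2)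
    _ = (2 * Real.pi)⁻¹ * (Real.exp (-4) * (30/71) ^ 2) := by
        rw [← mul_assoc (2 * Real.pi)⁻¹, ← h3]; ring
    _ ≤ _ := by
        refine mul_le_mul_of_nonneg_left ?_ (by positivity)
        have := exp_num2
        norm_num at this ⊢
        linarith

lemma Lf_final (h k x : ℝ) (hh : 2 ≤ h) (hk : 2 ≤ k) (hhk : h * k ≤ 20/3) (h0 : 0 ≤ x)
    (hx : x ≤ h * k / 7) : Lf h k x ≤ 0.0051 := by
  have hhk4 : 4 ≤ h * k := by nlinarith
  have b1 := Lf_le h k (h * k / 7) x hh hk h0 hx (by linarith)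
  have b2 := Tf_le (h * k / 7) (by linarith) (by linarith)
  rw [show 7 * (h * k / 7) = h * k by ring] at b2
  have hpi : 0 < (2 * Real.pi)⁻¹ := by positivity
  have b3 := mul_le_mul_of_nonneg_left b2 hpi.le
  have b4 : Qf h * Qf k ≤ Qf 2 * Qf 2 :=
    mul_le_mul (Qf_antitone hh) (Qf_antitone hk) (Qf_nonneg k) (Qf_nonneg 2)
  have b5 := Qf_two_sq
  have b6 : (2 * Real.pi)⁻¹ ≤ 0.15916 := by
    have := Real.pi_gt_d4
    calc (2 * Real.pi)⁻¹ ≤ (2 * 3.1415 : ℝ)⁻¹ := inv_anti₀ (by norm_num) (by linarith)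
      _ ≤ _ := by norm_num
  rw [mul_assoc] at b1
  generalize (2 * Real.pi)⁻¹ = c at *
  norm_num only at b3 b5 b6 b1 ⊢
  linarith

lemma wedge_small (p q : Fin 4 → ℝ) (hp : ∑ i, p i ^ 2 ≤ 1) (hq : ∑ i, q i ^ 2 ≤ 1)
    (hpq : ∑ i, p i * q i ≤ 4/7) :
    (stdGaussianPi 4).real {z | 2 ≤ ∑ i, p i * z i ∧ 2 ≤ ∑ i, q i * z i} ≤ 0.0051 := by
  by_cases h1 : ∑ i, p i ^ 2 ≤ 0.6
  · exact (measureReal_mono (fun z hz => hz.1)).trans (half_small p h1)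
  by_cases h2 : ∑ i, q i ^ 2 ≤ 0.6
  · exact (measureReal_mono (fun z hz => hz.2)).trans (half_small q h2)
  by_cases h3 : ∑ i, p i * q i ≤ 0.2
  · refine (measureReal_mono (fun z hz => ?_)).trans
      (half_small (fun i => (p i + q i) / 2) ?_)
    · have a1 := hz.1
      have a2 := hz.2
      have : ∑ i, (p i + q i) / 2 * z i = (∑ i, p i * z i + ∑ i, q i * z i) / 2 := by
        rw [← Finset.sum_add_distrib, Finset.sum_div]
        exact Finset.sum_congr rfl fun i _ => by ring
      rw [Set.mem_ofPred_eq, this]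
      linarith
    · have : ∑ i, ((p i + q i) / 2) ^ 2 =
          (∑ i, p i ^ 2 + ∑ i, q i ^ 2 + 2 * ∑ i, p i * q i) / 4 := by
        rw [Finset.mul_sum, ← Finset.sum_add_distrib, ← Finset.sum_add_distrib, Finset.sum_div]
        exact Finset.sum_congr rfl fun i _ => by ring
      rw [this]
      norm_num at h3 ⊢
      linarith
  push Not at h1 h2 h3
  obtain ⟨a, ha, ha2⟩ : ∃ a : ℝ, 0 < a ∧ ∑ i, p i ^ 2 = a ^ 2 := by
    have : 0 < ∑ i, p i ^ 2 := lt_trans (by norm_num) h1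
    exact ⟨_, Real.sqrt_pos.2 this, (Real.sq_sqrt this.le).symm⟩
  obtain ⟨b, hb, hb2⟩ : ∃ b : ℝ, 0 < b ∧ ∑ i, q i ^ 2 = b ^ 2 := by
    have : 0 < ∑ i, q i ^ 2 := lt_trans (by norm_num) h2
    exact ⟨_, Real.sqrt_pos.2 this, (Real.sq_sqrt this.le).symm⟩
  rw [ha2] at h1 hp
  rw [hb2] at h2 hq
  have hab : 0.6 < a * b := by
    apply lt_of_pow_lt_pow_left₀ 2 (by positivity)
    rw [mul_pow]
    norm_num at h1 h2 ⊢
    nlinarith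
  have ha1 : a ≤ 1 := by nlinarith
  have hb1 : b ≤ 1 := by nlinarith
  have habp : 0 < a * b := by positivity
  have hc0 : 0 ≤ (∑ i, p i * q i) / (a * b) :=
    div_nonneg (le_trans (by norm_num) h3.le) habp.le
  rw [wedge_measure p q a b _ ha hb ha2 hb2 rfl]
  · have e : 2 / a * (2 / b) = 4 / (a * b) := by
      field_simp; norm_num
    apply Lf_final
    · rw [le_div_iff₀ ha]; linarith
    · rw [le_div_iff₀ hb]; linarith
    · rw [e, div_le_iff₀ habp]
      norm_num at hab
      linarith
    · exact hc0
    · rw [e, div_div, div_le_div_iff₀ habp (by positivity)]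
      nlinarith
  · rw [abs_of_nonneg hc0, div_lt_one habp]
    norm_num at hab
    linarith

lemma event_small (N : ℝ) (hN : 0 < N) (μ : Measure (Fin 4 → ℝ)) (m : Fin 4 → ℝ)
    (L : Matrix (Fin 4) (Fin 4) ℝ)
    (hμ : μ = Measure.map (fun x => m + L.mulVec x) (stdGaussianPi 4))
    (hvar : ∀ i, (L * L.transpose) i i ≤ N / 4) (i j : Fin 4) (s t : ℝ)
    (hs : s ^ 2 = 1) (ht : t ^ 2 = 1) (hc : s * t * (L * L.transpose) i j ≤ N / 7) :
    (μ {v | Real.sqrt N ≤ s * (v i - m i) ∧ Real.sqrt N ≤ t * (v j - m j)}).toReal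
      ≤ 0.0051 := by
  have hsN := Real.sqrt_pos.2 hN
  have hNN := Real.sq_sqrt hN.le
  have hexp : ∀ i j, (L * L.transpose) i j = ∑ k, L i k * L j k := by
    intro i j
    simp [Matrix.mul_apply]
  have hb : ∀ (s : ℝ), s ^ 2 = 1 → ∀ i, ∑ k, (2 / Real.sqrt N * s * L i k) ^ 2 ≤ 1 := by
    intro s hs i
    have : ∑ k, (2 / Real.sqrt N * s * L i k) ^ 2 = 4 / N * (L * L.transpose) i i := by
      rw [hexp, Finset.mul_sum]
      refine Finset.sum_congr rfl fun k _ => ?_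
      rw [mul_pow, mul_pow, hs, div_pow, hNN]
      ring
    rw [this, div_mul_eq_mul_div, div_le_one hN]
    linarith [hvar i]
  have key := wedge_small (fun k => 2 / Real.sqrt N * s * L i k)
    (fun k => 2 / Real.sqrt N * t * L j k) (hb s hs i) (hb t ht j) (by
      have : ∑ k, (2 / Real.sqrt N * s * L i k) * (2 / Real.sqrt N * t * L j k) =
          4 / N * (s * t * (L * L.transpose) i j) := by
        rw [hexp, Finset.mul_sum, Finset.mul_sum]
        refine Finset.sum_congr rfl fun k _ => ?_
        have : (4 : ℝ) / N = (2 / Real.sqrt N) * (2 / Real.sqrt N) := by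
          rw [← pow_two, div_pow, hNN]; norm_num
        rw [this]
        ring
      rw [this, div_mul_eq_mul_div, div_le_iff₀ hN]
      linarith)
  rw [hμ, Measure.map_apply (by fun_prop)]
  · convert key using 1
    rw [Measure.real]
    congr 2
    ext z
    have hz : ∀ (s : ℝ) (i : Fin 4), Real.sqrt N ≤ s * ((m + L.mulVec z) i - m i) ↔
        2 ≤ ∑ k, 2 / Real.sqrt N * s * L i k * z k := by
      intro s i
      have : ∑ k, 2 / Real.sqrt N * s * L i k * z k =
          2 * (s * ((m + L.mulVec z) i - m i)) / Real.sqrt N := by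
        simp only [Pi.add_apply, add_sub_cancel_left, Matrix.mulVec, dotProduct]
        rw [Finset.mul_sum, Finset.mul_sum, Finset.sum_div]
        exact Finset.sum_congr rfl fun k _ => by ring
      rw [this, le_div_iff₀ hsN]
      constructor <;> intro h <;> linarith
    rw [Set.mem_preimage, Set.mem_ofPred_eq, Set.mem_ofPred_eq, hz s i, hz t j]
  · have hm : ∀ (s : ℝ) (i : Fin 4),
        MeasurableSet {v : Fin 4 → ℝ | Real.sqrt N ≤ s * (v i - m i)} := by
      intro s i
      exact measurableSet_le (by fun_prop) (by fun_prop)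
    exact (hm s i).inter (hm t j)


/-- **Classical score bound for the macroscopic CHSH game.** The coordinates
`0, 1, 2, 3` of the Gaussian vector are `A₀, A₁, B₀, B₁` respectively. Under the
variance bounds `≤ N/4` and the covariance Bell bound
`Cov(A₀,B₀) + Cov(A₀,B₁) + Cov(A₁,B₀) − Cov(A₁,B₁) ≤ 4N/7`, the minimum over the
four question pairs of the round-win probability is at most `0.0102`. -/
theorem macroscopic_chsh_classical_score (N : ℝ) (hN : 0 < N)
    (μ : Measure (Fin 4 → ℝ)) (m : Fin 4 → ℝ) (S : Matrix (Fin 4) (Fin 4) ℝ)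
    (hG : IsGaussianWith μ m S)
    (hvar : ∀ i, S i i ≤ N / 4)
    (hbell : S 0 2 + S 0 3 + S 1 2 - S 1 3 ≤ 4 * N / 7) :
    min
      (min
        ((μ {v | Real.sqrt N ≤ v 0 - m 0 ∧ Real.sqrt N ≤ v 2 - m 2}).toReal
          + (μ {v | v 0 - m 0 ≤ -Real.sqrt N ∧ v 2 - m 2 ≤ -Real.sqrt N}).toReal)
        ((μ {v | Real.sqrt N ≤ v 0 - m 0 ∧ Real.sqrt N ≤ v 3 - m 3}).toReal
          + (μ {v | v 0 - m 0 ≤ -Real.sqrt N ∧ v 3 - m 3 ≤ -Real.sqrt N}).toReal))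
      (min
        ((μ {v | Real.sqrt N ≤ v 1 - m 1 ∧ Real.sqrt N ≤ v 2 - m 2}).toReal
          + (μ {v | v 1 - m 1 ≤ -Real.sqrt N ∧ v 2 - m 2 ≤ -Real.sqrt N}).toReal)
        ((μ {v | Real.sqrt N ≤ v 1 - m 1 ∧ v 3 - m 3 ≤ -Real.sqrt N}).toReal
          + (μ {v | v 1 - m 1 ≤ -Real.sqrt N ∧ Real.sqrt N ≤ v 3 - m 3}).toReal))
      ≤ 0.0102 := by
  obtain ⟨L, hL, hμ⟩ := hG
  have hev := event_small N hN μ m L hμ (by rw [hL]; exact hvar)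
  rw [hL] at hev
  have hle : ∀ i j : Fin 4, S i j ≤ N / 7 →
      (μ {v | Real.sqrt N ≤ v i - m i ∧ Real.sqrt N ≤ v j - m j}).toReal
        + (μ {v | v i - m i ≤ -Real.sqrt N ∧ v j - m j ≤ -Real.sqrt N}).toReal ≤ 0.0102 := by
    intro i j hij
    have a1 := hev i j 1 1 (by norm_num) (by norm_num) (by linarith)
    have a2 := hev i j (-1) (-1) (by norm_num) (by norm_num) (by linarith)
    simp only [one_mul] at a1
    simp only [neg_one_mul, le_neg (a := Real.sqrt N)] at a2
    norm_num only at a1 a2 ⊢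
    linarith
  have hle' : -S 1 3 ≤ N / 7 →
      (μ {v | Real.sqrt N ≤ v 1 - m 1 ∧ v 3 - m 3 ≤ -Real.sqrt N}).toReal
        + (μ {v | v 1 - m 1 ≤ -Real.sqrt N ∧ Real.sqrt N ≤ v 3 - m 3}).toReal ≤ 0.0102 := by
    intro hij
    have a1 := hev 1 3 1 (-1) (by norm_num) (by norm_num) (by linarith)
    have a2 := hev 1 3 (-1) 1 (by norm_num) (by norm_num) (by linarith)
    simp only [neg_one_mul, one_mul, le_neg (a := Real.sqrt N)] at a1 a2
    norm_num only at a1 a2 ⊢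
    linarith
  by_cases h1 : S 0 2 ≤ N / 7
  · exact (min_le_left _ _).trans ((min_le_left _ _).trans (hle 0 2 h1))
  by_cases h2 : S 0 3 ≤ N / 7
  · exact (min_le_left _ _).trans ((min_le_right _ _).trans (hle 0 3 h2))
  by_cases h3 : S 1 2 ≤ N / 7
  · exact (min_le_right _ _).trans ((min_le_left _ _).trans (hle 1 2 h3))
  push Not at h1 h2 h3
  exact (min_le_right _ _).trans ((min_le_right _ _).trans (hle' (by linarith)))
end

section
/- Let N > 0 and let (A₀, B₀) be distributed according to a bivariate Gaussian on ℝ² with both means equal to N/2 and covariance matrix Σ with Σ₀₀ = Σ₁₁ = N/4 and Σ₀₁ = Σ₁₀ = N/(4√2). Then P(A₀ ≥ N/2 + √N and B₀ ≥ N/2 + √N) + P(A₀ ≤ N/2 − √N and B₀ ≤ N/2 − √N) ≥ 0.0150. -/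
open MeasureTheory ProbabilityTheory

lemma aux_tangent (s0 s : ℝ) (h0 : 0 ≤ s0) (hs : 0 ≤ s) :
    Real.exp (-2*s0)/(1+s0) * (1 - (2+1/(1+s0))*(s-s0)) ≤ Real.exp (-2*s)/(1+s) := by
  have hp : 0 < 1 + s0 := by linarith
  have hq : 0 < 1 + s := by linarith
  have h1 : (1+s)/(1+s0) ≤ Real.exp ((s-s0)/(1+s0)) := by
    have := Real.add_one_le_exp ((s-s0)/(1+s0))
    have e : (1+s)/(1+s0) = (s-s0)/(1+s0) + 1 := by field_simp; ring
    linarith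
  have h2 := Real.add_one_le_exp (-(2+1/(1+s0))*(s-s0))
  have h3 : Real.exp (-2*s) = Real.exp (-2*s0) * Real.exp (-(2+1/(1+s0))*(s-s0)) * Real.exp ((s-s0)/(1+s0)) := by
    rw [← Real.exp_add, ← Real.exp_add]; congr 1; field_simp; ring
  rw [le_div_iff₀ hq, h3]
  have hE := Real.exp_pos (-2*s0)
  have hE2 := Real.exp_pos (-(2+1/(1+s0))*(s-s0))
  calc Real.exp (-2*s0)/(1+s0) * (1 - (2+1/(1+s0))*(s-s0)) * (1+s)
      = Real.exp (-2*s0) * (-(2+1/(1+s0))*(s-s0) + 1) * ((1+s)/(1+s0)) := by ring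
    _ ≤ _ := by gcongr

lemma aux_cont : Continuous (fun t : ℝ => Real.exp (-2*t^2)/(1+t^2)) :=
  Continuous.div (by fun_prop) (by fun_prop) (fun t => by positivity)

lemma aux_step (a b T s F L R : ℝ) (hab : a ≤ b) (hs : 0 ≤ s) 
    (hF : F ≤ Real.exp (-2*s)/(1+s))
    (hB : 0 ≤ (b-a) * (1 + (2+1/(1+s))*s) - (2+1/(1+s))*((b^3-a^3)/3))
    (hL : L ≤ ∫ t in b..T, Real.exp (-2*t^2)/(1+t^2))
    (hR : R ≤ F * ((b-a) * (1 + (2+1/(1+s))*s) - (2+1/(1+s))*((b^3-a^3)/3)) + L) :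
    R ≤ ∫ t in a..T, Real.exp (-2*t^2)/(1+t^2) := by
  rw [← intervalIntegral.integral_add_adjacent_intervals (aux_cont.intervalIntegrable a b)
    (aux_cont.intervalIntegrable b T)]
  have h : ∫ t in a..b, Real.exp (-2*s)/(1+s) * ((1 + (2+1/(1+s))*s) - (2+1/(1+s))*t^2) ≤ ∫ t in a..b, Real.exp (-2*t^2)/(1+t^2) := by
    apply intervalIntegral.integral_mono_on hab
    · exact Continuous.intervalIntegrable (by fun_prop) _ _
    · exact aux_cont.intervalIntegrable a b
    · intro t _
      have := aux_tangent s (t^2) hs (by positivity)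
      refine le_trans (le_of_eq ?_) this
      ring
  rw [intervalIntegral.integral_const_mul, intervalIntegral.integral_sub (by simp) (Continuous.intervalIntegrable (by fun_prop) _ _),
    intervalIntegral.integral_const_mul, integral_pow, intervalIntegral.integral_const] at h
  norm_num at h
  have := mul_le_mul_of_nonneg_right hF hB
  norm_num at this
  norm_num at hR hL ⊢
  linarith

lemma aux_exp_tenth : (0.9048374180:ℝ) ≤ Real.exp (-(1/10)) := by
  have h := Real.exp_bound' (x := 1/10) (by norm_num) (by norm_num) (n := 10) (by norm_num)
  rw [Real.exp_neg, le_inv_comm₀ (by norm_num) (Real.exp_pos _)]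
  refine h.trans ?_
  norm_num [Finset.sum_range_succ, Nat.factorial]

lemma aux_F (F : ℝ) (s : ℝ) (j : ℕ) (hs : s = j / 20) (hF : F * (1 + (j:ℝ)/20) ≤ 0.9048374180 ^ j) :
    F ≤ Real.exp (-2*s)/(1+s) := by
  subst hs
  rw [le_div_iff₀ (by positivity)]
  refine hF.trans ?_
  have : Real.exp (-2*((j:ℝ)/20)) = Real.exp (-(1/10)) ^ j := by
    rw [← Real.exp_nat_mul]; congr 1; ring
  rw [this]
  exact pow_le_pow_left₀ (by norm_num) aux_exp_tenth j

lemma aux_chain : (0.1741900:ℝ) ≤ ∫ t in (0.41422:ℝ)..1.828, Real.exp (-2*t^2)/(1+t^2) := by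
  have h0 : (0:ℝ) ≤ ∫ t in (1.828:ℝ)..1.828, Real.exp (-2*t^2)/(1+t^2) := by simp
  have h1 := aux_step 1.688 1.828 1.828 (58/20) 0.000776296086 0 0.0000615489 (by norm_num) (by norm_num)
    (aux_F _ _ 58 (by norm_num) (by norm_num)) (by norm_num) h0 (by norm_num)
  have h2 := aux_step 1.658 1.688 1.828 (56/20) 0.000973122028 0.0000615489 0.0000908083 (by norm_num) (by norm_num)
    (aux_F _ _ 56 (by norm_num) (by norm_num)) (by norm_num) h1 (by norm_num)
  have h3 := aux_step 1.627 1.658 1.828 (54/20) 0.001220697549 0.0000908083 0.0001288315 (by norm_num) (by norm_num)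
    (aux_F _ _ 54 (by norm_num) (by norm_num)) (by norm_num) h2 (by norm_num)
  have h4 := aux_step 1.596 1.627 1.828 (52/20) 0.001532379002 0.0001288315 0.0001766585 (by norm_num) (by norm_num)
    (aux_F _ _ 52 (by norm_num) (by norm_num)) (by norm_num) h3 (by norm_num)
  have h5 := aux_step 1.565 1.596 1.828 (50/20) 0.001925127710 0.0001766585 0.0002366020 (by norm_num) (by norm_num)
    (aux_F _ _ 50 (by norm_num) (by norm_num)) (by norm_num) h4 (by norm_num)
  have h6 := aux_step 1.532 1.565 1.828 (48/20) 0.002420513833 0.0002366020 0.0003168558 (by norm_num) (by norm_num)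
    (aux_F _ _ 48 (by norm_num) (by norm_num)) (by norm_num) h5 (by norm_num)
  have h7 := aux_step 1.499 1.532 1.828 (46/20) 0.003046010826 0.0003168558 0.0004181077 (by norm_num) (by norm_num)
    (aux_F _ _ 46 (by norm_num) (by norm_num)) (by norm_num) h6 (by norm_num)
  have h8 := aux_step 1.466 1.499 1.828 (44/20) 0.003836668712 0.0004181077 0.0005453334 (by norm_num) (by norm_num)
    (aux_F _ _ 44 (by norm_num) (by norm_num)) (by norm_num) h7 (by norm_num)
  have h9 := aux_step 1.431 1.466 1.828 (42/20) 0.004837282837 0.0005453334 0.0007153247 (by norm_num) (by norm_num)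
    (aux_F _ _ 42 (by norm_num) (by norm_num)) (by norm_num) h8 (by norm_num)
  have h10 := aux_step 1.396 1.431 1.828 (40/20) 0.006105212953 0.0007153247 0.0009299622 (by norm_num) (by norm_num)
    (aux_F _ _ 40 (by norm_num) (by norm_num)) (by norm_num) h9 (by norm_num)
  have h11 := aux_step 1.359 1.396 1.828 (38/20) 0.007714059249 0.0009299622 0.0012169750 (by norm_num) (by norm_num)
    (aux_F _ _ 38 (by norm_num) (by norm_num)) (by norm_num) h10 (by norm_num)
  have h12 := aux_step 1.322 1.359 1.828 (36/20) 0.009758472288 0.0012169750 0.0015805454 (by norm_num) (by norm_num)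
    (aux_F _ _ 36 (by norm_num) (by norm_num)) (by norm_num) h11 (by norm_num)
  have h13 := aux_step 1.284 1.322 1.828 (34/20) 0.012360470338 0.0015805454 0.0020525486 (by norm_num) (by norm_num)
    (aux_F _ _ 34 (by norm_num) (by norm_num)) (by norm_num) h12 (by norm_num)
  have h14 := aux_step 1.244 1.284 1.828 (32/20) 0.015677770740 0.0020525486 0.0026829054 (by norm_num) (by norm_num)
    (aux_F _ _ 32 (by norm_num) (by norm_num)) (by norm_num) h13 (by norm_num)
  have h15 := aux_step 1.203 1.244 1.828 (30/20) 0.019914827323 0.0026829054 0.0035051112 (by norm_num) (by norm_num)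
    (aux_F _ _ 30 (by norm_num) (by norm_num)) (by norm_num) h14 (by norm_num)
  have h16 := aux_step 1.161 1.203 1.828 (28/20) 0.025337526065 0.0035051112 0.0045763056 (by norm_num) (by norm_num)
    (aux_F _ _ 28 (by norm_num) (by norm_num)) (by norm_num) h15 (by norm_num)
  have h17 := aux_step 1.117 1.161 1.828 (26/20) 0.032292860059 0.0045763056 0.0060059014 (by norm_num) (by norm_num)
    (aux_F _ _ 26 (by norm_num) (by norm_num)) (by norm_num) h16 (by norm_num)
  have h18 := aux_step 1.071 1.117 1.828 (24/20) 0.041235433274 0.0060059014 0.0079166414 (by norm_num) (by norm_num)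
    (aux_F _ _ 24 (by norm_num) (by norm_num)) (by norm_num) h17 (by norm_num)
  have h19 := aux_step 1.024 1.071 1.828 (22/20) 0.052763408697 0.0079166414 0.0104122396 (by norm_num) (by norm_num)
    (aux_F _ _ 22 (by norm_num) (by norm_num)) (by norm_num) h18 (by norm_num)
  have h20 := aux_step 0.987 1.024 1.828 (20/20) 0.067667641564 0.0104122396 0.0128461870 (by norm_num) (by norm_num)
    (aux_F _ _ 20 (by norm_num) (by norm_num)) (by norm_num) h19 (by norm_num)
  have h21 := aux_step 0.961 0.987 1.828 (19/20) 0.076701855953 0.0128461870 0.0148467877 (by norm_num) (by norm_num)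
    (aux_F _ _ 19 (by norm_num) (by norm_num)) (by norm_num) h20 (by norm_num)
  have h22 := aux_step 0.935 0.961 1.828 (18/20) 0.086999414791 0.0148467877 0.0171158565 (by norm_num) (by norm_num)
    (aux_F _ _ 18 (by norm_num) (by norm_num)) (by norm_num) h21 (by norm_num)
  have h23 := aux_step 0.908 0.935 1.828 (17/20) 0.098747850772 0.0171158565 0.0197873115 (by norm_num) (by norm_num)
    (aux_F _ _ 17 (by norm_num) (by norm_num)) (by norm_num) h22 (by norm_num)
  have h24 := aux_step 0.88 0.908 1.828 (16/20) 0.112164732147 0.0197873115 0.0229335315 (by norm_num) (by norm_num)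
    (aux_F _ _ 16 (by norm_num) (by norm_num)) (by norm_num) h23 (by norm_num)
  have h25 := aux_step 0.851 0.88 1.828 (15/20) 0.127502948580 0.0229335315 0.0266391006 (by norm_num) (by norm_num)
    (aux_F _ _ 15 (by norm_num) (by norm_num)) (by norm_num) h24 (by norm_num)
  have h26 := aux_step 0.821 0.851 1.828 (14/20) 0.145057037532 0.0266391006 0.0310024016 (by norm_num) (by norm_num)
    (aux_F _ _ 14 (by norm_num) (by norm_num)) (by norm_num) h25 (by norm_num)
  have h27 := aux_step 0.79 0.821 1.828 (13/20) 0.165170783571 0.0310024016 0.0361372361 (by norm_num) (by norm_num)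
    (aux_F _ _ 13 (by norm_num) (by norm_num)) (by norm_num) h26 (by norm_num)
  have h28 := aux_step 0.758 0.79 1.828 (12/20) 0.188246382355 0.0361372361 0.0421743819 (by norm_num) (by norm_num)
    (aux_F _ _ 12 (by norm_num) (by norm_num)) (by norm_num) h27 (by norm_num)
  have h29 := aux_step 0.724 0.758 1.828 (11/20) 0.214755537775 0.0421743819 0.0494919592 (by norm_num) (by norm_num)
    (aux_F _ _ 11 (by norm_num) (by norm_num)) (by norm_num) h28 (by norm_num)
  have h30 := aux_step 0.689 0.724 1.828 (10/20) 0.245252960683 0.0494919592 0.0580931102 (by norm_num) (by norm_num)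
    (aux_F _ _ 10 (by norm_num) (by norm_num)) (by norm_num) h29 (by norm_num)
  have h31 := aux_step 0.651 0.689 1.828 (9/20) 0.280392868686 0.0580931102 0.0687761145 (by norm_num) (by norm_num)
    (aux_F _ _ 9 (by norm_num) (by norm_num)) (by norm_num) h30 (by norm_num)
  have h32 := aux_step 0.612 0.651 1.828 (8/20) 0.320949259981 0.0687761145 0.0813298623 (by norm_num) (by norm_num)
    (aux_F _ _ 8 (by norm_num) (by norm_num)) (by norm_num) h31 (by norm_num)
  have h33 := aux_step 0.569 0.612 1.828 (7/20) 0.367840965669 0.0813298623 0.0971971228 (by norm_num) (by norm_num)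
    (aux_F _ _ 7 (by norm_num) (by norm_num)) (by norm_num) h32 (by norm_num)
  have h34 := aux_step 0.524 0.569 1.828 (6/20) 0.422162796894 0.0971971228 0.1162559473 (by norm_num) (by norm_num)
    (aux_F _ _ 6 (by norm_num) (by norm_num)) (by norm_num) h33 (by norm_num)
  have h35 := aux_step 0.474 0.524 1.828 (5/20) 0.485224527673 0.1162559473 0.1405708848 (by norm_num) (by norm_num)
    (aux_F _ _ 5 (by norm_num) (by norm_num)) (by norm_num) h34 (by norm_num)
  have h36 := aux_step 0.41422 0.474 1.828 (4/20) 0.558600038274 0.1405708848 0.1741975496 (by norm_num) (by norm_num)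
    (aux_F _ _ 4 (by norm_num) (by norm_num)) (by norm_num) h35 (by norm_num)
  refine le_trans ?_ h36
  norm_num

lemma aux_inner (t : ℝ) :
    ∫⁻ x in Set.Ioi (2:ℝ), ENNReal.ofReal (x * Real.exp (-(1+t^2)/2*x^2)) =
      ENNReal.ofReal (Real.exp (-2) * (Real.exp (-2*t^2)/(1+t^2))) := by
  have hp : 0 < 1 + t^2 := by positivity
  have hd : ∀ x ∈ Set.Ici (2:ℝ), HasDerivAt (fun x : ℝ => -(Real.exp (-(1+t^2)/2*x^2)/(1+t^2)))
      (x * Real.exp (-(1+t^2)/2*x^2)) x := by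
    intro x _
    have h1 : HasDerivAt (fun x : ℝ => -(1+t^2)/2*x^2) (-(1+t^2)/2*(2*x)) x := by
      have := (hasDerivAt_pow 2 x).const_mul (-(1+t^2)/2)
      norm_num only [Nat.cast_ofNat, pow_one] at this
      convert! this using 1
    convert! (h1.exp.div_const (1+t^2)).neg using 1
    field_simp
  have hpos : ∀ x ∈ Set.Ioi (2:ℝ), 0 ≤ x * Real.exp (-(1+t^2)/2*x^2) := by
    intro x hx
    have : (0:ℝ) < x := lt_trans (by norm_num) hx
    positivity
  have hl : Filter.Tendsto (fun x : ℝ => -(Real.exp (-(1+t^2)/2*x^2)/(1+t^2))) Filter.atTop (nhds 0) := by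
    have h1 : Filter.Tendsto (fun x : ℝ => -(1+t^2)/2*x^2) Filter.atTop Filter.atBot :=
      Filter.Tendsto.const_mul_atTop_of_neg (by linarith) (Filter.tendsto_pow_atTop (by norm_num))
    simpa using ((Real.tendsto_exp_atBot.comp h1).div_const (1+t^2)).neg
  have hi := integrableOn_Ioi_deriv_of_nonneg' hd hpos hl
  have hv := integral_Ioi_of_hasDerivAt_of_nonneg' hd hpos hl
  rw [← ofReal_integral_eq_lintegral_ofReal hi ((ae_restrict_iff' measurableSet_Ioi).2 (ae_of_all _ hpos)), hv]
  congr 1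
  rw [← mul_div_assoc, ← Real.exp_add]
  simp only [zero_sub, neg_neg]
  congr 2
  ring

lemma aux_scale (t0 x : ℝ) (hx : 0 < x) (g : ℝ → ENNReal) :
    ∫⁻ y in Set.Ioi (t0 * x), g y = ∫⁻ t in Set.Ioi t0, ENNReal.ofReal x * g (t * x) := by
  have h := lintegral_image_eq_lintegral_abs_deriv_mul (s := Set.Ioi t0) (f := fun t => t * x)
    (f' := fun _ => x) measurableSet_Ioi
    (fun t _ => by simpa using ((hasDerivAt_id t).mul_const x).hasDerivWithinAt)
    (fun a _ b _ hab => mul_right_cancel₀ hx.ne' hab) g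
  have himg : Set.image (fun t => t * x) (Set.Ioi t0) = Set.Ioi (t0 * x) := by
    ext y
    constructor
    · rintro ⟨t, ht, rfl⟩
      exact mul_lt_mul_of_pos_right ht hx
    · intro hy
      exact ⟨y / x, (lt_div_iff₀ hx).2 hy, div_mul_cancel₀ y hx.ne'⟩
  rw [himg] at h
  rw [h, abs_of_pos hx]

lemma aux_wedge_std (t0 : ℝ) (ht0 : t0 ≤ 0.41422) :
    ENNReal.ofReal 0.00375 ≤ ((gaussianReal 0 1).prod (gaussianReal 0 1))
      {p : ℝ × ℝ | 2 ≤ p.1 ∧ t0 * p.1 < p.2} := by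
  have hm : MeasurableSet {p : ℝ × ℝ | 2 ≤ p.1 ∧ t0 * p.1 < p.2} :=
    (measurableSet_le measurable_const measurable_fst).inter
      (measurableSet_lt (measurable_fst.const_mul t0) measurable_snd)
  have hpdf : ∀ x t : ℝ, 0 < x → gaussianPDF 0 1 x * (ENNReal.ofReal x * gaussianPDF 0 1 (t * x))
      = ENNReal.ofReal (1/(2*Real.pi)) * ENNReal.ofReal (x * Real.exp (-(1+t^2)/2*x^2)) := by
    intro x t hx
    have hs : (√(2 * Real.pi))⁻¹ * (√(2 * Real.pi))⁻¹ = 1/(2*Real.pi) := by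
      rw [← mul_inv, Real.mul_self_sqrt (by positivity), one_div]
    simp only [gaussianPDF, gaussianPDFReal]
    rw [← ENNReal.ofReal_mul (by positivity), ← ENNReal.ofReal_mul (by positivity),
      ← ENNReal.ofReal_mul (by positivity), ← hs]
    congr 1
    have : Real.exp (-(1+t^2)/2*x^2) = Real.exp (-(x-0)^2/(2*(1:NNReal))) * Real.exp (-(t*x-0)^2/(2*(1:NNReal))) := by
      rw [← Real.exp_add]; congr 1; push_cast; ring
    rw [this]
    simp only [NNReal.coe_one, mul_one]
    ring
  have hmeas2 : Measurable (fun z : ℝ × ℝ => ENNReal.ofReal (1/(2*Real.pi)) * ENNReal.ofReal (z.1 * Real.exp (-(1+z.2^2)/2*z.1^2))) := by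
    fun_prop
  rw [Measure.prod_apply hm]
  conv_rhs => rw [gaussianReal_of_var_ne_zero 0 (one_ne_zero)]
  rw [lintegral_withDensity_eq_lintegral_mul _ (measurable_gaussianPDF 0 1)
    (by rw [← gaussianReal_of_var_ne_zero 0 (one_ne_zero)]; exact measurable_measure_prodMk_left hm)]
  calc ENNReal.ofReal 0.00375 
      ≤ ENNReal.ofReal (1/(2*Real.pi)) * ENNReal.ofReal (Real.exp (-2) * ∫ t in (0.41422:ℝ)..1.828, Real.exp (-2*t^2)/(1+t^2)) := by
        rw [← ENNReal.ofReal_mul (by positivity)]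
        apply ENNReal.ofReal_le_ofReal
        have h1 := aux_chain
        have h2 : (0.13533528:ℝ) ≤ Real.exp (-2) := by
          have : Real.exp (-2) = (Real.exp 1 ^ 2)⁻¹ := by
            rw [← Real.exp_nat_mul, ← Real.exp_neg]; norm_num
          rw [this, le_inv_comm₀ (by norm_num) (by positivity)]
          have := Real.exp_one_lt_d9
          calc Real.exp 1 ^ 2 ≤ 2.7182818286 ^ 2 := by gcongr
            _ ≤ _ := by norm_num
        have h3 := Real.pi_lt_d6
        have h4 := Real.pi_pos
        rw [one_div, inv_mul_eq_div, le_div_iff₀ (by positivity)]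
        have h5 : (0.13533528:ℝ) * 0.1741900 ≤ Real.exp (-2) * ∫ t in (0.41422:ℝ)..1.828, Real.exp (-2*t^2)/(1+t^2) := by
          gcongr
        refine le_trans ?_ h5
        norm_num at h3 ⊢
        linarith
    _ = ENNReal.ofReal (1/(2*Real.pi)) * ∫⁻ t in Set.Ioc (0.41422:ℝ) 1.828, ENNReal.ofReal (Real.exp (-2) * (Real.exp (-2*t^2)/(1+t^2))) := by
        rw [← intervalIntegral.integral_const_mul, intervalIntegral.integral_of_le (by norm_num),
          ofReal_integral_eq_lintegral_ofReal]
        · exact ((aux_cont.const_mul _).intervalIntegrable 0.41422 1.828).1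
        · exact ae_of_all _ (fun t => by positivity)
    _ ≤ ENNReal.ofReal (1/(2*Real.pi)) * ∫⁻ t in Set.Ioi t0, ENNReal.ofReal (Real.exp (-2) * (Real.exp (-2*t^2)/(1+t^2))) := by
        gcongr
        intro t ht
        exact lt_of_le_of_lt ht0 ht.1
    _ = ∫⁻ t in Set.Ioi t0, ∫⁻ x in Set.Ioi (2:ℝ), ENNReal.ofReal (1/(2*Real.pi)) * ENNReal.ofReal (x * Real.exp (-(1+t^2)/2*x^2)) := by
        rw [← lintegral_const_mul' _ _ ENNReal.ofReal_ne_top]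
        refine lintegral_congr fun t => ?_
        rw [lintegral_const_mul' _ _ ENNReal.ofReal_ne_top, aux_inner]
    _ = ∫⁻ x in Set.Ioi (2:ℝ), ∫⁻ t in Set.Ioi t0, ENNReal.ofReal (1/(2*Real.pi)) * ENNReal.ofReal (x * Real.exp (-(1+t^2)/2*x^2)) :=
        lintegral_lintegral_swap (by
          exact (hmeas2.comp measurable_swap).aemeasurable)
    _ = ∫⁻ x in Set.Ioi (2:ℝ), gaussianPDF 0 1 x * gaussianReal 0 1 (Set.Ioi (t0 * x)) := by
        refine setLIntegral_congr_fun measurableSet_Ioi fun x hx => ?_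
        have hx0 : (0:ℝ) < x := lt_trans (by norm_num) hx
        rw [gaussianReal_apply 0 one_ne_zero, aux_scale t0 x hx0,
          ← lintegral_const_mul' _ _ (by simp [gaussianPDF])]
        refine lintegral_congr fun t => ?_
        rw [hpdf x t hx0]
    _ ≤ _ := by
        refine le_trans ?_ (setLIntegral_le_lintegral (Set.Ioi (2:ℝ)) _)
        refine setLIntegral_mono' measurableSet_Ioi fun x hx => ?_
        simp only [Pi.mul_apply]
        gcongr
        · rw [gaussianReal_of_var_ne_zero 0 (one_ne_zero)]
        · intro y hy
          exact ⟨le_of_lt hx, hy⟩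

lemma aux_map (p q : Fin 2 → ℝ) (hpp : p 0 ^ 2 + p 1 ^ 2 = 1) (hqq : q 0 ^ 2 + q 1 ^ 2 = 1)
    (hpq : p 0 * q 0 + p 1 * q 1 = 0) (s : Set (ℝ × ℝ)) (hs : MeasurableSet s) :
    (Measure.pi fun _ : Fin 2 => gaussianReal 0 1)
      {v | (p 0 * v 0 + p 1 * v 1, q 0 * v 0 + q 1 * v 1) ∈ s} =
    ((gaussianReal 0 1).prod (gaussianReal 0 1)) s := by
  let li : EuclideanSpace ℝ (Fin 2) →ₗᵢ[ℝ] EuclideanSpace ℝ (Fin 2) :=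
    { toFun := fun v => !₂[p 0 * v 0 + p 1 * v 1, q 0 * v 0 + q 1 * v 1]
      map_add' := by
        intro x y; ext i; fin_cases i <;> simp <;> ring
      map_smul' := by
        intro c x; ext i; fin_cases i <;> simp <;> ring
      norm_map' := by
        intro x
        have hc1 : p 0 ^ 2 + q 0 ^ 2 = 1 := by
          grind
        have hc2 : p 1 ^ 2 + q 1 ^ 2 = 1 := by linarith
        have hc3 : p 0 * p 1 + q 0 * q 1 = 0 := by
          grind
        simp [EuclideanSpace.norm_eq, Fin.sum_univ_two]
        congr 1
        linear_combination (x 0)^2 * hc1 + (x 1)^2 * hc2 + 2 * x 0 * x 1 * hc3 }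
  let e := li.toLinearIsometryEquiv rfl
  have h1 := stdGaussian_map e
  rw [← map_pi_eq_stdGaussian, Measure.map_map (by fun_prop) (by fun_prop)] at h1
  have h2 := measurePreserving_finTwoArrow (gaussianReal 0 1)
  let S : Set (EuclideanSpace ℝ (Fin 2)) := {v | (v 0, v 1) ∈ s}
  have hS : MeasurableSet S := by
    apply hs.preimage (f := fun v : EuclideanSpace ℝ (Fin 2) => (v 0, v 1))
    fun_prop
  have h3 := congrArg (fun m => m S) h1
  rw [Measure.map_apply (by fun_prop) hS, Measure.map_apply (by fun_prop) hS] at h3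
  rw [← h2.measure_preimage hs.nullMeasurableSet]
  exact h3

lemma aux_pair (p w : Fin 2 → ℝ) (hpp : p 0 ^ 2 + p 1 ^ 2 = 1) (hww : w 0 ^ 2 + w 1 ^ 2 = 1)
    (hpw : √2 * (p 0 * w 0 + p 1 * w 1) = 1) :
    ENNReal.ofReal 0.00375 ≤ (Measure.pi fun _ : Fin 2 => gaussianReal 0 1)
      {v | 2 ≤ p 0 * v 0 + p 1 * v 1 ∧ p 0 * v 0 + p 1 * v 1 < w 0 * v 0 + w 1 * v 1} := by
  have h2 : √2 ^ 2 = (2:ℝ) := Real.sq_sqrt (by norm_num)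
  have hlt : √2 - 1 ≤ 0.41422 := by
    have : √2 ≤ 1.41422 := Real.sqrt_le_iff.2 (by norm_num)
    norm_num at this ⊢
    linarith
  have hpos : 0 < √2 := by positivity
  have hm : MeasurableSet {p : ℝ × ℝ | 2 ≤ p.1 ∧ (√2 - 1) * p.1 < p.2} :=
    (measurableSet_le measurable_const measurable_fst).inter
      (measurableSet_lt (measurable_fst.const_mul _) measurable_snd)
  have h := aux_map p (fun i => √2 * w i - p i) hpp
    (by linear_combination h2 * (w 0 ^ 2 + w 1 ^ 2) + 2 * hww + hpp - 2 * hpw)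
    (by linear_combination hpw - hpp) _ hm
  refine (aux_wedge_std _ hlt).trans (h.symm.le.trans (measure_mono ?_))
  rintro v ⟨h3, h4⟩
  refine ⟨h3, ?_⟩
  simp only at h4
  refine lt_of_mul_lt_mul_left ?_ hpos.le
  linarith

lemma aux_two (p w : Fin 2 → ℝ) (hpp : p 0 ^ 2 + p 1 ^ 2 = 1) (hww : w 0 ^ 2 + w 1 ^ 2 = 1)
    (hpw : √2 * (p 0 * w 0 + p 1 * w 1) = 1) (S : Set (Fin 2 → ℝ))
    (hS : ∀ v : Fin 2 → ℝ, 2 ≤ p 0 * v 0 + p 1 * v 1 → 2 ≤ w 0 * v 0 + w 1 * v 1 → v ∈ S) :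
    0.0075 ≤ ((Measure.pi fun _ : Fin 2 => gaussianReal 0 1) S).toReal := by
  have h1 := aux_pair p w hpp hww hpw
  have h2 := aux_pair w p hww hpp (by linarith)
  have hm : MeasurableSet {v : Fin 2 → ℝ | 2 ≤ w 0 * v 0 + w 1 * v 1 ∧
      w 0 * v 0 + w 1 * v 1 < p 0 * v 0 + p 1 * v 1} :=
    (measurableSet_le (f := fun v : Fin 2 → ℝ => 2) (g := fun v : Fin 2 → ℝ => w 0 * v 0 + w 1 * v 1) (by fun_prop) (by fun_prop)).inter
      (measurableSet_lt (f := fun v : Fin 2 → ℝ => w 0 * v 0 + w 1 * v 1) (g := fun v : Fin 2 → ℝ => p 0 * v 0 + p 1 * v 1) (by fun_prop) (by fun_prop))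
  have hd : Disjoint {v : Fin 2 → ℝ | 2 ≤ p 0 * v 0 + p 1 * v 1 ∧
      p 0 * v 0 + p 1 * v 1 < w 0 * v 0 + w 1 * v 1}
      {v : Fin 2 → ℝ | 2 ≤ w 0 * v 0 + w 1 * v 1 ∧
      w 0 * v 0 + w 1 * v 1 < p 0 * v 0 + p 1 * v 1} :=
    Set.disjoint_left.2 fun v ha hb => lt_asymm ha.2 hb.2
  rw [← ENNReal.ofReal_le_iff_le_toReal (measure_ne_top _ _)]
  calc ENNReal.ofReal 0.0075 = ENNReal.ofReal 0.00375 + ENNReal.ofReal 0.00375 := by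
        rw [← ENNReal.ofReal_add (by norm_num) (by norm_num)]; norm_num
    _ ≤ _ := add_le_add h1 h2
    _ = _ := (measure_union hd hm).symm
    _ ≤ _ := measure_mono (by
        rintro v (⟨ha, hb⟩ | ⟨ha, hb⟩)
        · exact hS v ha (ha.trans hb.le)
        · exact hS v (ha.trans hb.le) ha)

/-- **Quantum score in the macroscopic CHSH game.** If `(A₀, B₀)` is bivariate Gaussian
with means `N/2`, variances `N/4`, and covariance `N/(4√2)` (the statistics of `N`
singlet pairs played with the optimal CHSH strategy, in the central-limit regime), then
`P(A₀ ≥ N/2 + √N ∧ B₀ ≥ N/2 + √N) + P(A₀ ≤ N/2 − √N ∧ B₀ ≤ N/2 − √N) ≥ 0.0150`. -/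
theorem macroscopic_chsh_quantum_score (N : ℝ) (hN : 0 < N)
    (μ : Measure (Fin 2 → ℝ))
    (hG : IsGaussianWith μ (fun _ => N / 2)
      !![N / 4, N / (4 * Real.sqrt 2); N / (4 * Real.sqrt 2), N / 4]) :
    (μ {v | N / 2 + Real.sqrt N ≤ v 0 ∧ N / 2 + Real.sqrt N ≤ v 1}).toReal
      + (μ {v | v 0 ≤ N / 2 - Real.sqrt N ∧ v 1 ≤ N / 2 - Real.sqrt N}).toReal
      ≥ 0.0150 := by
  obtain ⟨L, hL, rfl⟩ := hG
  have hsN : 0 < √N := Real.sqrt_pos.2 hN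
  have hsq : √N ^ 2 = N := Real.sq_sqrt hN.le
  have h2 : √2 ^ 2 = (2:ℝ) := Real.sq_sqrt (by norm_num)
  have h2p : 0 < √2 := by positivity
  have e00 := congrFun (congrFun hL 0) 0
  have e01 := congrFun (congrFun hL 0) 1
  have e11 := congrFun (congrFun hL 1) 1
  simp [Matrix.mul_apply, Fin.sum_univ_two] at e00 e01 e11
  have hpp : (2/√N * L 0 0) ^ 2 + (2/√N * L 0 1) ^ 2 = 1 := by
    field_simp
    rw [hsq]
    linarith
  have hww : (2/√N * L 1 0) ^ 2 + (2/√N * L 1 1) ^ 2 = 1 := by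
    field_simp
    rw [hsq]
    linarith
  have hpw : √2 * ((2/√N * L 0 0) * (2/√N * L 1 0) + (2/√N * L 0 1) * (2/√N * L 1 1)) = 1 := by
    have : (2/√N * L 0 0) * (2/√N * L 1 0) + (2/√N * L 0 1) * (2/√N * L 1 1)
        = 4 / √N^2 * (L 0 0 * L 1 0 + L 0 1 * L 1 1) := by ring
    rw [this, e01, hsq]
    field_simp
  have hscale : ∀ z : ℝ, 2 ≤ 2/√N * z → √N ≤ z := by
    intro z hz
    rw [div_mul_eq_mul_div, le_div_iff₀ hsN] at hz
    linarith
  have hmeas : Measurable (fun x : Fin 2 → ℝ => (fun _ => N / 2) + L.mulVec x) :=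
    Continuous.measurable (by fun_prop)
  have hU : MeasurableSet {v : Fin 2 → ℝ | N / 2 + √N ≤ v 0 ∧ N / 2 + √N ≤ v 1} :=
    (measurableSet_le (f := fun v : Fin 2 → ℝ => N / 2 + √N) (g := fun v : Fin 2 → ℝ => v 0) (by fun_prop) (by fun_prop)).inter
      (measurableSet_le (f := fun v : Fin 2 → ℝ => N / 2 + √N) (g := fun v : Fin 2 → ℝ => v 1) (by fun_prop) (by fun_prop))
  have hD : MeasurableSet {v : Fin 2 → ℝ | v 0 ≤ N / 2 - √N ∧ v 1 ≤ N / 2 - √N} :=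
    (measurableSet_le (f := fun v : Fin 2 → ℝ => v 0) (g := fun v : Fin 2 → ℝ => N / 2 - √N) (by fun_prop) (by fun_prop)).inter
      (measurableSet_le (f := fun v : Fin 2 → ℝ => v 1) (g := fun v : Fin 2 → ℝ => N / 2 - √N) (by fun_prop) (by fun_prop))
  rw [Measure.map_apply hmeas hU, Measure.map_apply hmeas hD, stdGaussianPi]
  have hA := aux_two (fun i => 2/√N * L 0 i) (fun i => 2/√N * L 1 i) hpp hww hpw
    ((fun x : Fin 2 → ℝ => (fun _ => N / 2) + L.mulVec x) ⁻¹'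
      {v : Fin 2 → ℝ | N / 2 + √N ≤ v 0 ∧ N / 2 + √N ≤ v 1}) (by
      intro v h0 h1
      have k0 := hscale (L 0 0 * v 0 + L 0 1 * v 1) (by linarith)
      have k1 := hscale (L 1 0 * v 0 + L 1 1 * v 1) (by linarith)
      simp only [Set.mem_preimage, Set.mem_ofPred_eq, Pi.add_apply, Matrix.mulVec, dotProduct,
        Fin.sum_univ_two]
      constructor <;> linarith)
  have hB := aux_two (fun i => -(2/√N * L 0 i)) (fun i => -(2/√N * L 1 i))
    (by linarith) (by linarith) (by linarith)
    ((fun x : Fin 2 → ℝ => (fun _ => N / 2) + L.mulVec x) ⁻¹'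
      {v : Fin 2 → ℝ | v 0 ≤ N / 2 - √N ∧ v 1 ≤ N / 2 - √N}) (by
      intro v h0 h1
      have k0 := hscale (-(L 0 0 * v 0 + L 0 1 * v 1)) (by linarith)
      have k1 := hscale (-(L 1 0 * v 0 + L 1 1 * v 1)) (by linarith)
      simp only [Set.mem_preimage, Set.mem_ofPred_eq, Pi.add_apply, Matrix.mulVec, dotProduct,
        Fin.sum_univ_two]
      constructor <;> linarith)
  norm_num at hA hB ⊢
  linarith
end
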